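/- Let A and B be nonzero integers such that the Lucas sequence of the first kind u corresponding to (A,B) is non-degenerate, and assume that (A,B) is none of the pairs (1,1), (-1,1), (1,2), (-1,2), (-1,-2). Then the set of triples (k,l,m) of nonnegative integers such that u_k < u_l < u_m and u_k + u_m = 2·u_l is finite, and its cardinality is at most 645·10^2338 (i.e., 6.45·10^2340). -/

import Mathlib

/-- Lucas sequence of the first kind for parameters `A`, `B`:
`u 0 = 0`, `u 1 = 1`, `u (n+2) = A * u (n+1) + B * u n`. -/
def lucasU (A B : ℤ) : ℕ → ℤ
  | 0 => 0
  | 1 => 1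
  | n + 2 => A * lucasU A B (n + 1) + B * lucasU A B n

section

open Polynomial

/-- The Euler operator `X * d/dX + d` on polynomials. -/
noncomputable def eulerOp (d : ℕ) : ℂ[X] →ₗ[ℂ] ℂ[X] :=
  LinearMap.mulLeft ℂ X ∘ₗ derivative + (d : ℂ) • LinearMap.id

theorem eulerOp_apply (d : ℕ) (f : ℂ[X]) : eulerOp d f = X * derivative f + C (d : ℂ) * f := by
  simp [eulerOp, smul_eq_C_mul]

theorem eulerOp_zero_X_pow_mul (d : ℕ) (f : ℂ[X]) :
    eulerOp 0 (X ^ d * f) = X ^ d * eulerOp d f := by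
  rw [eulerOp_apply, eulerOp_apply]
  rcases d with _ | d
  · simp
  · simp [derivative_mul]
    ring

theorem eulerOp_zero_pow_X_pow_mul (d i : ℕ) (f : ℂ[X]) :
    (eulerOp 0 ^ i) (X ^ d * f) = X ^ d * (eulerOp d ^ i) f := by
  induction i generalizing f with
  | zero => simp
  | succ i ih => rw [pow_succ, pow_succ, Module.End.mul_apply, Module.End.mul_apply,
      eulerOp_zero_X_pow_mul, ih]

theorem natDegree_eulerOp_pow_le (d i : ℕ) (f : ℂ[X]) :
    ((eulerOp d ^ i) f).natDegree ≤ f.natDegree := by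
  induction i generalizing f with
  | zero => simp
  | succ i ih =>
    rw [pow_succ, Module.End.mul_apply]
    refine (ih _).trans ?_
    rw [eulerOp_apply]
    refine natDegree_add_le_of_degree_le ?_ (natDegree_C_mul_le _ _)
    by_cases h : f.natDegree = 0
    · rw [natDegree_eq_zero] at h
      obtain ⟨c, rfl⟩ := h
      simp
    · refine natDegree_mul_le.trans ?_
      have := natDegree_derivative_le f
      simp
      omega

theorem eval_zero_eulerOp_pow (d i : ℕ) (f : ℂ[X]) :
    ((eulerOp d ^ i) f).eval 0 = (d : ℂ) ^ i * f.eval 0 := by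
  induction i generalizing f with
  | zero => simp
  | succ i ih =>
    rw [pow_succ, Module.End.mul_apply, ih, eulerOp_apply]
    simp
    ring

theorem X_sub_C_pow_dvd_eulerOp_pow (c : ℂ) (d i n : ℕ) (f : ℂ[X]) (h : (X - C c) ^ n ∣ f) :
    (X - C c) ^ (n - i) ∣ (eulerOp d ^ i) f := by
  induction i generalizing n f with
  | zero => simpa using h
  | succ i ih =>
    rw [pow_succ, Module.End.mul_apply, show n - (i + 1) = (n - 1) - i by omega]
    apply ih
    rw [eulerOp_apply]
    refine dvd_add (Dvd.dvd.mul_left ?_ _) (Dvd.dvd.mul_left ((pow_dvd_pow _ (by omega)).trans h) _)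
    exact pow_sub_one_dvd_derivative_of_pow_dvd h

theorem X_sub_C_pow_dvd_det {p : ℕ} (f : Fin p → ℂ[X]) (y : Fin p → ℂ) (j : Fin p) (hy : y j ≠ 0)
    (c : ℂ) (n : ℕ) (h : (X - C c) ^ n ∣ ∑ i, C (y i) * f i) :
    (X - C c) ^ (n - (p - 1)) ∣
      (Matrix.of fun i k : Fin p => (eulerOp 0 ^ (i : ℕ)) (f k)).det := by
  set W := Matrix.of fun i k : Fin p => (eulerOp 0 ^ (i : ℕ)) (f k) with hW
  have h1 := Matrix.det_updateCol_sum W j (fun i => C (y i))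
  have h2 : (X - C c) ^ (n - (p - 1)) ∣ (W.updateCol j fun k => ∑ i, C (y i) • W k i).det := by
    have h3 : ∀ k : Fin p, (X - C c) ^ (n - (p - 1)) ∣ ∑ i, C (y i) • W k i := by
      intro k
      have h4 : ∑ i, C (y i) • W k i = (eulerOp 0 ^ (k : ℕ)) (∑ i, C (y i) * f i) := by
        rw [map_sum]
        refine Finset.sum_congr rfl fun i _ => ?_
        rw [← smul_eq_C_mul, map_smul, smul_eq_mul, smul_eq_C_mul]
        rfl
      rw [h4]
      refine (pow_dvd_pow _ ?_).trans (X_sub_C_pow_dvd_eulerOp_pow c 0 k n _ h)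
      omega
    choose q hq using h3
    have h5 : (fun k => ∑ i, C (y i) • W k i) = (X - C c) ^ (n - (p - 1)) • q := by
      funext k; rw [hq]; rfl
    rw [h5, Matrix.det_updateCol_smul]
    exact Dvd.intro _ rfl
  rw [h1, smul_eq_mul] at h2
  exact (IsUnit.dvd_mul_left (isUnit_C.mpr (isUnit_iff_ne_zero.mpr hy))).mp h2

theorem natDegree_det_le_mul {p v : ℕ} (M : Matrix (Fin p) (Fin p) ℂ[X])
    (h : ∀ i j, (M i j).natDegree ≤ v) : M.det.natDegree ≤ p * v := by
  rw [Matrix.det_apply]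
  refine natDegree_sum_le_of_forall_le _ _ fun σ _ => ?_
  refine (natDegree_smul_le _ _).trans ((natDegree_prod_le _ _).trans ?_)
  refine (Finset.sum_le_sum fun i _ => h (σ i) i).trans ?_
  simp

theorem zero_estimate_fin {p v m n : ℕ} (d : Fin p → ℕ) (hd : Function.Injective d)
    (h : Fin p → ℂ[X]) (h0 : ∀ j, (h j).eval 0 ≠ 0) (hv : ∀ j, (h j).natDegree ≤ v)
    (hp : 0 < p) (y : Fin p → ℂ) (hy : ∀ j, y j ≠ 0) (c : ℂ) (hc0 : c ≠ 0) (hc1 : c ≠ 1)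
    (hm : (X - C (1 : ℂ)) ^ m ∣ ∑ j, X ^ d j * h j)
    (hn : (X - C c) ^ n ∣ ∑ j, C (y j) * (X ^ d j * h j)) :
    m + n ≤ p * v + 2 * (p - 1) := by
  set V := (Matrix.of fun i k : Fin p => (eulerOp (d k) ^ (i : ℕ)) (h k)).det with hV
  have hW : (Matrix.of fun i k : Fin p => (eulerOp 0 ^ (i : ℕ)) (X ^ d k * h k)).det =
      (∏ k, X ^ d k) * V := by
    rw [hV, ← Matrix.det_mul_row]
    congr 1
    ext1 i k
    simp only [Matrix.of_apply]
    rw [eulerOp_zero_pow_X_pow_mul]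
  have hV0 : V ≠ 0 := by
    intro hV1
    have : V.eval 0 = (Matrix.of fun i k : Fin p => (d k : ℂ) ^ (i : ℕ) * (h k).eval 0).det := by
      rw [hV, ← coe_evalRingHom, RingHom.map_det]
      congr 1
      ext1 i k
      simp [eval_zero_eulerOp_pow]
    rw [hV1, eval_zero] at this
    have h2 : (Matrix.of fun i k : Fin p => (d k : ℂ) ^ (i : ℕ) * (h k).eval 0) =
      Matrix.of fun i k : Fin p => (h k).eval 0 * (Matrix.vandermonde fun k => (d k : ℂ)).transpose i k := by
      ext1 i k; simp [Matrix.vandermonde, mul_comm]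
    rw [h2, Matrix.det_mul_row, Matrix.det_transpose] at this
    rcases mul_eq_zero.mp this.symm with h3 | h3
    · rw [Finset.prod_eq_zero_iff] at h3
      obtain ⟨j, _, hj⟩ := h3
      exact h0 j hj
    · refine Matrix.det_vandermonde_ne_zero_iff.mpr ?_ h3
      intro a b hab
      exact hd (Nat.cast_injective hab)
  have key : ∀ (c : ℂ) (n : ℕ) (y : Fin p → ℂ), (∀ j, y j ≠ 0) → c ≠ 0 →
      (X - C c) ^ n ∣ ∑ j, C (y j) * (X ^ d j * h j) → (X - C c) ^ (n - (p - 1)) ∣ V := by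
    intro c n y hy hc h1
    have h2 := X_sub_C_pow_dvd_det (fun j => X ^ d j * h j) y ⟨0, hp⟩ (hy _) c n h1
    rw [hW, Finset.prod_pow_eq_pow_sum] at h2
    refine IsCoprime.dvd_of_dvd_mul_left (IsCoprime.pow_right (IsCoprime.pow_left ?_)) h2
    have := isCoprime_X_sub_C_of_isUnit_sub (R := ℂ) (a := c) (b := 0) (by simpa using hc)
    simpa using this
  have k1 := key 1 m (fun _ => 1) (by simp) one_ne_zero (by simpa using hm)
  have k2 := key c n y hy hc0 hn
  have k3 : (X - C (1 : ℂ)) ^ (m - (p - 1)) * (X - C c) ^ (n - (p - 1)) ∣ V := by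
    refine IsCoprime.mul_dvd (IsCoprime.pow_right (IsCoprime.pow_left ?_)) k1 k2
    exact isCoprime_X_sub_C_of_isUnit_sub
      (isUnit_iff_ne_zero.mpr (sub_ne_zero.mpr hc1.symm))
  have k4 := natDegree_le_of_dvd k3 hV0
  rw [natDegree_mul (pow_ne_zero _ (X_sub_C_ne_zero _)) (pow_ne_zero _ (X_sub_C_ne_zero _)),
    natDegree_pow, natDegree_pow,
    natDegree_X_sub_C, natDegree_X_sub_C] at k4
  have k5 : V.natDegree ≤ p * v := natDegree_det_le_mul _ fun i j =>
    (natDegree_eulerOp_pow_le _ _ _).trans (hv j)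
  omega

/-- Zero estimate: a lacunary combination of polynomials with separated lowest terms cannot vanish
to high order both at `1` and, after twisting the summands, at another point. -/
theorem zero_estimate {ι : Type*} [Fintype ι] {v m n : ℕ} (k : ι → ℕ) (A : ι → ℂ[X])
    (hv : ∀ j, (A j).natDegree ≤ v)
    (hk : ∀ i j, i ≠ j → A i ≠ 0 → A j ≠ 0 → k i + v < k j ∨ k j + v < k i)
    (hA : ∃ j, A j ≠ 0) (y : ι → ℂ) (hy : ∀ j, y j ≠ 0) (c : ℂ) (hc0 : c ≠ 0) (hc1 : c ≠ 1)
    (hm : (X - C (1 : ℂ)) ^ m ∣ ∑ j, X ^ k j * A j)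
    (hn : (X - C c) ^ n ∣ ∑ j, C (y j) * (X ^ k j * A j)) :
    m + n ≤ Fintype.card ι * v + 2 * (Fintype.card ι - 1) := by
  classical
  let J := {j : ι // A j ≠ 0}
  have hJ : Fintype.card J ≤ Fintype.card ι := Fintype.card_subtype_le _
  have hJ0 : 0 < Fintype.card J := Fintype.card_pos_iff.mpr (by obtain ⟨j, hj⟩ := hA; exact ⟨⟨j, hj⟩⟩)
  let e := (Fintype.equivFin J).symm
  have hdiv : ∀ j, ∃ h : ℂ[X], A j = X ^ (A j).natTrailingDegree * h := fun j =>
    X_pow_dvd_iff.mpr fun d hd => coeff_eq_zero_of_lt_natTrailingDegree hd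
  choose h hh using hdiv
  have h0 : ∀ j, A j ≠ 0 → (h j).eval 0 ≠ 0 := by
    intro j hj h1
    have h2 : (A j).coeff (A j).natTrailingDegree = (h j).eval 0 := by
      have h3 := coeff_mul_X_pow (h j) (A j).natTrailingDegree 0
      rwa [mul_comm, ← hh j, zero_add, coeff_zero_eq_eval_zero] at h3
    rw [h1] at h2
    exact hj (trailingCoeff_eq_zero.mp h2)
  have htd : ∀ j, (A j).natTrailingDegree ≤ v := fun j =>
    (natTrailingDegree_le_natDegree _).trans (hv j)
  have hsum : ∀ z : ι → ℂ, ∑ j, C (z j) * (X ^ k j * A j) =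
      ∑ i, C (z (e i).1) * (X ^ (k (e i).1 + (A (e i).1).natTrailingDegree) * h (e i).1) := by
    intro z
    rw [Equiv.sum_comp e (fun j : J => C (z j.1) * (X ^ (k j.1 + (A j.1).natTrailingDegree) * h j.1))]
    have h3 : ∀ j : ι, X ^ k j * A j = X ^ (k j + (A j).natTrailingDegree) * h j := by
      intro j
      conv_lhs => rw [hh j]
      rw [pow_add, mul_assoc]
    simp_rw [← h3]
    rw [← Finset.sum_subtype (Finset.univ.filter fun j => A j ≠ 0) (p := fun j => A j ≠ 0)
      (by simp) (fun j => C (z j) * (X ^ k j * A j)), Finset.sum_filter_of_ne]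
    rintro j - hj h4
    simp [h4] at hj
  have := zero_estimate_fin (p := Fintype.card J) (v := v) (m := m) (n := n)
    (fun i => k (e i).1 + (A (e i).1).natTrailingDegree) ?_ (fun i => h (e i).1)
    (fun i => h0 _ (e i).2) ?_ hJ0 (fun i => y (e i).1) (fun i => hy _) c hc0 hc1 ?_ ?_
  · refine this.trans ?_
    gcongr
  · intro a b hab
    by_contra hne
    have h1 : (e a).1 ≠ (e b).1 := fun h2 => hne (e.injective (Subtype.ext h2))
    have h2 := hk _ _ h1 (e a).2 (e b).2
    have h3 := htd (e a).1
    have h4 := htd (e b).1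
    simp only at hab
    omega
  · intro i
    have h1 := hv (e i).1
    have h2 : h (e i).1 ≠ 0 := by
      intro h3
      exact h0 _ (e i).2 (by rw [h3, eval_zero])
    rw [hh (e i).1, natDegree_mul (by simp) h2] at h1
    omega
  · have := hsum (fun _ => 1)
    simp only [C_1, one_mul] at this
    rwa [← this]
  · rwa [← hsum y]

end

attribute [local instance] Matrix.seminormedAddCommGroup in
/-- Siegel's lemma for a gap polynomial vanishing to high order at `1`. -/
theorem exists_gap_coefficients (M v k : ℕ) (hM : 1 ≤ M) (hk : 10 * M * (v + 1) ≤ k) :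
    ∃ c : Fin (10 * M) × Fin (v + 1) → ℤ, c ≠ 0 ∧
      (∀ p, |(c p : ℝ)| ≤ 2 ^ (18 * (10 * M * k))) ∧
      ∀ h < 9 * M * (v + 1), ∑ p, c p * ((k * p.1 + p.2).choose h : ℤ) = 0 := by
  let A : Matrix (Fin (9 * M * (v + 1))) (Fin (10 * M) × Fin (v + 1)) ℤ :=
    Matrix.of fun h p => ((k * p.1 + p.2).choose h : ℤ)
  have hMv : 1 ≤ M * (v + 1) := Nat.mul_pos hM (by omega)
  have hβ : Fintype.card (Fin (10 * M) × Fin (v + 1)) = 10 * (M * (v + 1)) := by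
    simp; ring
  have hα : Fintype.card (Fin (9 * M * (v + 1))) = 9 * (M * (v + 1)) := by
    simp; ring
  obtain ⟨t, ht0, htA, htn⟩ := Int.Matrix.exists_ne_zero_int_vec_norm_le A
    (by rw [hα, hβ]; omega) (by rw [hα]; omega)
  refine ⟨t, ht0, ?_, ?_⟩
  · intro p
    have h1 : ‖A‖ ≤ 2 ^ (10 * M * k) := by
      rw [Matrix.norm_le_iff (by positivity)]
      intro h p
      have h2 : (k * (p.1 : ℕ) + p.2).choose h ≤ 2 ^ (10 * M * k) := by
        refine (Nat.choose_le_two_pow _ _).trans (Nat.pow_le_pow_right (by norm_num) ?_)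
        have h3 : (p.1 : ℕ) + 1 ≤ 10 * M := p.1.2
        have h4 : (p.2 : ℕ) ≤ k := by
          have := p.2.2
          nlinarith
        nlinarith
      simp only [A, Matrix.of_apply]
      rw [Int.norm_eq_abs]
      simp only [Int.cast_natCast, Nat.abs_cast]
      exact_mod_cast h2
    have h2 : |(t p : ℝ)| ≤ ‖t‖ := by
      rw [← Int.norm_eq_abs]
      exact norm_le_pi_norm t p
    refine h2.trans (htn.trans ?_)
    rw [hα, hβ]
    have h3 : (((9 * (M * (v + 1)) : ℕ) : ℝ) / ((10 * (M * (v + 1)) : ℕ) - (9 * (M * (v + 1)) : ℕ))) = (9 : ℕ) := by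
      have : (0 : ℝ) < M * (v + 1) := by exact_mod_cast hMv
      push_cast
      field_simp
      ring
    rw [h3, Real.rpow_natCast]
    have h4 : ((10 * (M * (v + 1)) : ℕ) : ℝ) ≤ 2 ^ (10 * M * k) := by
      have : 10 * (M * (v + 1)) ≤ 2 ^ (10 * M * k) := by
        calc 10 * (M * (v + 1)) ≤ k := by linarith
          _ ≤ 10 * M * k := by nlinarith
          _ ≤ 2 ^ (10 * M * k) := Nat.lt_two_pow_self.le
      exact_mod_cast this
    have h5 : max 1 ‖A‖ ≤ (2 : ℝ) ^ (10 * M * k) := max_le (one_le_pow₀ (by norm_num)) h1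
    calc (((10 * (M * (v + 1)) : ℕ) : ℝ) * max 1 ‖A‖) ^ 9
        ≤ ((2 : ℝ) ^ (10 * M * k) * 2 ^ (10 * M * k)) ^ 9 := by gcongr
      _ = _ := by rw [← pow_add, ← pow_mul]; congr 1; ring
  · intro h hh
    have := congrFun htA ⟨h, hh⟩
    simp only [Matrix.mulVec, dotProduct, A, Matrix.of_apply, Pi.zero_apply] at this
    rw [← this]
    exact Finset.sum_congr rfl fun p _ => mul_comm _ _

open Polynomial in
theorem X_sub_C_pow_dvd_of_hasseDeriv (G : ℂ[X]) (c : ℂ) (n : ℕ)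
    (h : ∀ i < n, (hasseDeriv i G).eval c = 0) : (X - C c) ^ n ∣ G := by
  rw [X_sub_C_pow_dvd_iff, X_pow_dvd_iff]
  intro d hd
  have := h d hd
  rwa [← taylor_coeff, taylor_apply] at this

open Polynomial in
/-- A twisted gap polynomial has a small-order nonvanishing derivative. -/
theorem exists_hasse_ne_zero (M v k : ℕ) (hM : 1 ≤ M) (hv : 9 ≤ v) (hk : 10 * M * (v + 1) ≤ k)
    (c : Fin (10 * M) × Fin (v + 1) → ℤ) (hc : c ≠ 0)
    (h0 : ∀ h < 9 * M * (v + 1), ∑ p, c p * ((k * p.1 + p.2).choose h : ℤ) = 0)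
    (y : Fin (10 * M) → ℂ) (hy : ∀ a, y a ≠ 0) (x : ℂ) (hx0 : x ≠ 0) (hx1 : x ≠ 1) :
    ∃ i ≤ 2 * M * (v + 1),
      ∑ p, (c p : ℂ) * y p.1 * ((k * p.1 + p.2).choose i : ℂ) * x ^ (k * (p.1 : ℕ) + p.2 - i) ≠ 0 := by
  by_contra! hcon
  let A : Fin (10 * M) → ℂ[X] := fun a => ∑ b : Fin (v + 1), C (c (a, b) : ℂ) * X ^ (b : ℕ)
  have hcoeff : ∀ a (b : Fin (v + 1)), (A a).coeff b = c (a, b) := by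
    intro a b
    simp only [A, finsetSum_coeff, coeff_C_mul, coeff_X_pow]
    rw [Finset.sum_eq_single b]
    · simp
    · intro b' _ hb'
      rw [if_neg]
      · simp
      · intro h; exact hb' (Fin.ext h.symm)
    · simp
  have hdeg : ∀ a, (A a).natDegree ≤ v := by
    intro a
    refine natDegree_sum_le_of_forall_le _ _ fun b _ => ?_
    refine (natDegree_C_mul_X_pow_le _ _).trans ?_
    have := b.2
    omega
  have hvk : v < k := by nlinarith
  have hasse : ∀ (z : Fin (10 * M) → ℂ) (i : ℕ) (w : ℂ),
      (hasseDeriv i (∑ a, C (z a) * (X ^ (k * (a : ℕ)) * A a))).eval w =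
      ∑ p : Fin (10 * M) × Fin (v + 1), (c p : ℂ) * z p.1 * ((k * p.1 + p.2).choose i : ℂ) * w ^ (k * (p.1 : ℕ) + p.2 - i) := by
    intro z i w
    rw [Fintype.sum_prod_type, map_sum, eval_finsetSum]
    refine Finset.sum_congr rfl fun a _ => ?_
    simp only [A, Finset.mul_sum, map_sum, eval_finsetSum]
    refine Finset.sum_congr rfl fun b _ => ?_
    rw [show C (z a) * (X ^ (k * (a : ℕ)) * (C (c (a, b) : ℂ) * X ^ (b : ℕ))) =
      monomial (k * (a : ℕ) + b) (c (a, b) * z a : ℂ) by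
        rw [← C_mul_X_pow_eq_monomial, C_mul, pow_add]; ring, hasseDeriv_monomial, eval_monomial]
    ring
  have := zero_estimate (m := 9 * M * (v + 1)) (n := 2 * M * (v + 1)) (fun a : Fin (10 * M) => k * (a : ℕ)) A hdeg
    ?_ ?_ y hy x hx0 hx1 ?_ ?_
  · rw [Fintype.card_fin] at this
    have h1 : 10 * M - 1 + 1 = 10 * M := by omega
    nlinarith
  · intro a b hab _ _
    have : (a : ℕ) ≠ b := fun h => hab (Fin.ext h)
    rcases lt_or_gt_of_ne this with h | h
    · left; nlinarith
    · right; nlinarith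
  · obtain ⟨⟨a, b⟩, hp⟩ := Function.ne_iff.mp hc
    refine ⟨a, fun h => hp ?_⟩
    have := hcoeff a b
    rw [h, coeff_zero] at this
    exact_mod_cast this.symm
  · apply X_sub_C_pow_dvd_of_hasseDeriv
    intro i hi
    have h1 := hasse (fun _ => 1) i 1
    simp only [C_1, one_mul] at h1
    rw [h1]
    have h2 := h0 i hi
    have h3 : ((∑ p, c p * ((k * p.1 + p.2).choose i : ℤ) : ℤ) : ℂ) = 0 := by rw [h2]; simp
    push_cast at h3
    simpa using h3
  · apply X_sub_C_pow_dvd_of_hasseDeriv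
    intro i hi
    rw [hasse]
    exact hcon i hi.le

/-- Taylor expansion of a Hasse derivative of a monomial at `1`. -/
theorem choose_mul_pow_eq_sum (e i : ℕ) (x : ℂ) :
    (e.choose i : ℂ) * x ^ (e - i) =
      ∑ h ∈ Finset.range (e + 1), (e.choose h : ℂ) * (h.choose i : ℂ) * (x - 1) ^ (h - i) := by
  by_cases hi : e < i
  · rw [Nat.choose_eq_zero_of_lt hi, Finset.sum_eq_zero]
    · simp
    · intro h hh
      rw [Finset.mem_range] at hh
      rw [Nat.choose_eq_zero_of_lt (show h < i by omega)]
      simp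
  · push Not at hi
    have h1 : x ^ (e - i) = ∑ h ∈ Finset.range (e - i + 1), (x - 1) ^ h * ((e - i).choose h : ℂ) := by
      conv_lhs => rw [show x = (x - 1) + 1 by ring]
      rw [add_pow]
      simp
    rw [← Finset.sum_range_add_sum_Ico _ (show i ≤ e + 1 by omega), Finset.sum_eq_zero, zero_add,
      Finset.sum_Ico_eq_sum_range, h1, Finset.mul_sum, show e + 1 - i = e - i + 1 by omega]
    · refine Finset.sum_congr rfl fun h hh => ?_
      rw [Finset.mem_range] at hh
      have h2 := Nat.choose_mul (n := e) (k := i + h) (s := i) (by omega)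
      rw [show i + h - i = h by omega] at h2 ⊢
      have h3 : ((e.choose (i + h) : ℂ)) * ((i + h).choose i : ℂ) = (e.choose i : ℂ) * ((e - i).choose h : ℂ) := by
        exact_mod_cast h2
      rw [h3]; ring
    · intro h hh
      rw [Finset.mem_range] at hh
      rw [Nat.choose_eq_zero_of_lt hh]
      simp

theorem norm_pow_sub_one_le (w : ℂ) (hw : ‖w‖ ≤ 1) (n : ℕ) : ‖w ^ n - 1‖ ≤ n * ‖w - 1‖ := by
  induction n with
  | zero => simp
  | succ n ih =>
    have h : w ^ (n + 1) - 1 = w * (w ^ n - 1) + (w - 1) := by ring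
    rw [h]
    refine (norm_add_le _ _).trans ?_
    rw [norm_mul]
    push_cast
    have := mul_le_mul_of_nonneg_right hw (norm_nonneg (w ^ n - 1))
    linarith

theorem norm_twisted_gap_le (M v k i : ℕ) (hM : 1 ≤ M) (hk : 10 * M * (v + 1) ≤ k)
    (c : Fin (10 * M) × Fin (v + 1) → ℤ) (hc : ∀ p, |(c p : ℝ)| ≤ 2 ^ (18 * (10 * M * k)))
    (h0 : ∀ h < 9 * M * (v + 1), ∑ p, c p * ((k * p.1 + p.2).choose h : ℤ) = 0)
    (hi : i ≤ 2 * M * (v + 1)) (x w : ℂ) (hx : ‖x‖ = 1) (hw : ‖w‖ = 1) (hx1 : ‖x - 1‖ ≤ 1) (δ : ℝ)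
    (hxδ : ‖x - 1‖ ^ (7 * M * (v + 1)) ≤ δ) (hwδ : ‖w - 1‖ ≤ δ) :
    ‖∑ p, (c p : ℂ) * w ^ (10 * M - 1 - (p.1 : ℕ)) * ((k * p.1 + p.2).choose i : ℂ) *
      x ^ (k * (p.1 : ℕ) + p.2 - i)‖ ≤ 2 ^ (23 * (10 * M * k)) * δ := by
  have hδ : 0 ≤ δ := (norm_nonneg _).trans hwδ
  set E := 10 * M * k with hE
  have hk0 : 0 < k := lt_of_lt_of_le (by positivity) hk
  have hE1 : 1 ≤ E := by rw [hE]; exact Nat.mul_pos (by omega) hk0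
  have hMv : 1 ≤ M * (v + 1) := Nat.mul_pos hM (by omega)
  have hkE : k ≤ E := by rw [hE]; nlinarith
  have hME : 10 * M ≤ E := by rw [hE]; nlinarith
  have hexp : ∀ p : Fin (10 * M) × Fin (v + 1), k * (p.1 : ℕ) + p.2 ≤ E := by
    intro p
    have h3 : (p.1 : ℕ) + 1 ≤ 10 * M := p.1.2
    have h4 : (p.2 : ℕ) ≤ k := by
      have := p.2.2
      nlinarith
    rw [hE]
    nlinarith
  have hcard : Fintype.card (Fin (10 * M) × Fin (v + 1)) ≤ E := by
    simp; linarith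
  have hEp : (E : ℝ) + 1 ≤ 2 ^ E := by exact_mod_cast Nat.lt_two_pow_self (n := E)
  have hcardp : (Fintype.card (Fin (10 * M) × Fin (v + 1)) : ℝ) ≤ 2 ^ E := by
    have : (Fintype.card (Fin (10 * M) × Fin (v + 1)) : ℝ) ≤ E := by exact_mod_cast hcard
    linarith
  have hch : ∀ n ≤ E, ∀ j, ‖(n.choose j : ℂ)‖ ≤ 2 ^ E := by
    intro n hn j
    rw [Complex.norm_natCast]
    have : n.choose j ≤ 2 ^ E :=
      (Nat.choose_le_two_pow _ _).trans (Nat.pow_le_pow_right (by norm_num) hn)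
    exact_mod_cast this
  have hcn : ∀ p, ‖(c p : ℂ)‖ ≤ 2 ^ (18 * E) := by
    intro p
    rw [Complex.norm_intCast]
    exact hc p
  have hmain : ‖∑ p, (c p : ℂ) * ((k * p.1 + p.2).choose i : ℂ) *
      x ^ (k * (p.1 : ℕ) + p.2 - i)‖ ≤ 2 ^ (22 * E) * δ := by
    have h1 : ∑ p, (c p : ℂ) * ((k * p.1 + p.2).choose i : ℂ) * x ^ (k * (p.1 : ℕ) + p.2 - i) =
        ∑ h ∈ Finset.range (E + 1), (∑ p, (c p : ℂ) * ((k * p.1 + p.2).choose h : ℂ)) *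
          ((h.choose i : ℂ) * (x - 1) ^ (h - i)) := by
      simp_rw [Finset.sum_mul]
      rw [Finset.sum_comm]
      refine Finset.sum_congr rfl fun p _ => ?_
      rw [mul_assoc, choose_mul_pow_eq_sum, Finset.mul_sum]
      rw [Finset.sum_subset (Finset.range_subset_range.mpr (Nat.add_le_add_right (hexp p) 1))]
      · refine Finset.sum_congr rfl fun h _ => ?_
        ring
      · intro h _ hh
        rw [Finset.mem_range] at hh
        rw [Nat.choose_eq_zero_of_lt (show k * (p.1 : ℕ) + p.2 < h by omega)]
        simp
    rw [h1]
    refine (norm_sum_le_of_le (f := fun h => (∑ p, (c p : ℂ) * ((k * p.1 + p.2).choose h : ℂ)) *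
          ((h.choose i : ℂ) * (x - 1) ^ (h - i))) _ (n := fun _ => (2 ^ E * (2 ^ (18 * E) * 2 ^ E)) * (2 ^ E * δ)) ?_).trans ?_
    · intro h hh
      rw [Finset.mem_range] at hh
      by_cases hlt : h < 9 * M * (v + 1)
      · have h3 : ((∑ p, c p * ((k * p.1 + p.2).choose h : ℤ) : ℤ) : ℂ) = 0 := by
          rw [h0 h hlt]; simp
        push_cast at h3
        simp only [h3, zero_mul, norm_zero]
        positivity
      · rw [norm_mul, norm_mul]
        gcongr
        · refine (norm_sum_le_of_le (n := fun _ => (2 : ℝ) ^ (18 * E) * 2 ^ E) _ ?_).trans ?_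
          · intro p _
            rw [norm_mul]
            gcongr
            · exact hcn p
            · exact hch _ (hexp p) _
          · rw [Finset.sum_const, Finset.card_univ, nsmul_eq_mul]
            gcongr
        · exact hch _ (by omega) _
        · rw [norm_pow]
          refine (pow_le_pow_of_le_one (norm_nonneg _) hx1 ?_).trans hxδ
          push Not at hlt
          have : 9 * M * (v + 1) = 9 * (M * (v + 1)) := by ring
          have : 7 * M * (v + 1) = 7 * (M * (v + 1)) := by ring
          have : 2 * M * (v + 1) = 2 * (M * (v + 1)) := by ring
          omega
    · rw [Finset.sum_const, Finset.card_range, nsmul_eq_mul]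
      push_cast
      calc ((E : ℝ) + 1) * ((2 ^ E * (2 ^ (18 * E) * 2 ^ E)) * (2 ^ E * δ))
          ≤ 2 ^ E * ((2 ^ E * (2 ^ (18 * E) * 2 ^ E)) * (2 ^ E * δ)) := by gcongr
        _ = 2 ^ (22 * E) * δ := by ring
  have hdiff : ‖∑ p, ((c p : ℂ) * w ^ (10 * M - 1 - (p.1 : ℕ)) * ((k * p.1 + p.2).choose i : ℂ) *
      x ^ (k * (p.1 : ℕ) + p.2 - i) - (c p : ℂ) * ((k * p.1 + p.2).choose i : ℂ) *
      x ^ (k * (p.1 : ℕ) + p.2 - i))‖ ≤ 2 ^ (21 * E) * δ := by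
    refine (norm_sum_le_of_le (n := fun _ => (2 : ℝ) ^ (18 * E) * (2 ^ E * δ) * 2 ^ E) _ ?_).trans ?_
    · intro p _
      rw [show (c p : ℂ) * w ^ (10 * M - 1 - (p.1 : ℕ)) * ((k * p.1 + p.2).choose i : ℂ) *
        x ^ (k * (p.1 : ℕ) + p.2 - i) - (c p : ℂ) * ((k * p.1 + p.2).choose i : ℂ) *
        x ^ (k * (p.1 : ℕ) + p.2 - i) = (c p : ℂ) * (w ^ (10 * M - 1 - (p.1 : ℕ)) - 1) *
        ((k * p.1 + p.2).choose i : ℂ) * x ^ (k * (p.1 : ℕ) + p.2 - i) by ring]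
      rw [norm_mul, norm_mul, norm_mul, norm_pow, hx, one_pow, mul_one]
      gcongr
      · exact hcn p
      · refine (norm_pow_sub_one_le w hw.le _).trans ?_
        gcongr
        have h5 : 10 * M - 1 - (p.1 : ℕ) ≤ 2 ^ E := by
          have := Nat.lt_two_pow_self (n := E)
          omega
        exact_mod_cast h5
      · exact hch _ (hexp p) _
    · rw [Finset.sum_const, Finset.card_univ, nsmul_eq_mul]
      calc (Fintype.card (Fin (10 * M) × Fin (v + 1)) : ℝ) * (2 ^ (18 * E) * (2 ^ E * δ) * 2 ^ E)
          ≤ 2 ^ E * (2 ^ (18 * E) * (2 ^ E * δ) * 2 ^ E) := by gcongr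
        _ = 2 ^ (21 * E) * δ := by ring
  rw [Finset.sum_sub_distrib] at hdiff
  have h2 := norm_add_le (∑ p, (c p : ℂ) * w ^ (10 * M - 1 - (p.1 : ℕ)) * ((k * p.1 + p.2).choose i : ℂ) *
      x ^ (k * (p.1 : ℕ) + p.2 - i) - ∑ p, (c p : ℂ) * ((k * p.1 + p.2).choose i : ℂ) *
      x ^ (k * (p.1 : ℕ) + p.2 - i)) (∑ p, (c p : ℂ) * ((k * p.1 + p.2).choose i : ℂ) *
      x ^ (k * (p.1 : ℕ) + p.2 - i))
  rw [sub_add_cancel] at h2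
  refine h2.trans ((add_le_add hdiff hmain).trans ?_)
  rw [← add_mul]
  gcongr
  have h3 : (2 : ℝ) ^ (21 * E) ≤ 2 ^ (22 * E) := pow_le_pow_right₀ (by norm_num) (by omega)
  calc (2 : ℝ) ^ (21 * E) + 2 ^ (22 * E) ≤ 2 ^ (22 * E) + 2 ^ (22 * E) := by gcongr
    _ = 2 ^ (22 * E + 1) := by ring
    _ ≤ 2 ^ (23 * E) := pow_le_pow_right₀ (by norm_num) (by omega)

/-- The unimodular number `z / conj z`. -/
noncomputable def unitDir (z : ℂ) : ℂ := z / starRingEnd ℂ z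

theorem norm_unitDir {z : ℂ} (hz : z ≠ 0) : ‖unitDir z‖ = 1 := by
  rw [unitDir, norm_div, Complex.norm_conj, div_self (norm_ne_zero_iff.mpr hz)]

theorem unitDir_ne_zero {z : ℂ} (hz : z ≠ 0) : unitDir z ≠ 0 := by
  rw [← norm_ne_zero_iff, norm_unitDir hz]; exact one_ne_zero

theorem clear_denominators (x x' w w' u u' : ℂ) (hx : x ≠ 0) (hx' : x' ≠ 0) (hw' : w' ≠ 0)
    (hu' : u' ≠ 0) (n₁ n₀ k a j b e' t' : ℕ) :
    (x ^ n₁ * w / (x' ^ n₁ * w')) ^ (k * a + b) *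
      (x ^ (k * n₁ + n₀) * u / (x' ^ (k * n₁ + n₀) * u')) ^ j *
      (x' ^ (n₁ * k * (a + j) + (n₁ * b + n₀ * j + t')) / x ^ (n₁ * k * (a + j)) *
        w' ^ (k * a + b + e') * u' ^ (a + j)) =
    x ^ (n₁ * b + n₀ * j) * x' ^ t' * w ^ (k * a + b) * w' ^ e' * u ^ j * u' ^ a := by
  rw [div_pow, div_pow]
  field_simp
  ring

theorem one_le_norm_twisted_gap (O : Subring ℂ) (hconj : ∀ z ∈ O, starRingEnd ℂ z ∈ O)
    (hnorm : ∀ z ∈ O, z ≠ 0 → 1 ≤ ‖z‖) (η : ℂ) (hη : η ∈ O) (hη0 : η ≠ 0)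
    (M v k i n₁ n₀ : ℕ) (hn₀ : n₀ ≤ n₁) (hM : 1 ≤ M) (hk : 10 * M * (v + 1) ≤ k)
    (w₁ w₂ : ℂ) (hw₁ : w₁ ∈ O) (hw₂ : w₂ ∈ O) (hw₁0 : w₁ ≠ 0) (hw₂0 : w₂ ≠ 0)
    (c : Fin (10 * M) × Fin (v + 1) → ℤ)
    (hne : ∑ p, (c p : ℂ) * unitDir (η ^ (k * n₁ + n₀) * w₂) ^ (10 * M - 1 - (p.1 : ℕ)) *
      ((k * p.1 + p.2).choose i : ℂ) *
      unitDir (η ^ n₁ * w₁) ^ (k * (p.1 : ℕ) + p.2 - i) ≠ 0) :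
    1 ≤ ‖∑ p, (c p : ℂ) * unitDir (η ^ (k * n₁ + n₀) * w₂) ^ (10 * M - 1 - (p.1 : ℕ)) *
      ((k * p.1 + p.2).choose i : ℂ) *
      unitDir (η ^ n₁ * w₁) ^ (k * (p.1 : ℕ) + p.2 - i)‖ *
      (‖η‖ ^ (n₁ * (v + (10 * M - 1))) * ‖w₁‖ ^ (10 * M * k) * ‖w₂‖ ^ (10 * M - 1)) := by
  set S := ∑ p, (c p : ℂ) * unitDir (η ^ (k * n₁ + n₀) * w₂) ^ (10 * M - 1 - (p.1 : ℕ)) *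
      ((k * p.1 + p.2).choose i : ℂ) *
      unitDir (η ^ n₁ * w₁) ^ (k * (p.1 : ℕ) + p.2 - i) with hS
  set l := 10 * M - 1 with hl
  set T := n₁ * (v + l) with hT
  set E := 10 * M * k with hE
  set η' := starRingEnd ℂ η with hη'
  set w₁' := starRingEnd ℂ w₁ with hw₁'
  set w₂' := starRingEnd ℂ w₂ with hw₂'
  have hη'0 : η' ≠ 0 := by simpa [hη'] using hη0
  have hw₁'0 : w₁' ≠ 0 := by simpa [hw₁'] using hw₁0
  have hw₂'0 : w₂' ≠ 0 := by simpa [hw₂'] using hw₂0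
  set X₁ := unitDir (η ^ n₁ * w₁) with hX₁
  set X₂ := unitDir (η ^ (k * n₁ + n₀) * w₂) with hX₂
  have hX₁n : ‖X₁‖ = 1 := norm_unitDir (mul_ne_zero (pow_ne_zero _ hη0) hw₁0)
  have hX₁e : X₁ = η ^ n₁ * w₁ / (η' ^ n₁ * w₁') := by simp [hX₁, unitDir, hη', hw₁']
  have hX₂e : X₂ = η ^ (k * n₁ + n₀) * w₂ / (η' ^ (k * n₁ + n₀) * w₂') := by
    simp [hX₂, unitDir, hη', hw₂']
  set μ := η' ^ (n₁ * k * l + T) / η ^ (n₁ * k * l) * w₁' ^ E * w₂' ^ l with hμ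
  have hmem : S * (X₁ ^ i * μ) ∈ O := by
    rw [hS, Finset.sum_mul]
    refine Subring.sum_mem _ fun p _ => ?_
    have h1 : (c p : ℂ) * X₂ ^ (l - (p.1 : ℕ)) * ((k * p.1 + p.2).choose i : ℂ) *
        X₁ ^ (k * (p.1 : ℕ) + p.2 - i) * (X₁ ^ i * μ) =
        (c p : ℂ) * ((k * p.1 + p.2).choose i : ℂ) *
          (X₁ ^ (k * (p.1 : ℕ) + p.2) * X₂ ^ (l - (p.1 : ℕ)) * μ) := by
      by_cases hi : k * (p.1 : ℕ) + p.2 < i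
      · rw [Nat.choose_eq_zero_of_lt hi]; simp
      · push Not at hi
        rw [← Nat.sub_add_cancel hi, pow_add]
        simp only [Nat.sub_add_cancel hi]
        ring
    rw [h1]
    refine O.mul_mem (O.mul_mem (intCast_mem O _) (natCast_mem O _)) ?_
    have hp1 : (p.1 : ℕ) + 1 ≤ 10 * M := p.1.2
    have hp2 : (p.2 : ℕ) ≤ v := by have := p.2.2; omega
    obtain ⟨j, hj⟩ := Nat.exists_eq_add_of_le (show (p.1 : ℕ) ≤ l by omega)
    have hvk : v ≤ k := by nlinarith
    obtain ⟨e', he'⟩ := Nat.exists_eq_add_of_le (show k * (p.1 : ℕ) + p.2 ≤ E by rw [hE]; nlinarith)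
    obtain ⟨t', ht'⟩ := Nat.exists_eq_add_of_le (show n₁ * (p.2 : ℕ) + n₀ * j ≤ T by
      rw [hT]
      have h2 : n₁ * (p.2 : ℕ) ≤ n₁ * v := by gcongr
      have h3 : n₀ * j ≤ n₁ * l := Nat.mul_le_mul hn₀ (by omega)
      linarith)
    have h4 := clear_denominators η η' w₁ w₁' w₂ w₂' hη0 hη'0 hw₁'0 hw₂'0 n₁ n₀ k p.1 j p.2 e' t'
    rw [← hX₁e, ← hX₂e, ← ht', ← he', ← hj] at h4
    rw [show l - (p.1 : ℕ) = j by omega, hμ, h4]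
    refine O.mul_mem (O.mul_mem (O.mul_mem (O.mul_mem (O.mul_mem ?_ ?_) ?_) ?_) ?_) ?_
    · exact O.pow_mem hη _
    · exact O.pow_mem (hconj _ hη) _
    · exact O.pow_mem hw₁ _
    · exact O.pow_mem (hconj _ hw₁) _
    · exact O.pow_mem hw₂ _
    · exact O.pow_mem (hconj _ hw₂) _
  have hX₁0 : X₁ ≠ 0 := unitDir_ne_zero (mul_ne_zero (pow_ne_zero _ hη0) hw₁0)
  have hμ0 : μ ≠ 0 := by
    rw [hμ]
    refine mul_ne_zero (mul_ne_zero (div_ne_zero ?_ ?_) ?_) ?_ <;>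
    exact pow_ne_zero _ (by assumption)
  have h5 := hnorm _ hmem (mul_ne_zero hne (mul_ne_zero (pow_ne_zero _ hX₁0) hμ0))
  refine h5.trans (le_of_eq ?_)
  rw [norm_mul, norm_mul, norm_pow, hX₁n, one_pow, one_mul, hμ, norm_mul, norm_mul, norm_div,
    norm_pow, norm_pow, norm_pow, norm_pow, hη', hw₁', hw₂', Complex.norm_conj, Complex.norm_conj,
    Complex.norm_conj, pow_add]
  have : ‖η‖ ≠ 0 := norm_ne_zero_iff.mpr hη0
  field_simp

/-- Two very good approximations `η ^ n * w` to the real line cannot have exponents that are too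
far apart. -/
theorem two_solutions (O : Subring ℂ) (hconj : ∀ z ∈ O, starRingEnd ℂ z ∈ O)
    (hnorm : ∀ z ∈ O, z ≠ 0 → 1 ≤ ‖z‖) (η : ℂ) (hη : η ∈ O) (hη2 : 2 ≤ ‖η‖)
    (M n₁ n₂ : ℕ) (hM : 1 ≤ M) (w₁ w₂ : ℂ) (hw₁ : w₁ ∈ O) (hw₂ : w₂ ∈ O)
    (hw₁0 : w₁ ≠ 0) (hw₂0 : w₂ ≠ 0)
    (h₁ : ‖unitDir (η ^ n₁ * w₁) - 1‖ ^ M * ‖η‖ ^ n₁ ≤ 1)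
    (h₂ : ‖unitDir (η ^ n₂ * w₂) - 1‖ ^ M * ‖η‖ ^ n₂ ≤ 1)
    (hs₁ : ‖w₁‖ ^ (400 * M ^ 2) ≤ ‖η‖ ^ n₁) (hs₂ : ‖w₂‖ ^ (400 * M ^ 2) ≤ ‖η‖ ^ n₂)
    (hX : unitDir (η ^ n₁ * w₁) ≠ 1) (hn₁ : 800 * M ^ 2 ≤ n₁) (hn₂ : 110 * M ^ 2 * n₁ ≤ n₂) :
    False := by
  have hη0 : η ≠ 0 := by intro h; rw [h, norm_zero] at hη2; linarith
  have hn₁0 : 0 < n₁ := lt_of_lt_of_le (by positivity) hn₁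
  set Q := ‖η‖ with hQ
  have hQ1 : 1 ≤ Q := by linarith
  set k := n₂ / n₁ with hk
  set n₀ := n₂ % n₁ with hn₀
  have hn₂e : n₂ = k * n₁ + n₀ := by rw [hk, hn₀, mul_comm]; exact (Nat.div_add_mod _ _).symm
  have hn₀lt : n₀ < n₁ := Nat.mod_lt _ hn₁0
  have hkM : 110 * M ^ 2 ≤ k := (Nat.le_div_iff_mul_le hn₁0).mpr hn₂
  have hv1 : 10 * M + 1 ≤ k / (10 * M) := by
    rw [Nat.le_div_iff_mul_le (by omega)]
    nlinarith
  obtain ⟨v, hv⟩ : ∃ v, k / (10 * M) = v + 1 := ⟨k / (10 * M) - 1, by omega⟩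
  have hvM : 10 * M ≤ v := by omega
  have hkl : 10 * M * (v + 1) ≤ k := by rw [← hv]; exact Nat.mul_div_le _ _
  have hku : k < 10 * M * (v + 2) := by
    have := Nat.lt_mul_div_succ k (show 0 < 10 * M by omega)
    rwa [hv] at this
  have hX₁0 : unitDir (η ^ n₁ * w₁) ≠ 0 := unitDir_ne_zero (mul_ne_zero (pow_ne_zero _ hη0) hw₁0)
  have hX₂0 : unitDir (η ^ n₂ * w₂) ≠ 0 := unitDir_ne_zero (mul_ne_zero (pow_ne_zero _ hη0) hw₂0)
  obtain ⟨c, hc0, hcb, hcv⟩ := exists_gap_coefficients M v k hM hkl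
  obtain ⟨i, hi, hne⟩ := exists_hasse_ne_zero M v k hM (by omega) hkl c hc0 hcv
    (fun a => unitDir (η ^ n₂ * w₂) ^ (10 * M - 1 - (a : ℕ))) (fun a => pow_ne_zero _ hX₂0)
    _ hX₁0 hX
  have hx₁ : ‖unitDir (η ^ n₁ * w₁) - 1‖ ^ M ≤ (Q ^ n₁)⁻¹ := by
    rw [← one_div, le_div_iff₀ (by positivity)]; exact h₁
  have hx₂ : ‖unitDir (η ^ n₂ * w₂) - 1‖ ^ M ≤ (Q ^ n₂)⁻¹ := by
    rw [← one_div, le_div_iff₀ (by positivity)]; exact h₂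
  have hM0 : M ≠ 0 := by omega
  have hb₁ : ‖unitDir (η ^ n₁ * w₁) - 1‖ ≤ 1 := by
    refine le_of_pow_le_pow_left₀ hM0 zero_le_one ?_
    rw [one_pow]
    exact hx₁.trans (inv_le_one_of_one_le₀ (one_le_pow₀ hQ1))
  set δ := (Q ^ (7 * n₁ * (v + 1)))⁻¹ with hδ
  have hδ₁ : ‖unitDir (η ^ n₁ * w₁) - 1‖ ^ (7 * M * (v + 1)) ≤ δ := by
    rw [show 7 * M * (v + 1) = M * (7 * (v + 1)) by ring, pow_mul, hδ,
      show 7 * n₁ * (v + 1) = n₁ * (7 * (v + 1)) by ring, pow_mul Q, ← inv_pow]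
    gcongr
  have hδ₂ : ‖unitDir (η ^ n₂ * w₂) - 1‖ ≤ δ := by
    refine le_of_pow_le_pow_left₀ hM0 (by positivity) (hx₂.trans ?_)
    rw [hδ, inv_pow, ← pow_mul]
    refine inv_anti₀ (by positivity) (pow_le_pow_right₀ hQ1 ?_)
    calc 7 * n₁ * (v + 1) * M ≤ (10 * M * (v + 1)) * n₁ := by nlinarith [Nat.zero_le (n₁ * (v + 1) * M)]
      _ ≤ k * n₁ := by gcongr
      _ ≤ n₂ := by omega
  have hup := norm_twisted_gap_le M v k i hM hkl c hcb hcv hi _ _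
    (norm_unitDir (mul_ne_zero (pow_ne_zero n₁ hη0) hw₁0))
    (norm_unitDir (mul_ne_zero (pow_ne_zero n₂ hη0) hw₂0)) hb₁ δ hδ₁ hδ₂
  have hlow := one_le_norm_twisted_gap O hconj hnorm η hη hη0 M v k i n₁ n₀ hn₀lt.le hM hkl w₁ w₂
    hw₁ hw₂ hw₁0 hw₂0 c (by rw [← hn₂e]; exact hne)
  rw [← hn₂e] at hlow
  have hw₁1 := hnorm _ hw₁ hw₁0
  have hw₂1 := hnorm _ hw₂ hw₂0
  have ha : (‖w₁‖ ^ (10 * M * k)) ^ 4 ≤ Q ^ (n₁ * (v + 2)) := by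
    calc (‖w₁‖ ^ (10 * M * k)) ^ 4 = ‖w₁‖ ^ (40 * M * k) := by rw [← pow_mul]; congr 1; ring
      _ ≤ ‖w₁‖ ^ (400 * M ^ 2 * (v + 2)) := pow_le_pow_right₀ hw₁1 (by nlinarith)
      _ ≤ Q ^ (n₁ * (v + 2)) := by rw [pow_mul, pow_mul Q]; gcongr
  have hb : (‖w₂‖ ^ (10 * M - 1)) ^ 4 ≤ Q ^ (n₁ * (v + 2)) := by
    have h3 : ‖w₂‖ ^ (40 * M) ≤ Q ^ (n₁ * (v + 2)) := by
      refine le_of_pow_le_pow_left₀ (n := 10 * M) (by omega) (by positivity) ?_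
      rw [← pow_mul, ← pow_mul, show 40 * M * (10 * M) = 400 * M ^ 2 by ring]
      refine hs₂.trans (pow_le_pow_right₀ hQ1 ?_)
      rw [hn₂e]
      nlinarith
    refine le_trans ?_ h3
    rw [← pow_mul]
    exact pow_le_pow_right₀ hw₂1 (by omega)
  have h6 := (hlow.trans (mul_le_mul_of_nonneg_right hup (by positivity)))
  have h7 : 1 ≤ 2 ^ (92 * (10 * M * k)) * δ ^ 4 *
      (Q ^ (4 * (n₁ * (v + (10 * M - 1)))) * Q ^ (n₁ * (v + 2)) * Q ^ (n₁ * (v + 2))) := by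
    calc (1 : ℝ) ≤ (2 ^ (23 * (10 * M * k)) * δ *
          (Q ^ (n₁ * (v + (10 * M - 1))) * ‖w₁‖ ^ (10 * M * k) * ‖w₂‖ ^ (10 * M - 1))) ^ 4 :=
            one_le_pow₀ h6
      _ = 2 ^ (92 * (10 * M * k)) * δ ^ 4 *
        (Q ^ (4 * (n₁ * (v + (10 * M - 1)))) * (‖w₁‖ ^ (10 * M * k)) ^ 4 * (‖w₂‖ ^ (10 * M - 1)) ^ 4) := by
          rw [mul_pow, mul_pow, mul_pow, mul_pow, ← pow_mul, ← pow_mul Q]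
          ring_nf
      _ ≤ _ := by gcongr
  have h8 : (2 : ℝ) ^ (92 * (10 * M * k)) ≤ Q ^ (92 * (10 * M * k)) := by gcongr
  have h9 : Q ^ (28 * n₁ * (v + 1)) ≤ Q ^ (92 * (10 * M * k) + 4 * (n₁ * (v + (10 * M - 1))) +
      n₁ * (v + 2) + n₁ * (v + 2)) := by
    have hd : δ ^ 4 = (Q ^ (28 * n₁ * (v + 1)))⁻¹ := by
      rw [hδ, inv_pow, ← pow_mul]; ring_nf
    rw [hd, mul_right_comm, ← div_eq_mul_inv, le_div_iff₀ (by positivity), one_mul] at h7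
    refine h7.trans ?_
    rw [pow_add, pow_add, pow_add]
    rw [mul_assoc (Q ^ (92 * (10 * M * k))), mul_assoc (Q ^ (92 * (10 * M * k)))]
    gcongr
  have h10 := (pow_le_pow_iff_right₀ (by linarith : 1 < Q)).mp h9
  have h11 : 10 * M - 1 + 1 = 10 * M := by omega
  have h12 : M * k ≤ 10 * M ^ 2 * (v + 2) := by nlinarith
  have h13 : 920 * (10 * M ^ 2 * (v + 2)) ≤ 12 * (n₁ * (v + 2)) := by nlinarith
  have h14 : n₁ * (10 * M - 1) ≤ n₁ * v := by gcongr; omega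
  have h15 : 0 < n₁ * (v + 1) := by positivity
  nlinarith

theorem unitDir_gap (O : Subring ℂ) (hconj : ∀ z ∈ O, starRingEnd ℂ z ∈ O)
    (hnorm : ∀ z ∈ O, z ≠ 0 → 1 ≤ ‖z‖) (η : ℂ) (hη : η ∈ O) (hη0 : η ≠ 0)
    (n d : ℕ) (w₁ w₂ : ℂ) (hw₁ : w₁ ∈ O) (hw₂ : w₂ ∈ O) (hw₁0 : w₁ ≠ 0) (hw₂0 : w₂ ≠ 0)
    (hne : unitDir (η ^ n * w₁) ≠ unitDir (η ^ (n + d) * w₂)) :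
    1 ≤ ‖unitDir (η ^ n * w₁) - unitDir (η ^ (n + d) * w₂)‖ * (‖η‖ ^ d * ‖w₁‖ * ‖w₂‖) := by
  set z : ℂ := w₁ * (starRingEnd ℂ (η ^ d * w₂)) - starRingEnd ℂ w₁ * (η ^ d * w₂) with hz
  have hzO : z ∈ O := O.sub_mem (O.mul_mem hw₁ (hconj _ (O.mul_mem (O.pow_mem hη _) hw₂)))
    (O.mul_mem (hconj _ hw₁) (O.mul_mem (O.pow_mem hη _) hw₂))
  have c0 : ∀ {x : ℂ}, x ≠ 0 → starRingEnd ℂ x ≠ 0 := fun h => by simpa using h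
  have h1 : unitDir (η ^ n * w₁) - unitDir (η ^ (n + d) * w₂) =
      (η ^ n / (starRingEnd ℂ η) ^ n) * z / (starRingEnd ℂ w₁ * (starRingEnd ℂ (η ^ d * w₂))) := by
    have := c0 hη0
    have := c0 hw₁0
    have := c0 hw₂0
    simp only [unitDir, hz, map_mul, map_pow, pow_add]
    field_simp
  have hz0 : z ≠ 0 := by
    intro h
    rw [h, mul_zero, zero_div, sub_eq_zero] at h1
    exact hne h1
  have hη1 : ‖η‖ ≠ 0 := norm_ne_zero_iff.mpr hη0
  have hw₁1 : ‖w₁‖ ≠ 0 := norm_ne_zero_iff.mpr hw₁0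
  have hw₂1 : ‖w₂‖ ≠ 0 := norm_ne_zero_iff.mpr hw₂0
  refine (hnorm z hzO hz0).trans (le_of_eq ?_)
  rw [h1, norm_div, norm_mul, norm_div, norm_mul, norm_pow, norm_pow, Complex.norm_conj,
    Complex.norm_conj, Complex.norm_conj, norm_mul, norm_pow]
  field_simp

/-- Directions of very good approximations `η ^ n * w` to the real line are few. -/
theorem encard_unitDir_le (O : Subring ℂ) (hconj : ∀ z ∈ O, starRingEnd ℂ z ∈ O)
    (hnorm : ∀ z ∈ O, z ≠ 0 → 1 ≤ ‖z‖) (η : ℂ) (hη : η ∈ O) (hη2 : 2 ≤ ‖η‖)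
    (M : ℕ) (hM : 1 ≤ M) :
    {X : ℂ | ∃ n : ℕ, ∃ w ∈ O, w ≠ 0 ∧ X = unitDir (η ^ n * w) ∧ 800 * M ^ 2 ≤ n ∧
      ‖X - 1‖ ^ M * ‖η‖ ^ n ≤ 1 ∧ ‖w‖ ^ (400 * M ^ 2) ≤ ‖η‖ ^ n}.encard ≤ 220 * M ^ 3 + 1 := by
  have hη0 : η ≠ 0 := by intro h; rw [h, norm_zero] at hη2; linarith
  set S := {X : ℂ | X ≠ 1 ∧ ∃ n : ℕ, ∃ w ∈ O, w ≠ 0 ∧ X = unitDir (η ^ n * w) ∧ 800 * M ^ 2 ≤ n ∧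
      ‖X - 1‖ ^ M * ‖η‖ ^ n ≤ 1 ∧ ‖w‖ ^ (400 * M ^ 2) ≤ ‖η‖ ^ n} with hS
  suffices hSc : S.encard ≤ 220 * M ^ 3 by
    refine (Set.encard_le_encard (t := insert 1 S) ?_).trans ?_
    · intro X hX
      by_cases h : X = 1
      · exact Or.inl h
      · exact Or.inr ⟨h, hX⟩
    · exact (Set.encard_insert_le _ _).trans (by gcongr)
  set Q := ‖η‖ with hQ
  have hQ1 : 1 ≤ Q := by linarith
  rcases S.eq_empty_or_nonempty with hemp | hnon
  · rw [hemp]; simp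
  have hch : ∀ X : ℂ, ∃ n : ℕ, X ∈ S → ∃ w ∈ O, w ≠ 0 ∧ X = unitDir (η ^ n * w) ∧ 800 * M ^ 2 ≤ n ∧
      ‖X - 1‖ ^ M * Q ^ n ≤ 1 ∧ ‖w‖ ^ (400 * M ^ 2) ≤ Q ^ n := by
    intro X
    by_cases h : X ∈ S
    · obtain ⟨n, hn⟩ := h.2
      exact ⟨n, fun _ => hn⟩
    · exact ⟨0, fun h' => absurd h' h⟩
  choose N hN using hch
  obtain ⟨X₀, hX₀, hmin⟩ : ∃ X₀ ∈ S, ∀ X ∈ S, N X₀ ≤ N X := by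
    obtain ⟨m, ⟨X₀, hX₀, rfl⟩, hm⟩ := WellFounded.has_min (wellFounded_lt (α := ℕ)) (N '' S) (hnon.image N)
    exact ⟨X₀, hX₀, fun X hX => not_lt.mp (hm _ ⟨X, hX, rfl⟩)⟩
  have hMsq : 1 ≤ M ^ 2 := Nat.one_le_pow _ _ hM
  have hN0 : 0 < N X₀ := by
    obtain ⟨w, _, _, _, h, _⟩ := hN X₀ hX₀
    omega
  have hgap : ∀ X ∈ S, ∀ Y ∈ S, X ≠ Y → N X ≤ N Y → N X ≤ 2 * M * (N Y - N X) := by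
    intro X hX Y hY hXY hle
    obtain ⟨w, hw, hw0, hXe, hn, hx, hs⟩ := hN X hX
    obtain ⟨w', hw', hw0', hYe, hn', hy, hs'⟩ := hN Y hY
    obtain ⟨d, hd⟩ := Nat.exists_eq_add_of_le hle
    have h1 := unitDir_gap O hconj hnorm η hη hη0 (N X) d w w' hw hw' hw0 hw0' (by rw [← hd, ← hXe, ← hYe]; exact hXY)
    rw [← hd, ← hXe, ← hYe] at h1
    rw [show N Y - N X = d by omega]
    set n := N X
    have hM0 : M ≠ 0 := by omega
    have hdist : (‖X - Y‖) ^ M * Q ^ n ≤ 2 ^ M := by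
      have h2 : ‖X - Y‖ ≤ ‖X - 1‖ + ‖Y - 1‖ := by
        have := norm_sub_le (X - 1) (Y - 1)
        simpa using this
      have h3 : ‖Y - 1‖ ^ M * Q ^ n ≤ 1 := by
        refine le_trans ?_ hy
        gcongr
      have h4 : (max ‖X - 1‖ ‖Y - 1‖) ^ M * Q ^ n ≤ 1 := by
        rcases max_choice ‖X - 1‖ ‖Y - 1‖ with h | h <;> rw [h] <;> assumption
      calc (‖X - Y‖) ^ M * Q ^ n ≤ (2 * max ‖X - 1‖ ‖Y - 1‖) ^ M * Q ^ n := by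
            gcongr
            linarith [le_max_left ‖X - 1‖ ‖Y - 1‖, le_max_right ‖X - 1‖ ‖Y - 1‖]
        _ = 2 ^ M * ((max ‖X - 1‖ ‖Y - 1‖) ^ M * Q ^ n) := by rw [mul_pow]; ring
        _ ≤ 2 ^ M * 1 := by gcongr
        _ = 2 ^ M := mul_one _
    have h5 : Q ^ n ≤ 2 ^ M * (Q ^ d * ‖w‖ * ‖w'‖) ^ M := by
      have h6 := one_le_pow₀ h1 (n := M)
      rw [mul_pow] at h6
      calc Q ^ n ≤ (‖X - Y‖ ^ M * (Q ^ d * ‖w‖ * ‖w'‖) ^ M) * Q ^ n :=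
            le_mul_of_one_le_left (by positivity) h6
        _ = (‖X - Y‖ ^ M * Q ^ n) * (Q ^ d * ‖w‖ * ‖w'‖) ^ M := by ring
        _ ≤ _ := by gcongr
    have h7 : Q ^ (n * (400 * M)) ≤ Q ^ (400 * M ^ 2 + d * (400 * M ^ 2) + n + (n + d)) := by
      calc Q ^ (n * (400 * M)) = (Q ^ n) ^ (400 * M) := pow_mul _ _ _
        _ ≤ (2 ^ M * (Q ^ d * ‖w‖ * ‖w'‖) ^ M) ^ (400 * M) := by gcongr
        _ = 2 ^ (400 * M ^ 2) * Q ^ (d * (400 * M ^ 2)) * ‖w‖ ^ (400 * M ^ 2) * ‖w'‖ ^ (400 * M ^ 2) := by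
            simp only [mul_pow, ← pow_mul]
            ring_nf
        _ ≤ Q ^ (400 * M ^ 2) * Q ^ (d * (400 * M ^ 2)) * Q ^ n * Q ^ (n + d) := by
            rw [hd] at hs'
            gcongr
        _ = _ := by ring
    have h8 := (pow_le_pow_iff_right₀ (by linarith : 1 < Q)).mp h7
    by_contra! hlt
    nlinarith [Nat.zero_le (d * M), Nat.zero_le (n * M)]
  have hle : S.encard ≤ (↑(Finset.range (220 * M ^ 3)) : Set ℕ).encard := by
    refine Set.encard_le_encard_of_injOn (f := fun X => 2 * M * N X / N X₀) ?_ ?_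
    · intro X hX
      simp only [Finset.coe_range, Set.mem_Iio]
      rw [Nat.div_lt_iff_lt_mul hN0]
      obtain ⟨w, hw, hw0, hXe, hn, hx, hs⟩ := hN X₀ hX₀
      obtain ⟨w', hw', hw0', hYe, hn', hy, hs'⟩ := hN X hX
      by_contra! hge
      refine two_solutions O hconj hnorm η hη hη2 M (N X₀) (N X) hM w w' hw hw' hw0 hw0' ?_ ?_ hs hs' ?_ hn ?_
      · rw [← hXe]; exact hx
      · rw [← hYe]; exact hy
      · rw [← hXe]; exact hX₀.1
      · have : 2 * M * (110 * M ^ 2 * N X₀) ≤ 2 * M * N X := by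
          calc 2 * M * (110 * M ^ 2 * N X₀) = 220 * M ^ 3 * N X₀ := by ring
            _ ≤ _ := hge
        exact Nat.le_of_mul_le_mul_left this (by omega)
    · have key : ∀ X ∈ S, ∀ Y ∈ S, X ≠ Y → N X ≤ N Y → 2 * M * N X / N X₀ < 2 * M * N Y / N X₀ := by
        intro X hX Y hY hXY hle
        have h1 := hgap X hX Y hY hXY hle
        have h2 := hmin X hX
        have h3 : 2 * M * N X + N X₀ ≤ 2 * M * N Y := by
          obtain ⟨d, hd⟩ := Nat.exists_eq_add_of_le hle
          rw [show N Y - N X = d by omega] at h1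
          rw [hd]
          nlinarith
        calc 2 * M * N X / N X₀ < 2 * M * N X / N X₀ + 1 := Nat.lt_succ_self _
          _ = (2 * M * N X + N X₀) / N X₀ := (Nat.add_div_right _ hN0).symm
          _ ≤ _ := Nat.div_le_div_right h3
      intro X hX Y hY hXY
      by_contra hne
      rcases le_total (N X) (N Y) with h | h
      · exact absurd hXY (key X hX Y hY hne h).ne
      · exact absurd hXY.symm (key Y hY X hX (Ne.symm hne) h).ne
  refine hle.trans ?_
  rw [Set.encard_coe_eq_coe_finsetCard, Finset.card_range]
  push_cast
  rfl

/-- The arithmetic data attached to a nonreal root `α` of a quadratic polynomial over `ℤ`: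
a conjugation-stable ring `O` containing `α` and `η`, where `η` is the primitive part of `α ^ 2`
and has norm `Q`, and `‖α‖ = Q ^ l`. -/
structure RootSetting (α η : ℂ) (O : Subring ℂ) (Q l : ℝ) : Prop where
  conj_mem : ∀ z ∈ O, starRingEnd ℂ z ∈ O
  one_le_norm : ∀ z ∈ O, z ≠ 0 → 1 ≤ ‖z‖
  root_mem : α ∈ O
  eta_mem : η ∈ O
  norm_eta : ‖η‖ = Q
  two_le : 2 ≤ Q
  half_le : 1 / 2 ≤ l
  norm_root_pow : ∀ n : ℕ, ‖α‖ ^ n = Q ^ (l * n)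
  real_factor : ∃ g : ℝ, g ≠ 0 ∧ α ^ 2 = g * η
  nonreal : ∀ n : ℕ, 0 < n → (α ^ n).im ≠ 0
  norm_of_real : ∀ (k : ℕ), ∀ z ∈ O, z ≠ 0 → (α ^ k * z).im = 0 → Q ^ k ≤ ‖z‖ ^ 2

/-- `α ^ n * w` is a very good approximation to the real line. -/
structure NearReal (α : ℂ) (O : Subring ℂ) (Q : ℝ) (M n : ℕ) (w : ℂ) : Prop where
  mem : w ∈ O
  ne_zero : w ≠ 0
  le_exp : 800 * M ^ 2 ≤ n
  norm_le : ‖w‖ ≤ Q ^ ((n : ℝ) / (1000 * M ^ 2))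
  im_le : |(α ^ n * w).im| ≤ 50 * Q ^ (-(2 * n / M : ℝ)) * ‖α ^ n * w‖

theorem unitDir_mul (x y : ℂ) : unitDir (x * y) = unitDir x * unitDir y := by
  simp [unitDir, mul_div_mul_comm]

theorem unitDir_pow (x : ℂ) (n : ℕ) : unitDir (x ^ n) = unitDir x ^ n := by
  simp [unitDir, div_pow]

theorem unitDir_ofReal {r : ℝ} (hr : r ≠ 0) : unitDir (r : ℂ) = 1 := by
  simp [unitDir, Complex.conj_ofReal, hr]

theorem im_eq_zero_of_unitDir_eq_one {z : ℂ} (h : unitDir z = 1) : z.im = 0 := by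
  by_cases hz : z = 0
  · simp [hz]
  · rw [unitDir, div_eq_one_iff_eq (by simpa using hz)] at h
    exact Complex.conj_eq_iff_im.mp h.symm

theorem norm_unitDir_sub_one {z : ℂ} (hz : z ≠ 0) : ‖unitDir z - 1‖ * ‖z‖ = 2 * |z.im| := by
  have hc : starRingEnd ℂ z ≠ 0 := by simpa using hz
  have h1 : unitDir z - 1 = (z - starRingEnd ℂ z) / starRingEnd ℂ z := by
    rw [unitDir]; field_simp
  rw [h1, norm_div, Complex.norm_conj, div_mul_cancel₀ _ (norm_ne_zero_iff.mpr hz),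
    Complex.sub_conj]
  simp

namespace RootSetting

variable {α η : ℂ} {O : Subring ℂ} {Q l : ℝ} (S : RootSetting α η O Q l)

include S

theorem pos : 0 < Q := by linarith [S.two_le]

theorem one_le : 1 ≤ Q := by linarith [S.two_le]

theorem root_ne_zero : α ≠ 0 := by
  intro h
  have := S.nonreal 1 one_pos
  simp [h] at this

theorem unitDir_sq (n : ℕ) (w : ℂ) : unitDir (α ^ n * w) ^ 2 = unitDir (η ^ n * w ^ 2) := by
  obtain ⟨g, hg, h⟩ := S.real_factor
  rw [← unitDir_pow, mul_pow, ← pow_mul, mul_comm n 2, pow_mul, h, mul_pow, mul_assoc, unitDir_mul,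
    unitDir_pow, unitDir_ofReal hg, one_pow, one_mul]

theorem encard_nearReal_dir (M : ℕ) (hM : 1 ≤ M) :
    {X : ℂ | ∃ n w, NearReal α O Q M n w ∧ X = unitDir (α ^ n * w) ^ 2}.encard ≤
      220 * M ^ 3 + 1 := by
  refine (Set.encard_le_encard ?_).trans (encard_unitDir_le O S.conj_mem S.one_le_norm η S.eta_mem
    (by rw [S.norm_eta]; exact S.two_le) M hM)
  rintro X ⟨n, w, h, rfl⟩
  have hM0 : (0 : ℝ) < M := by exact_mod_cast hM
  have hQ0 := S.pos
  have hz : α ^ n * w ≠ 0 := mul_ne_zero (pow_ne_zero _ S.root_ne_zero) h.ne_zero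
  refine ⟨n, w ^ 2, O.pow_mem h.mem 2, pow_ne_zero 2 h.ne_zero, S.unitDir_sq n w, h.le_exp, ?_, ?_⟩
  · rw [S.norm_eta]
    have h1 : ‖unitDir (α ^ n * w) - 1‖ ≤ 100 * Q ^ (-(2 * n / M : ℝ)) := by
      have h2 := norm_unitDir_sub_one hz
      have h3 : 0 < ‖α ^ n * w‖ := norm_pos_iff.mpr hz
      refine le_of_mul_le_mul_right ?_ h3
      rw [h2]
      linarith [h.im_le]
    have h4 : ‖unitDir (α ^ n * w) ^ 2 - 1‖ ≤ 200 * Q ^ (-(2 * n / M : ℝ)) := by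
      have := norm_pow_sub_one_le _ (norm_unitDir hz).le 2
      push_cast at this
      linarith
    calc ‖unitDir (α ^ n * w) ^ 2 - 1‖ ^ M * Q ^ n ≤ (200 * Q ^ (-(2 * n / M : ℝ))) ^ M * Q ^ n := by
          gcongr
      _ = 200 ^ M * (Q ^ n)⁻¹ := by
          rw [mul_pow, ← Real.rpow_natCast (Q ^ (-(2 * n / M : ℝ))), ← Real.rpow_mul hQ0.le,
            show -(2 * n / M : ℝ) * M = -(2 * n : ℕ) by push_cast; field_simp, Real.rpow_neg hQ0.le,
            Real.rpow_natCast, two_mul, pow_add]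
          field_simp
      _ ≤ 1 := by
          rw [← div_eq_mul_inv, div_le_one (by positivity)]
          calc (200 : ℝ) ^ M ≤ (2 ^ 8) ^ M := by gcongr; norm_num
            _ = 2 ^ (8 * M) := by rw [pow_mul]
            _ ≤ 2 ^ n := by
                apply pow_le_pow_right₀ (by norm_num)
                have := h.le_exp
                nlinarith
            _ ≤ Q ^ n := by gcongr; exact S.two_le
  · rw [S.norm_eta, norm_pow, ← pow_mul]
    calc ‖w‖ ^ (2 * (400 * M ^ 2)) ≤ (Q ^ ((n : ℝ) / (1000 * M ^ 2))) ^ (2 * (400 * M ^ 2)) := by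
          gcongr; exact h.norm_le
      _ = Q ^ ((n : ℝ) * (4 / 5)) := by
          rw [← Real.rpow_natCast, ← Real.rpow_mul hQ0.le]
          congr 1
          push_cast
          field_simp
          ring
      _ ≤ Q ^ (n : ℝ) := by
          apply Real.rpow_le_rpow_of_exponent_le S.one_le
          have : (0 : ℝ) ≤ n := by positivity
          linarith
      _ = Q ^ n := Real.rpow_natCast _ _

theorem unitDir_pow_injective {i j : ℕ} (h : unitDir (α ^ i) ^ 2 = unitDir (α ^ j) ^ 2) : i = j := by
  have hα := S.root_ne_zero
  wlog hij : i ≤ j generalizing i j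
  · exact (this h.symm (by omega)).symm
  by_contra hne
  obtain ⟨d, rfl⟩ := Nat.exists_eq_add_of_le hij
  have h1 : unitDir (α ^ (d * 2)) = 1 := by
    rw [pow_add, unitDir_mul, mul_pow] at h
    have h2 := unitDir_ne_zero (pow_ne_zero i hα)
    rw [pow_mul, unitDir_pow (α ^ d)]
    exact mul_left_cancel₀ (pow_ne_zero 2 h2) (by rw [← h, mul_one])
  exact S.nonreal (d * 2) (by omega) (im_eq_zero_of_unitDir_eq_one h1)

theorem encard_nearReal_exp (M : ℕ) (hM : 1 ≤ M) (w : ℂ) :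
    {n : ℕ | NearReal α O Q M n w}.encard ≤ 220 * M ^ 3 + 1 := by
  refine (Set.encard_le_encard_of_injOn (f := fun n => unitDir (α ^ n * w) ^ 2) ?_ ?_).trans
    (S.encard_nearReal_dir M hM)
  · intro n hn
    exact ⟨n, w, hn, rfl⟩
  · intro n hn m hm h
    simp only [unitDir_mul, mul_pow] at h
    exact S.unitDir_pow_injective
      (mul_right_cancel₀ (pow_ne_zero 2 (unitDir_ne_zero (NearReal.ne_zero hn))) h)

end RootSetting

theorem encard_union_le_add {β : Type*} {s t : Set β} {a b : ℕ} (hs : s.encard ≤ a) (ht : t.encard ≤ b) :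
    (s ∪ t).encard ≤ (a + b : ℕ) := by
  push_cast
  exact (Set.encard_union_le s t).trans (add_le_add hs ht)

theorem encard_le_mul_of_fibers {β γ : Type*} {s : Set β} {t : Set γ} {a b : ℕ} (f : β → γ)
    (hst : Set.MapsTo f s t) (ht : t.encard ≤ a) (hf : ∀ y ∈ t, {x ∈ s | f x = y}.encard ≤ b) :
    s.encard ≤ (a * b : ℕ) := by
  classical
  have htf : t.Finite := Set.finite_of_encard_le_coe ht
  have hsf : s.Finite := by
    refine (htf.biUnion (t := fun y => {x ∈ s | f x = y}) fun y hy =>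
      Set.finite_of_encard_le_coe (hf y hy)).subset ?_
    intro x hx
    simp only [Set.mem_iUnion]
    exact ⟨f x, hst hx, hx, rfl⟩
  lift s to Finset β using hsf
  lift t to Finset γ using htf
  rw [Set.encard_coe_eq_coe_finsetCard] at ht ⊢
  have ht' : t.card ≤ a := by exact_mod_cast ht
  have h1 : s.card ≤ b * t.card := by
    refine Finset.card_le_mul_card_image_of_maps_to (f := f) (fun x hx => hst hx) b ?_
    intro y hy
    have h2 := hf y hy
    rw [show {x | x ∈ (s : Set β) ∧ f x = y} = ((s.filter fun x => f x = y : Finset β) : Set β) by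
      ext x; simp, Set.encard_coe_eq_coe_finsetCard] at h2
    exact_mod_cast h2
  have : s.card ≤ a * b := h1.trans (by rw [mul_comm]; gcongr)
  exact_mod_cast this

theorem encard_lt_le (R : ℕ) : {n : ℕ | n < R}.encard ≤ R := by
  have : {n : ℕ | n < R} = ((Finset.range R : Finset ℕ) : Set ℕ) := by ext; simp
  rw [this, Set.encard_coe_eq_coe_finsetCard, Finset.card_range]

theorem encard_le_of_injOn {β γ : Type*} {s : Set β} {t : Set γ} {a : ℕ} (f : β → γ)
    (ht : t.encard ≤ a) (hst : Set.MapsTo f s t) (hf : Set.InjOn f s) : s.encard ≤ a :=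
  (Set.encard_le_encard_of_injOn hst hf).trans ht

theorem exists_min_image_nat {β : Type*} (s : Set β) (hs : s.Nonempty) (f : β → ℕ) :
    ∃ x ∈ s, ∀ y ∈ s, f x ≤ f y := by
  obtain ⟨m, ⟨x, hx, rfl⟩, hm⟩ :=
    WellFounded.has_min (wellFounded_lt (α := ℕ)) (f '' s) (hs.image f)
  exact ⟨x, hx, fun y hy => not_lt.mp (hm _ ⟨y, hy, rfl⟩)⟩

theorem im_mul_conj_of_im_eq_zero {x y : ℂ} (hx : x.im = 0) (hy : y.im = 0) :
    (x * starRingEnd ℂ y).im = 0 := by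
  simp [hx, hy]

theorem im_of_im_mul_ofReal {r : ℝ} (hr : r ≠ 0) {z : ℂ} (h : ((r : ℂ) * z).im = 0) : z.im = 0 := by
  simpa [hr] using h

theorem abs_im_conj (z : ℂ) : |(starRingEnd ℂ z).im| = |z.im| := by simp

theorem pow_mul_conj_pow_self (α : ℂ) (n : ℕ) :
    α ^ n * (starRingEnd ℂ α) ^ n = ((‖α‖ ^ (2 * n) : ℝ) : ℂ) := by
  rw [← mul_pow, Complex.mul_conj, Complex.normSq_eq_norm_sq, pow_mul]
  push_cast
  rfl

/-- Dividing `α ^ x * conj α ^ y * w` by the largest real factor and possibly conjugating. -/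
theorem mixed_pow_cases (α w : ℂ) (x y : ℕ) :
    ∃ r : ℝ, r = ‖α‖ ^ (2 * min x y) ∧
      (y ≤ x → α ^ x * (starRingEnd ℂ α) ^ y * w = r * (α ^ (x - y) * w)) ∧
      (x ≤ y → α ^ x * (starRingEnd ℂ α) ^ y * w =
        starRingEnd ℂ (r * (α ^ (y - x) * starRingEnd ℂ w))) := by
  refine ⟨_, rfl, fun h => ?_, fun h => ?_⟩
  · obtain ⟨d, rfl⟩ := Nat.exists_eq_add_of_le h
    rw [min_eq_right h, ← pow_mul_conj_pow_self, pow_add, Nat.add_sub_cancel_left]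
    ring
  · obtain ⟨d, rfl⟩ := Nat.exists_eq_add_of_le h
    rw [min_eq_left h, ← pow_mul_conj_pow_self, Nat.add_sub_cancel_left]
    simp only [map_mul, map_pow, Complex.conj_conj, pow_add]
    ring

namespace RootSetting

variable {α η : ℂ} {O : Subring ℂ} {Q l : ℝ} (S : RootSetting α η O Q l)

include S

theorem conj_root_mem : starRingEnd ℂ α ∈ O := S.conj_mem _ S.root_mem

theorem norm_root_pos : 0 < ‖α‖ := norm_pos_iff.mpr S.root_ne_zero

theorem rpow_le {x y : ℝ} (h : x ≤ y) : Q ^ x ≤ Q ^ y :=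
  Real.rpow_le_rpow_of_exponent_le S.one_le h

theorem le_rpow_of_nat (m : ℕ) {x : ℝ} (h : (m : ℝ) ≤ x) : (2 : ℝ) ^ m ≤ Q ^ x := by
  calc (2 : ℝ) ^ m ≤ Q ^ m := by gcongr; exact S.two_le
    _ = Q ^ (m : ℝ) := (Real.rpow_natCast _ _).symm
    _ ≤ Q ^ x := S.rpow_le h

theorem one_lt_norm_root : 1 < ‖α‖ := by
  have h := S.norm_root_pow 1
  rw [pow_one] at h
  rw [h]
  apply Real.one_lt_rpow (by linarith [S.two_le])
  have := S.half_le
  simp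
  linarith

theorem norm_root_pow_le {i j : ℕ} (h : i ≤ j) : ‖α‖ ^ i ≤ ‖α‖ ^ j :=
  pow_le_pow_right₀ S.one_lt_norm_root.le h

/-- A good approximation of the form `α ^ x * conj α ^ y * w`. -/
theorem nearReal_of_mixed {w : ℂ} (hw : w ∈ O) (hw0 : w ≠ 0) {M x y N : ℕ}
    (hN : N = (x - y) + (y - x)) (hMN : 800 * M ^ 2 ≤ N)
    (hwn : ‖w‖ ≤ Q ^ ((N : ℝ) / (1000 * M ^ 2)))
    (him : |(α ^ x * (starRingEnd ℂ α) ^ y * w).im| ≤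
      50 * Q ^ (-(2 * N / M : ℝ)) * (‖α‖ ^ (x + y) * ‖w‖)) :
    (y ≤ x ∧ NearReal α O Q M N w) ∨ (x ≤ y ∧ NearReal α O Q M N (starRingEnd ℂ w)) := by
  obtain ⟨r, hr, h1, h2⟩ := mixed_pow_cases α w x y
  have hr0 : 0 < r := by rw [hr]; exact pow_pos S.norm_root_pos _
  have hxy : ‖α‖ ^ (x + y) = r * ‖α‖ ^ N := by
    rw [hr, ← pow_add]; congr 1; omega
  have key : ∀ u : ℂ, ‖u‖ = ‖w‖ → r * |(α ^ N * u).im| ≤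
      50 * Q ^ (-(2 * N / M : ℝ)) * (‖α‖ ^ (x + y) * ‖w‖) →
      |(α ^ N * u).im| ≤ 50 * Q ^ (-(2 * N / M : ℝ)) * ‖α ^ N * u‖ := by
    intro u hu h
    rw [hxy] at h
    refine le_of_mul_le_mul_left (h.trans (le_of_eq ?_)) hr0
    rw [norm_mul, norm_pow, hu]
    ring
  rcases le_total y x with h | h
  · refine Or.inl ⟨h, hw, hw0, hMN, hwn, key w rfl ?_⟩
    have hN' : x - y = N := by omega
    rwa [h1 h, hN', Complex.im_ofReal_mul, abs_mul, abs_of_pos hr0] at him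
  · refine Or.inr ⟨h, S.conj_mem _ hw, by simpa using hw0, hMN, by rwa [Complex.norm_conj],
      key _ (Complex.norm_conj w) ?_⟩
    have hN' : y - x = N := by omega
    rwa [h2 h, hN', abs_im_conj, Complex.im_ofReal_mul, abs_mul, abs_of_pos hr0] at him

end RootSetting

theorem encard_shift_le (n₁ : ℕ) (E : Set ℕ) {a : ℕ} (hE : E.encard ≤ a) :
    {n : ℕ | n₁ ≤ n ∧ n - n₁ ∈ E}.encard ≤ a := by
  refine encard_le_of_injOn (fun n => n - n₁) hE (fun n hn => hn.2) ?_
  intro x hx y hy h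
  have := hx.1
  have := hy.1
  simp only at h
  omega

theorem encard_reflect_le (n₁ : ℕ) (E : Set ℕ) {a : ℕ} (hE : E.encard ≤ a) :
    {n : ℕ | n ≤ n₁ ∧ n₁ - n ∈ E}.encard ≤ a := by
  refine encard_le_of_injOn (fun n => n₁ - n) hE (fun n hn => hn.2) ?_
  intro x hx y hy h
  have := hx.1
  have := hy.1
  simp only at h
  omega

namespace RootSetting

variable {α η : ℂ} {O : Subring ℂ} {Q l : ℝ} (S : RootSetting α η O Q l)

include S

theorem half_mul_le (n : ℕ) : (n : ℝ) / 2 ≤ l * n := by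
  have := S.half_le
  have h : (0 : ℝ) ≤ n := by positivity
  nlinarith

theorem im_mul_conj_sub_one {ω : ℂ} (hω : ω ≠ 0) {V : ℝ} {n₁ a b : ℕ} (h₁ : (ω * α ^ n₁).im = V)
    (ha : (ω * α ^ (n₁ + a)).im = V) (hb : (ω * α ^ (n₁ + b)).im = V) :
    ((α ^ b - 1) * ((starRingEnd ℂ α) ^ a - 1)).im = 0 := by
  have h2 : (ω * α ^ n₁ * (α ^ a - 1)).im = 0 := by
    rw [show ω * α ^ n₁ * (α ^ a - 1) = ω * α ^ (n₁ + a) - ω * α ^ n₁ by rw [pow_add]; ring,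
      Complex.sub_im, ha, h₁, sub_self]
  have h3 : (ω * α ^ n₁ * (α ^ b - 1)).im = 0 := by
    rw [show ω * α ^ n₁ * (α ^ b - 1) = ω * α ^ (n₁ + b) - ω * α ^ n₁ by rw [pow_add]; ring,
      Complex.sub_im, hb, h₁, sub_self]
  have h4 := im_mul_conj_of_im_eq_zero h3 h2
  have h5 : ω * α ^ n₁ ≠ 0 := mul_ne_zero hω (pow_ne_zero _ S.root_ne_zero)
  refine im_of_im_mul_ofReal (r := Complex.normSq (ω * α ^ n₁)) (by simpa using h5) ?_
  rw [← h4, ← Complex.mul_conj]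
  simp only [map_mul, map_sub, map_pow, map_one]
  ring_nf

theorem encard_im_eq_le {ω : ℂ} (hω : ω ≠ 0) (V : ℝ) :
    {n : ℕ | (ω * α ^ n).im = V}.encard ≤ (10 ^ 20 : ℕ) := by
  set T := {n : ℕ | (ω * α ^ n).im = V} with hT
  rcases T.eq_empty_or_nonempty with hemp | hnon
  · rw [hemp]; simp
  obtain ⟨n₁, hn₁, hmin₁⟩ := exists_min_image_nat T hnon id
  rcases (T \ {n₁}).eq_empty_or_nonempty with hemp | hnon
  · rw [Set.sdiff_eq_empty] at hemp
    refine (Set.encard_le_encard hemp).trans ?_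
    rw [Set.encard_singleton]
    norm_num
  obtain ⟨n₂, hn₂, hmin₂⟩ := exists_min_image_nat _ hnon id
  have h12 : n₁ < n₂ := lt_of_le_of_ne (hmin₁ n₂ hn₂.1) (fun h => hn₂.2 h.symm)
  obtain ⟨a, ha⟩ := Nat.exists_eq_add_of_lt h12
  set a' := a + 1 with ha'
  have hna : n₂ = n₁ + a' := by omega
  set β := starRingEnd ℂ α with hβ
  set w := β ^ a' - 1 with hw
  have hwO : w ∈ O := O.sub_mem (O.pow_mem S.conj_root_mem _) O.one_mem
  have hw0 : w ≠ 0 := by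
    intro h
    have h2 : β ^ a' = 1 := sub_eq_zero.mp h
    have h3 := S.nonreal a' (by omega)
    have h4 : (starRingEnd ℂ (α ^ a')).im = 0 := by rw [map_pow, ← hβ, h2]; simp
    rw [Complex.conj_im, neg_eq_zero] at h4
    exact h3 h4
  have hβn : ‖β‖ = ‖α‖ := Complex.norm_conj α
  have hA1 : 1 ≤ ‖α‖ ^ a' := one_le_pow₀ S.one_lt_norm_root.le
  have hQ0 := S.pos
  set R := 800 * 400000 ^ 2 with hR
  have hsub : T ⊆ (({n₁} ∪ {n₂}) ∪ ({n | n₁ ≤ n ∧ n - n₁ ∈ {k | k < R}} ∪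
      {n | n₁ ≤ n ∧ n - n₁ ∈ {k | NearReal α O Q 8 k w}})) ∪
      ({n | n₂ ≤ n ∧ n - n₂ ∈ {k | k < R}} ∪
      {n | n₂ ≤ n ∧ n - n₂ ∈ {k | NearReal α O Q 400000 k 1}}) := by
    intro n hn
    by_cases e1 : n = n₁
    · left; left; left; exact e1
    by_cases e2 : n = n₂
    · left; left; right; exact e2
    have h1n : n₁ ≤ n := hmin₁ n hn
    have h2n : n₂ ≤ n := hmin₂ n ⟨hn, e1⟩
    by_cases hbR : n - n₁ < R
    · left; right; left; exact ⟨h1n, hbR⟩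
    by_cases hnR : n - n₂ < R
    · right; left; exact ⟨h2n, hnR⟩
    obtain ⟨n', hn'⟩ := Nat.exists_eq_add_of_le h2n
    set b := a' + n' with hb
    have hnb : n = n₁ + b := by omega
    have him := S.im_mul_conj_sub_one hω hn₁ (a := a') (b := b) (by rw [← hna]; exact hn₂.1)
      (by rw [← hnb]; exact hn)
    rw [← hβ] at him
    have hbR' : R ≤ b := by omega
    have hnR' : R ≤ n' := by omega
    have hbr : (R : ℝ) ≤ b := by exact_mod_cast hbR'
    have hnr : (R : ℝ) ≤ n' := by exact_mod_cast hnR'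
    rw [hR] at hbr hnr
    push_cast at hbr hnr
    have hbn : (n' : ℝ) ≤ b := by rw [hb]; push_cast; linarith [(Nat.cast_nonneg a' : (0:ℝ) ≤ a')]
    by_cases hfar : l * a' ≤ (b : ℝ) / 200000
    · left; right; right
      refine ⟨h1n, ?_⟩
      rw [Set.mem_ofPred_eq, show n - n₁ = b by omega]
      refine ⟨hwO, hw0, by omega, ?_, ?_⟩
      · calc ‖w‖ ≤ ‖β ^ a'‖ + ‖(1 : ℂ)‖ := norm_sub_le _ _
          _ ≤ 2 * ‖α‖ ^ a' := by rw [_root_.norm_pow, hβn, norm_one]; linarith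
          _ = 2 ^ 1 * Q ^ (l * a') := by rw [S.norm_root_pow, pow_one]
          _ ≤ Q ^ (1 : ℝ) * Q ^ (l * a') := by
              gcongr
              exact S.le_rpow_of_nat 1 (by simp)
          _ = Q ^ (1 + l * a') := (Real.rpow_add hQ0 _ _).symm
          _ ≤ _ := S.rpow_le (by push_cast; linarith)
      · have h3 : |(α ^ b * w).im| ≤ ‖α‖ ^ a' := by
          have h4 : (α ^ b * w).im = (β ^ a').im := by
            rw [show (α ^ b - 1) * (β ^ a' - 1) = α ^ b * w - β ^ a' + 1 by rw [hw]; ring] at him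
            simp only [Complex.add_im, Complex.sub_im, Complex.one_im] at him
            linarith
          rw [h4, ← hβn, ← _root_.norm_pow]
          exact Complex.abs_im_le_norm _
        refine h3.trans ?_
        rw [norm_mul, _root_.norm_pow, S.norm_root_pow, S.norm_root_pow]
        have h5 := S.one_le_norm w hwO hw0
        calc Q ^ (l * a') ≤ Q ^ (-(2 * b / (8 : ℕ) : ℝ) + l * b) := by
              apply S.rpow_le
              have := S.half_mul_le b
              push_cast
              linarith
          _ = 1 * Q ^ (-(2 * b / (8 : ℕ) : ℝ)) * (Q ^ (l * b) * 1) := by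
              rw [Real.rpow_add hQ0]; ring
          _ ≤ 50 * Q ^ (-(2 * b / (8 : ℕ) : ℝ)) * (Q ^ (l * b) * ‖w‖) := by
              gcongr
              norm_num
    · right; right
      push Not at hfar
      refine ⟨h2n, ?_⟩
      rw [Set.mem_ofPred_eq, show n - n₂ = n' by omega]
      refine ⟨O.one_mem, one_ne_zero, hnR', ?_, ?_⟩
      · rw [norm_one]
        exact Real.one_le_rpow S.one_le (by positivity)
      · rw [mul_one]
        set A := ‖α‖ ^ a' with hA
        have hA0 : 0 < A := by linarith
        have h4 : A ^ 2 * (α ^ n').im = (α ^ b + β ^ a').im := by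
          have h5 : (α ^ b - 1) * (β ^ a' - 1) =
              ((A ^ 2 : ℝ) : ℂ) * α ^ n' - (α ^ b + β ^ a') + 1 := by
            have := pow_mul_conj_pow_self α a'
            rw [← hβ, mul_comm 2, pow_mul, ← hA] at this
            rw [← this, hb, pow_add]
            ring
          rw [h5] at him
          simp only [Complex.add_im, Complex.sub_im, Complex.one_im, Complex.im_ofReal_mul] at him ⊢
          linarith
        have h6 : A ^ 2 * |(α ^ n').im| ≤ 2 * (A * ‖α‖ ^ n') := by
          rw [← abs_of_pos (pow_pos hA0 2), ← abs_mul, h4]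
          refine (Complex.abs_im_le_norm _).trans ((norm_add_le _ _).trans ?_)
          rw [_root_.norm_pow, _root_.norm_pow, hβn, hb, pow_add, ← hA]
          have : 1 ≤ ‖α‖ ^ n' := one_le_pow₀ S.one_lt_norm_root.le
          nlinarith
        have h7 : A * |(α ^ n').im| ≤ 2 * ‖α‖ ^ n' := by
          refine le_of_mul_le_mul_left ?_ hA0
          linarith
        have h8 : 1 ≤ Q ^ (-(2 * n' / (400000 : ℕ) : ℝ)) * A := by
          rw [hA, S.norm_root_pow, ← Real.rpow_add hQ0]
          apply Real.one_le_rpow S.one_le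
          push_cast
          linarith
        rw [_root_.norm_pow]
        have hq : 0 < Q ^ (-(2 * n' / (400000 : ℕ) : ℝ)) := Real.rpow_pos_of_pos hQ0 _
        calc |(α ^ n').im| ≤ |(α ^ n').im| * (Q ^ (-(2 * n' / (400000 : ℕ) : ℝ)) * A) :=
              le_mul_of_one_le_right (abs_nonneg _) h8
          _ = Q ^ (-(2 * n' / (400000 : ℕ) : ℝ)) * (A * |(α ^ n').im|) := by ring
          _ ≤ Q ^ (-(2 * n' / (400000 : ℕ) : ℝ)) * (2 * ‖α‖ ^ n') := by gcongr
          _ ≤ Q ^ (-(2 * n' / (400000 : ℕ) : ℝ)) * (50 * ‖α‖ ^ n') := by gcongr; norm_num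
          _ = _ := by ring
  refine (Set.encard_le_encard hsub).trans ?_
  have hsing : ∀ x : ℕ, ({x} : Set ℕ).encard ≤ (1 : ℕ) := fun x => by simp
  have hN8 : {k | NearReal α O Q 8 k w}.encard ≤ (220 * 8 ^ 3 + 1 : ℕ) := by
    have := S.encard_nearReal_exp 8 (by norm_num) w
    exact_mod_cast this
  have hN4 : {k | NearReal α O Q 400000 k 1}.encard ≤ (220 * 400000 ^ 3 + 1 : ℕ) := by
    have := S.encard_nearReal_exp 400000 (by norm_num) 1
    exact_mod_cast this
  refine (encard_union_le_add (encard_union_le_add (encard_union_le_add (hsing _) (hsing _))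
    (encard_union_le_add (encard_shift_le _ _ (encard_lt_le R)) (encard_shift_le _ _ hN8)))
    (encard_union_le_add (encard_shift_le _ _ (encard_lt_le R)) (encard_shift_le _ _ hN4))).trans ?_
  norm_num [hR]

end RootSetting

namespace RootSetting

variable {α η : ℂ} {O : Subring ℂ} {Q l : ℝ} (S : RootSetting α η O Q l)

include S

theorem binomial_mem (c c' : ℤ) (d : ℕ) : (c : ℂ) + c' * α ^ d ∈ O :=
  O.add_mem (intCast_mem O c) (O.mul_mem (intCast_mem O c') (O.pow_mem S.root_mem d))

theorem binomial_ne_zero {c c' : ℤ} (hc' : c' ≠ 0) {d : ℕ} (hd : 0 < d) :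
    (c : ℂ) + c' * α ^ d ≠ 0 := by
  intro h
  have h1 := congrArg Complex.im h
  have h2 := S.nonreal d hd
  have h3 : (c' : ℝ) ≠ 0 := by exact_mod_cast hc'
  rw [Complex.add_im, Complex.intCast_im, zero_add, ← Complex.ofReal_intCast,
    Complex.im_ofReal_mul, Complex.zero_im] at h1
  exact (mul_ne_zero h3 h2) h1

omit S in
theorem norm_intCast_le {c : ℤ} (h : |c| ≤ 2) : ‖(c : ℂ)‖ ≤ 2 := by
  rw [Complex.norm_intCast]
  exact_mod_cast h

theorem norm_binomial_le {c c' : ℤ} (hc : |c| ≤ 2) (hc' : |c'| ≤ 2) (d : ℕ) :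
    ‖(c : ℂ) + c' * α ^ d‖ ≤ 4 * ‖α‖ ^ d := by
  have h1 : 1 ≤ ‖α‖ ^ d := one_le_pow₀ S.one_lt_norm_root.le
  calc ‖(c : ℂ) + c' * α ^ d‖ ≤ ‖(c : ℂ)‖ + ‖(c' : ℂ)‖ * ‖α‖ ^ d := by
        rw [← _root_.norm_pow, ← norm_mul]; exact norm_add_le _ _
    _ ≤ 2 + 2 * ‖α‖ ^ d := by
        gcongr
        · exact norm_intCast_le hc
        · exact norm_intCast_le hc'
    _ ≤ _ := by linarith

theorem norm_binomial_le_rpow {c c' : ℤ} (hc : |c| ≤ 2) (hc' : |c'| ≤ 2) (d : ℕ) {x : ℝ}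
    (hx : 2 + l * d ≤ x) : ‖(c : ℂ) + c' * α ^ d‖ ≤ Q ^ x := by
  refine (S.norm_binomial_le hc hc' d).trans ?_
  calc 4 * ‖α‖ ^ d = 2 ^ 2 * Q ^ (l * d) := by rw [S.norm_root_pow]; norm_num
    _ ≤ Q ^ (2 : ℝ) * Q ^ (l * d) := by
        exact mul_le_mul_of_nonneg_right (S.le_rpow_of_nat 2 (by norm_num))
          (Real.rpow_nonneg S.pos.le _)
    _ = Q ^ (2 + l * d) := (Real.rpow_add S.pos _ _).symm
    _ ≤ _ := S.rpow_le hx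

theorem le_of_rpow_le {x y : ℝ} (h : Q ^ x ≤ Q ^ y) : x ≤ y :=
  (Real.rpow_le_rpow_left_iff (by linarith [S.two_le])).mp h

theorem pow_le_of_mixed_real {w : ℂ} (hw : w ∈ O) (hw0 : w ≠ 0) {x y N : ℕ}
    (hN : N = (x - y) + (y - x)) (him : (α ^ x * (starRingEnd ℂ α) ^ y * w).im = 0) :
    Q ^ N ≤ ‖w‖ ^ 2 := by
  obtain ⟨r, hr, h1, h2⟩ := mixed_pow_cases α w x y
  have hr0 : r ≠ 0 := by rw [hr]; exact (pow_pos S.norm_root_pos _).ne'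
  rcases le_total y x with h | h
  · rw [h1 h, show x - y = N by omega] at him
    exact S.norm_of_real N w hw hw0 (im_of_im_mul_ofReal hr0 him)
  · rw [h2 h, show y - x = N by omega, Complex.conj_im, neg_eq_zero] at him
    have := S.norm_of_real N _ (S.conj_mem _ hw) (by simpa using hw0) (im_of_im_mul_ofReal hr0 him)
    rwa [Complex.norm_conj] at this

set_option maxHeartbeats 800000 in
/-- Pairs of exponents for which a binomial lies on a fixed line through the origin. -/
theorem encard_binomial_real_le {c c' : ℤ} (hc0 : c ≠ 0) (hc : |c| ≤ 2) (hc0' : c' ≠ 0)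
    (hc' : |c'| ≤ 2) {w : ℂ} (hw : w ≠ 0) :
    {p : ℕ × ℕ | p.1 < p.2 ∧ ((c * α ^ p.1 + c' * α ^ p.2) * w).im = 0}.encard ≤
      (10 ^ 46 : ℕ) := by
  set T := {p : ℕ × ℕ | p.1 < p.2 ∧ ((c * α ^ p.1 + c' * α ^ p.2) * w).im = 0} with hT
  rcases T.eq_empty_or_nonempty with hemp | hnon
  · rw [hemp]; simp
  obtain ⟨⟨t₁, r₁⟩, ⟨hlt₁, him₁⟩, hmin⟩ := exists_min_image_nat T hnon fun p => p.2 - p.1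
  simp only at hlt₁ him₁ hmin
  have hcC : ((c : ℤ) : ℂ) ≠ 0 := by exact_mod_cast hc0
  set β := starRingEnd ℂ α with hβ
  have hβn : ‖β‖ = ‖α‖ := Complex.norm_conj α
  set d₁ := r₁ - t₁ with hd₁
  set γ₁ : ℂ := c + c' * β ^ d₁ with hγ₁
  have hγc : γ₁ = starRingEnd ℂ (c + c' * α ^ d₁) := by simp [hγ₁, hβ]
  have hγO : γ₁ ∈ O := by rw [hγc]; exact S.conj_mem _ (S.binomial_mem _ _ _)
  have hγ0 : γ₁ ≠ 0 := by
    rw [hγc]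
    exact (map_ne_zero _).mpr (S.binomial_ne_zero hc0' (by omega))
  have hγn : ∀ {x : ℝ}, 2 + l * d₁ ≤ x → ‖γ₁‖ ≤ Q ^ x := by
    intro x hx
    rw [hγc, Complex.norm_conj]
    exact S.norm_binomial_le_rpow hc hc' d₁ hx
  have hQ0 := S.pos
  have hα0 := S.norm_root_pos
  have hα1 := S.one_lt_norm_root
  have hcn : ‖(c : ℂ)‖ ≤ 2 := norm_intCast_le hc
  have hcn' : ‖(c' : ℂ)‖ ≤ 2 := norm_intCast_le hc'
  set R := 800 * 20000000 ^ 2 with hR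
  set E := {k | k < R} ∪ {k | NearReal α O Q 20000000 k 1} with hE
  set U := ({r | r₁ ≤ r ∧ r - r₁ ∈ E} ∪ {r | r ≤ r₁ ∧ r₁ - r ∈ E}) ∪
    ({r | t₁ ≤ r ∧ r - t₁ ∈ {k | NearReal α O Q 48 k γ₁}} ∪
      {r | r ≤ t₁ ∧ t₁ - r ∈ {k | NearReal α O Q 48 k (starRingEnd ℂ γ₁)}}) with hU
  have hmaps : Set.MapsTo Prod.snd T U := by
    rintro ⟨t, r⟩ ⟨hlt, him⟩
    simp only at hlt him ⊢
    have hdmin := hmin (t, r) ⟨hlt, him⟩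
    simp only at hdmin
    set n := (r - r₁) + (r₁ - r) with hn
    by_cases hnR : n < R
    · left
      rcases le_total r₁ r with h | h
      · left; exact ⟨h, Or.inl (by simp only [Set.mem_ofPred_eq]; omega)⟩
      · right; exact ⟨h, Or.inl (by simp only [Set.mem_ofPred_eq]; omega)⟩
    have hnr : (R : ℝ) ≤ n := by exact_mod_cast not_lt.mp hnR
    rw [hR] at hnr
    push_cast at hnr
    set d := r - t with hd
    have hrt : r = t + d := by omega
    have hrt₁ : r₁ = t₁ + d₁ := by omega
    have hreal : ((c * α ^ t + c' * α ^ r) * (β ^ t₁ * γ₁)).im = 0 := by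
      have h4 := im_mul_conj_of_im_eq_zero him him₁
      refine im_of_im_mul_ofReal (r := Complex.normSq w) (by simpa using hw) ?_
      rw [← h4, ← Complex.mul_conj]
      simp only [map_mul, map_add, map_pow, map_intCast, ← hβ, hγ₁]
      rw [hrt₁, pow_add]
      ring_nf
    have hhd := S.half_mul_le d
    have hhd₁ := S.half_mul_le d₁
    have habs : ∀ {i j : ℕ}, |(α ^ i * β ^ j).im| ≤ ‖α‖ ^ (i + j) := by
      intro i j
      refine (Complex.abs_im_le_norm _).trans (le_of_eq ?_)
      rw [norm_mul, _root_.norm_pow, _root_.norm_pow, hβn, pow_add]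
    by_cases h2 : (n : ℝ) / 10000000 ≤ l * d₁
    · left
      have h3 : |(α ^ r * β ^ r₁ * 1).im| ≤
          50 * Q ^ (-(2 * n / (20000000 : ℕ) : ℝ)) * (‖α‖ ^ (r + r₁) * ‖(1 : ℂ)‖) := by
        rw [mul_one, norm_one, mul_one]
        have e1 : (c' ^ 2 : ℤ) * (α ^ r * β ^ r₁).im = - ((c ^ 2 : ℤ) * (α ^ t * β ^ t₁).im
            + (c * c' : ℤ) * (α ^ t * β ^ r₁).im + (c * c' : ℤ) * (α ^ r * β ^ t₁).im) := by
          rw [show (c * α ^ t + c' * α ^ r) * (β ^ t₁ * γ₁) =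
            ((c' ^ 2 : ℤ) : ℝ) * (α ^ r * β ^ r₁) + (((c ^ 2 : ℤ) : ℝ) * (α ^ t * β ^ t₁)
            + ((c * c' : ℤ) : ℝ) * (α ^ t * β ^ r₁) + ((c * c' : ℤ) : ℝ) * (α ^ r * β ^ t₁)) by
              rw [hrt₁, hγ₁, pow_add]; push_cast; ring] at hreal
          simp only [Complex.add_im, Complex.im_ofReal_mul] at hreal
          linarith
        have i1 : ((c' ^ 2 : ℤ) : ℝ) ≥ 1 := by
          have : 1 ≤ c' ^ 2 := by have := sq_pos_of_ne_zero hc0'; omega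
          exact_mod_cast this
        have i2 : |((c ^ 2 : ℤ) : ℝ)| ≤ 4 := by
          have : |c ^ 2| ≤ 4 := by rw [abs_pow]; nlinarith [abs_nonneg c]
          exact_mod_cast this
        have i3 : |((c * c' : ℤ) : ℝ)| ≤ 4 := by
          have : |c * c'| ≤ 4 := by rw [abs_mul]; nlinarith [abs_nonneg c, abs_nonneg c']
          exact_mod_cast this
        set P := ‖α‖ ^ (r + t₁) with hP
        have k1 : |(α ^ t * β ^ t₁).im| ≤ P := habs.trans (S.norm_root_pow_le (by omega))
        have k2 : |(α ^ t * β ^ r₁).im| ≤ P := habs.trans (S.norm_root_pow_le (by omega))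
        have k3 : |(α ^ r * β ^ t₁).im| ≤ P := habs
        have k4 : |(α ^ r * β ^ r₁).im| ≤ 12 * P := by
          calc |(α ^ r * β ^ r₁).im| ≤ ((c' ^ 2 : ℤ) : ℝ) * |(α ^ r * β ^ r₁).im| :=
                le_mul_of_one_le_left (abs_nonneg _) i1
            _ = |((c' ^ 2 : ℤ) : ℝ) * (α ^ r * β ^ r₁).im| := by
                rw [abs_mul, abs_of_nonneg (by linarith : (0:ℝ) ≤ ((c' ^ 2 : ℤ) : ℝ))]
            _ ≤ |((c ^ 2 : ℤ) : ℝ)| * |(α ^ t * β ^ t₁).im| +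
                |((c * c' : ℤ) : ℝ)| * |(α ^ t * β ^ r₁).im| +
                |((c * c' : ℤ) : ℝ)| * |(α ^ r * β ^ t₁).im| := by
                rw [e1, abs_neg, ← abs_mul, ← abs_mul, ← abs_mul]
                exact abs_add_three _ _ _
            _ ≤ 4 * P + 4 * P + 4 * P := by gcongr
            _ = _ := by ring
        refine k4.trans ?_
        have k5 : ‖α‖ ^ (r + r₁) = P * Q ^ (l * d₁) := by
          rw [← S.norm_root_pow, hP, ← pow_add]; congr 1; omega
        rw [k5]
        have hP0 : 0 < P := pow_pos hα0 _
        have k6 : 1 ≤ Q ^ (-(2 * n / (20000000 : ℕ) : ℝ)) * Q ^ (l * d₁) := by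
          rw [← Real.rpow_add hQ0]
          apply Real.one_le_rpow S.one_le
          push_cast
          linarith
        nlinarith
      rcases S.nearReal_of_mixed O.one_mem one_ne_zero hn (by omega) (by
          rw [norm_one]; exact Real.one_le_rpow S.one_le (by positivity)) h3 with ⟨h, h4⟩ | ⟨h, h4⟩
      · left; exact ⟨h, Or.inr (by rwa [Set.mem_ofPred_eq, show r - r₁ = n by omega])⟩
      · right
        rw [map_one] at h4
        exact ⟨h, Or.inr (by rwa [Set.mem_ofPred_eq, show r₁ - r = n by omega])⟩
    · push Not at h2
      set N := (r - t₁) + (t₁ - r) with hN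
      have hd₁n : 1000000 * d₁ ≤ n := by
        have : (1000000 : ℝ) * d₁ ≤ n := by linarith
        exact_mod_cast this
      by_cases h3 : (n : ℝ) / 12 ≤ l * d
      · right
        have hNn : n ≤ 2 * N := by omega
        have hNn' : N ≤ 2 * n := by omega
        have hNr : (n : ℝ) ≤ 2 * N := by exact_mod_cast hNn
        have hNr' : (N : ℝ) ≤ 2 * n := by exact_mod_cast hNn'
        have h4 : |(α ^ r * β ^ t₁ * γ₁).im| ≤
            50 * Q ^ (-(2 * N / (48 : ℕ) : ℝ)) * (‖α‖ ^ (r + t₁) * ‖γ₁‖) := by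
          have e1 : (c' : ℝ) * (α ^ r * β ^ t₁ * γ₁).im = - (c * (α ^ t * β ^ t₁ * γ₁).im) := by
            rw [show (c * α ^ t + c' * α ^ r) * (β ^ t₁ * γ₁) =
              (c' : ℝ) * (α ^ r * β ^ t₁ * γ₁) + (c : ℝ) * (α ^ t * β ^ t₁ * γ₁) by
                push_cast; ring] at hreal
            simp only [Complex.add_im, Complex.im_ofReal_mul] at hreal
            linarith
          have i1 : 1 ≤ |(c' : ℝ)| := by exact_mod_cast Int.one_le_abs hc0'
          have i2 : |(c : ℝ)| ≤ 2 := by exact_mod_cast hc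
          have k1 : |(α ^ r * β ^ t₁ * γ₁).im| ≤ 2 * (‖α‖ ^ (t + t₁) * ‖γ₁‖) := by
            calc |(α ^ r * β ^ t₁ * γ₁).im| ≤ |(c' : ℝ)| * |(α ^ r * β ^ t₁ * γ₁).im| :=
                  le_mul_of_one_le_left (abs_nonneg _) i1
              _ = |(c : ℝ)| * |(α ^ t * β ^ t₁ * γ₁).im| := by
                  rw [← abs_mul, e1, abs_neg, abs_mul]
              _ ≤ 2 * ‖α ^ t * β ^ t₁ * γ₁‖ := by
                  gcongr
                  exact Complex.abs_im_le_norm _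
              _ = _ := by
                  rw [norm_mul, norm_mul, _root_.norm_pow, _root_.norm_pow, hβn, pow_add]
          refine k1.trans ?_
          have k5 : ‖α‖ ^ (r + t₁) = ‖α‖ ^ (t + t₁) * Q ^ (l * d) := by
            rw [← S.norm_root_pow, ← pow_add]; congr 1; omega
          rw [k5]
          have k6 : 1 ≤ Q ^ (-(2 * N / (48 : ℕ) : ℝ)) * Q ^ (l * d) := by
            rw [← Real.rpow_add hQ0]
            apply Real.one_le_rpow S.one_le
            push_cast
            linarith
          have k7 : 0 ≤ ‖α‖ ^ (t + t₁) * ‖γ₁‖ := by positivity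
          nlinarith
        rcases S.nearReal_of_mixed hγO hγ0 hN (by omega) (hγn (by push_cast; linarith)) h4 with
          ⟨h, h5⟩ | ⟨h, h5⟩
        · left; exact ⟨h, by rwa [Set.mem_ofPred_eq, show r - t₁ = N by omega]⟩
        · right; exact ⟨h, by rwa [Set.mem_ofPred_eq, show t₁ - r = N by omega]⟩
      · exfalso
        push Not at h3
        set k := (t - t₁) + (t₁ - t) with hk
        have hdn : 6 * d ≤ n := by
          have : (6 : ℝ) * d ≤ n := by linarith
          exact_mod_cast this
        have hkn : n ≤ k + d + d₁ := by omega
        have hw2 : ((c + c' * α ^ d) * γ₁) ≠ 0 :=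
          mul_ne_zero (S.binomial_ne_zero hc0' (by omega)) hγ0
        have h4 := S.pow_le_of_mixed_real (O.mul_mem (S.binomial_mem c c' d) hγO) hw2 hk (by
          rw [← hβ, ← hreal, hrt, pow_add]; ring_nf)
        have h5 : ‖((c + c' * α ^ d) * γ₁)‖ ≤ Q ^ (4 + l * d + l * d₁) := by
          rw [norm_mul, show 4 + l * d + l * d₁ = (2 + l * d) + (2 + l * d₁) by ring,
            Real.rpow_add hQ0]
          gcongr
          · exact S.norm_binomial_le_rpow hc hc' d le_rfl
          · exact hγn le_rfl
        have h6 : Q ^ (k : ℝ) ≤ Q ^ ((4 + l * d + l * d₁) * 2) := by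
          rw [Real.rpow_natCast, Real.rpow_mul hQ0.le]
          refine h4.trans ?_
          rw [Real.rpow_ofNat]
          gcongr
        have h7 := S.le_of_rpow_le h6
        have h8 : (n : ℝ) ≤ k + d + d₁ := by exact_mod_cast hkn
        have h9 : (1000000 : ℝ) * d₁ ≤ n := by exact_mod_cast hd₁n
        have h10 : (6 : ℝ) * d ≤ n := by exact_mod_cast hdn
        linarith
  have hEc : E.encard ≤ (R + (220 * 20000000 ^ 3 + 1) : ℕ) := by
    refine encard_union_le_add (encard_lt_le R) ?_
    have := S.encard_nearReal_exp 20000000 (by norm_num) 1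
    exact_mod_cast this
  have h48 : ∀ u, {k | NearReal α O Q 48 k u}.encard ≤ (220 * 48 ^ 3 + 1 : ℕ) := by
    intro u
    have := S.encard_nearReal_exp 48 (by norm_num) u
    exact_mod_cast this
  have hUc := encard_union_le_add
    (encard_union_le_add (encard_shift_le r₁ _ hEc) (encard_reflect_le r₁ _ hEc))
    (encard_union_le_add (encard_shift_le t₁ _ (h48 γ₁))
      (encard_reflect_le t₁ _ (h48 (starRingEnd ℂ γ₁))))
  refine (encard_le_mul_of_fibers Prod.snd hmaps hUc (b := 10 ^ 20) ?_).trans ?_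
  · intro r _
    refine encard_le_of_injOn Prod.fst
      (S.encard_im_eq_le (mul_ne_zero hcC hw) (-((c' * α ^ r * w).im))) ?_ ?_
    · rintro ⟨t, r'⟩ ⟨⟨_, him⟩, rfl⟩
      simp only at him ⊢
      rw [add_mul, Complex.add_im] at him
      rw [Set.mem_ofPred_eq, show c * w * α ^ t = c * α ^ t * w by ring]
      linarith
    · rintro ⟨t, r'⟩ ⟨_, h⟩ ⟨t', r''⟩ ⟨_, h'⟩ h2
      simp only at h h' h2
      rw [h, h', h2]
  · norm_num [hR]

end RootSetting

theorem unitDir_conj (z : ℂ) : unitDir (starRingEnd ℂ z) = (unitDir z)⁻¹ := by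
  simp [unitDir]

theorem im_mul_I_eq_zero_of_unitDir {z : ℂ} (h : unitDir z = -1) : (z * Complex.I).im = 0 := by
  apply im_eq_zero_of_unitDir_eq_one
  rw [unitDir_mul, h]
  simp [unitDir, Complex.conj_I]

theorem im_eq_zero_or_of_unitDir_sq_eq {z w : ℂ} (hw : w ≠ 0) (h : unitDir z ^ 2 = unitDir w ^ 2) :
    (z * starRingEnd ℂ w).im = 0 ∨ (z * (starRingEnd ℂ w * Complex.I)).im = 0 := by
  have hw' := unitDir_ne_zero hw
  have h1 : unitDir (z * starRingEnd ℂ w) ^ 2 = 1 := by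
    rw [unitDir_mul, unitDir_conj, mul_pow, h, inv_pow, mul_inv_cancel₀ (pow_ne_zero 2 hw')]
  rcases sq_eq_one_iff.mp h1 with h2 | h2
  · exact Or.inl (im_eq_zero_of_unitDir_eq_one h2)
  · right
    rw [← mul_assoc]
    exact im_mul_I_eq_zero_of_unitDir h2

namespace RootSetting

variable {α η : ℂ} {O : Subring ℂ} {Q l : ℝ} (S : RootSetting α η O Q l)

include S

theorem norm_root_pow_eq (s t : ℕ) : ‖α‖ ^ t = ‖α‖ ^ s * Q ^ (l * ((t : ℝ) - s)) := by
  rw [S.norm_root_pow, S.norm_root_pow, ← Real.rpow_add S.pos]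
  congr 1
  ring

theorem half_sub_le {s t : ℕ} (h : s ≤ t) : ((t : ℝ) - s) / 2 ≤ l * ((t : ℝ) - s) := by
  have := S.half_le
  have h' : (s : ℝ) ≤ t := by exact_mod_cast h
  nlinarith

omit S in
theorem binomial_factor (c c' : ℤ) (α : ℂ) {s t : ℕ} (h : s ≤ t) :
    (c : ℂ) * α ^ s + c' * α ^ t = α ^ s * (c + c' * α ^ (t - s)) := by
  obtain ⟨d, rfl⟩ := Nat.exists_eq_add_of_le h
  rw [Nat.add_sub_cancel_left, pow_add]
  ring

theorem binomial_ne_zero' {c c' : ℤ} (hc' : c' ≠ 0) {s t : ℕ} (h : s < t) :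
    (c : ℂ) * α ^ s + c' * α ^ t ≠ 0 := by
  rw [binomial_factor c c' α h.le]
  exact mul_ne_zero (pow_ne_zero _ S.root_ne_zero) (S.binomial_ne_zero hc' (by omega))

/-- Pairs of exponents for which a binomial is close to the real line. -/
theorem encard_nearReal_binomial_le {c c' : ℤ} (hc0 : c ≠ 0) (hc : |c| ≤ 2) (hc0' : c' ≠ 0)
    (hc' : |c'| ≤ 2) {M : ℕ} (hM : 1 ≤ M) {P : Set (ℕ × ℕ)} (hP : ∀ p ∈ P, p.1 < p.2)
    (hN : ∀ p ∈ P, NearReal α O Q M p.1 (c + c' * α ^ (p.2 - p.1))) :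
    P.encard ≤ ((220 * M ^ 3 + 1) * (2 * 10 ^ 46) : ℕ) := by
  have hX := S.encard_nearReal_dir M hM
  refine encard_le_mul_of_fibers (fun p : ℕ × ℕ => unitDir (c * α ^ p.1 + c' * α ^ p.2) ^ 2)
    (t := {X : ℂ | ∃ n w, NearReal α O Q M n w ∧ X = unitDir (α ^ n * w) ^ 2})
    ?_ (by exact_mod_cast hX) ?_
  · intro p hp
    refine ⟨_, _, hN p hp, ?_⟩
    simp only
    rw [binomial_factor c c' α (hP p hp).le]
  · intro y _
    rcases Set.eq_empty_or_nonempty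
      {p | p ∈ P ∧ unitDir (c * α ^ p.1 + c' * α ^ p.2) ^ 2 = y} with hemp | ⟨p₀, hp₀, hy⟩
    · rw [hemp]; simp
    · have hw := S.binomial_ne_zero' (c := c) hc0' (hP p₀ hp₀)
      have hw' : starRingEnd ℂ (c * α ^ p₀.1 + c' * α ^ p₀.2) ≠ 0 := (map_ne_zero _).mpr hw
      have h1 := S.encard_binomial_real_le hc0 hc hc0' hc' hw'
      have h2 := S.encard_binomial_real_le hc0 hc hc0' hc' (mul_ne_zero hw' Complex.I_ne_zero)
      refine (Set.encard_le_encard ?_).trans ((encard_union_le_add h1 h2).trans (by norm_num))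
      rintro p ⟨hp, hpy⟩
      rcases im_eq_zero_or_of_unitDir_sq_eq hw (hpy.trans hy.symm) with h | h
      · exact Or.inl ⟨hP p hp, h⟩
      · exact Or.inr ⟨hP p hp, h⟩

theorem norm_pow_mul_ge {n : ℕ} {w : ℂ} (hw : w ∈ O) (hw0 : w ≠ 0) :
    ‖α‖ ^ n ≤ ‖α ^ n * w‖ := by
  rw [norm_mul, _root_.norm_pow]
  exact le_mul_of_one_le_right (pow_nonneg S.norm_root_pos.le _) (S.one_le_norm w hw hw0)

omit S in
theorem abs_im_intCast_mul_pow_le {c : ℤ} (hc : |c| ≤ 2) (n : ℕ) :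
    |((c : ℂ) * α ^ n).im| ≤ 2 * ‖α‖ ^ n := by
  refine (Complex.abs_im_le_norm _).trans ?_
  rw [norm_mul, _root_.norm_pow]
  gcongr
  exact norm_intCast_le hc

omit S in
theorem abs_im_le_of_abs_im_mul_le {c : ℤ} (hc : c ≠ 0) {z : ℂ} {x : ℝ}
    (h : |((c : ℂ) * z).im| ≤ x) : |z.im| ≤ x := by
  refine le_trans ?_ h
  rw [← Complex.ofReal_intCast, Complex.im_ofReal_mul, abs_mul]
  exact le_mul_of_one_le_left (abs_nonneg _) (by exact_mod_cast Int.one_le_abs hc)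

/-- The larger exponents in the range where they are close to a given `t₁` and far from the
smaller ones. -/
theorem encard_snd_le_of_far {c c' : ℤ} (hc : |c| ≤ 2) (hc0' : c' ≠ 0)
    {V : ℝ} {t₁ : ℕ} {P : Set (ℕ × ℕ)} (hP : ∀ p ∈ P, p.1 < p.2)
    (hV : ∀ p ∈ P, (c * α ^ p.1 + c' * α ^ p.2).im = V)
    (hR : ∀ p ∈ P, 10 ^ 44 ≤ p.2) (ht₁ : ∀ p ∈ P, t₁ ≤ p.2)
    (hnear : ∀ p ∈ P, l * ((p.2 : ℝ) - t₁) ≤ p.2 / 10 ^ 7)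
    (hfar : ∀ p ∈ P, (p.2 : ℝ) / 10 ≤ l * ((p.2 : ℝ) - p.1)) :
    (Prod.snd '' P).encard ≤ (1 + (220 * 40 ^ 3 + 1) * (2 * 10 ^ 46) : ℕ) := by
  rcases P.eq_empty_or_nonempty with hemp | hnon
  · rw [hemp]; simp
  obtain ⟨⟨s₂, t₂⟩, hp₂, hmin⟩ := exists_min_image_nat P hnon Prod.snd
  simp only at hmin
  have hlt₂ := hP _ hp₂
  have hV₂ := hV _ hp₂
  have hR₂ := hR _ hp₂
  have ht₂ := ht₁ _ hp₂
  have hfar₂ := hfar _ hp₂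
  simp only at hlt₂ hV₂ hR₂ ht₂ hfar₂
  have hQ0 := S.pos
  have hα0 := S.norm_root_pos
  set F : Set (ℕ × ℕ) := {q | q.1 = t₂ ∧ t₂ < q.2 ∧ q.2 ∈ Prod.snd '' P} with hF
  have hFc : F.encard ≤ ((220 * 40 ^ 3 + 1) * (2 * 10 ^ 46) : ℕ) := by
    refine S.encard_nearReal_binomial_le (c := -1) (c' := 1) (by norm_num) (by norm_num)
      (by norm_num) (by norm_num) (M := 40) (by norm_num) (fun q hq => by rw [hq.1]; exact hq.2.1) ?_
    rintro ⟨x, t⟩ ⟨hx, hlt, ⟨s, t'⟩, hp, htt⟩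
    simp only at hx hlt htt ⊢
    subst hx htt
    have hltp := hP _ hp
    have hVp := hV _ hp
    have hnearp := hnear _ hp
    have hfarp := hfar _ hp
    simp only at hltp hVp hnearp hfarp
    have hr2 : (10 : ℝ) ^ 44 ≤ x := by exact_mod_cast hR₂
    have hxt : (x : ℝ) ≤ t' := by exact_mod_cast hlt.le
    have ht₂r : (t₁ : ℝ) ≤ x := by exact_mod_cast ht₂
    have hhalf := S.half_sub_le hlt.le
    have hl0 := S.half_le
    have hle : l * ((t' : ℝ) - x) ≤ t' / 10 ^ 7 := by
      refine le_trans ?_ hnearp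
      gcongr
    have hm := S.binomial_mem (-1) 1 (t' - x)
    have h0 := S.binomial_ne_zero (c := -1) (c' := 1) one_ne_zero (d := t' - x) (by omega)
    refine ⟨hm, h0, by omega, ?_, ?_⟩
    · apply S.norm_binomial_le_rpow (by norm_num) (by norm_num)
      rw [Nat.cast_sub hlt.le]
      push_cast
      linarith
    · have e0 : α ^ x * (((-1 : ℤ) : ℂ) + ((1 : ℤ) : ℂ) * α ^ (t' - x)) = α ^ t' - α ^ x := by
        rw [← binomial_factor _ _ _ hlt.le]; push_cast; ring
      have e1 := S.norm_pow_mul_ge (n := x) hm h0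
      have e2 : |(α ^ t' - α ^ x).im| ≤ 2 * ‖α‖ ^ s + 2 * ‖α‖ ^ s₂ := by
        apply abs_im_le_of_abs_im_mul_le hc0'
        have : ((c' : ℂ) * (α ^ t' - α ^ x)).im = (c * α ^ s₂).im - (c * α ^ s).im := by
          rw [Complex.add_im] at hVp hV₂
          rw [mul_sub, Complex.sub_im]
          linarith
        rw [this, add_comm]
        exact (abs_sub _ _).trans (add_le_add (abs_im_intCast_mul_pow_le hc _)
          (abs_im_intCast_mul_pow_le hc _))
      have e3 : ‖α‖ ^ s ≤ ‖α‖ ^ x * Q ^ (-(2 * x / (40 : ℕ) : ℝ)) := by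
        rw [S.norm_root_pow_eq x s]
        refine mul_le_mul_of_nonneg_left (S.rpow_le ?_) (by positivity)
        push_cast
        linarith
      have e4 : ‖α‖ ^ s₂ ≤ ‖α‖ ^ x * Q ^ (-(2 * x / (40 : ℕ) : ℝ)) := by
        rw [S.norm_root_pow_eq x s₂]
        refine mul_le_mul_of_nonneg_left (S.rpow_le ?_) (by positivity)
        push_cast
        linarith
      have hq : 0 < Q ^ (-(2 * x / (40 : ℕ) : ℝ)) := Real.rpow_pos_of_pos hQ0 _
      rw [e0] at e1 ⊢
      calc |(α ^ t' - α ^ x).im| ≤ 4 * (‖α‖ ^ x * Q ^ (-(2 * x / (40 : ℕ) : ℝ))) := by linarith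
        _ ≤ 50 * (‖α ^ t' - α ^ x‖ * Q ^ (-(2 * x / (40 : ℕ) : ℝ))) := by
            gcongr
            norm_num
        _ = _ := by ring
  have h1 : ({t₂} : Set ℕ).encard ≤ (1 : ℕ) := by simp
  have h2 : (Prod.snd '' F).encard ≤ ((220 * 40 ^ 3 + 1) * (2 * 10 ^ 46) : ℕ) :=
    (Set.encard_image_le _ _).trans hFc
  refine (Set.encard_le_encard ?_).trans (encard_union_le_add h1 h2)
  rintro t ⟨p, hp, rfl⟩
  rcases (hmin p hp).eq_or_lt with h | h
  · left; exact h.symm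
  · right; exact ⟨(t₂, p.2), ⟨rfl, h, p, hp, rfl⟩, rfl⟩

theorem encard_le_of_close {c c' : ℤ} (hc0 : c ≠ 0) (hc : |c| ≤ 2) (hc0' : c' ≠ 0)
    (hc' : |c'| ≤ 2) {V : ℝ} {t₁ : ℕ} {P : Set (ℕ × ℕ)} (hP : ∀ p ∈ P, p.1 < p.2)
    (hV : ∀ p ∈ P, (c * α ^ p.1 + c' * α ^ p.2).im = V)
    (hR : ∀ p ∈ P, 10 ^ 44 ≤ p.2) (ht₁ : ∀ p ∈ P, t₁ ≤ p.2)
    (hnear : ∀ p ∈ P, l * ((p.2 : ℝ) - t₁) ≤ p.2 / 10 ^ 7)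
    (hclose : ∀ p ∈ P, l * ((p.2 : ℝ) - p.1) ≤ p.2 / 10) :
    P.encard ≤ (10 ^ 46 : ℕ) := by
  rcases P.eq_empty_or_nonempty with hemp | hnon
  · rw [hemp]; simp
  obtain ⟨⟨s₃, t₃⟩, hp₃, hmin⟩ := exists_min_image_nat P hnon Prod.snd
  simp only at hmin
  have hlt₃ := hP _ hp₃
  have hV₃ := hV _ hp₃
  have ht₃ := ht₁ _ hp₃
  have hclose₃ := hclose _ hp₃
  simp only at hlt₃ hV₃ ht₃ hclose₃
  have hQ0 := S.pos
  have hα0 := S.norm_root_pos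
  have hw := S.binomial_ne_zero' (c := c) hc0' hlt₃
  refine (Set.encard_le_encard ?_).trans
    (S.encard_binomial_real_le hc0 hc hc0' hc' ((map_ne_zero (starRingEnd ℂ)).mpr hw))
  rintro ⟨s, t⟩ hp
  have hlt := hP _ hp
  have hVp := hV _ hp
  have hRp := hR _ hp
  have hnearp := hnear _ hp
  have hclosep := hclose _ hp
  have htt := hmin _ hp
  simp only at hlt hVp hRp hnearp hclosep htt
  refine ⟨hlt, ?_⟩
  suffices h : (c : ℂ) * α ^ s + c' * α ^ t = c * α ^ s₃ + c' * α ^ t₃ by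
    simp only [h, Complex.mul_conj, Complex.ofReal_im]
  have hr : (10 : ℝ) ^ 44 ≤ t := by exact_mod_cast hRp
  have httr : (t₃ : ℝ) ≤ t := by exact_mod_cast htt
  have ht₃r : (t₁ : ℝ) ≤ t₃ := by exact_mod_cast ht₃
  have hh1 := S.half_sub_le hlt.le
  have hh2 := S.half_sub_le hlt₃.le
  have hh3 := S.half_sub_le htt
  have hl0 := S.half_le
  have hle : l * ((t : ℝ) - t₃) ≤ t / 10 ^ 7 := by
    refine le_trans ?_ hnearp
    gcongr
  obtain ⟨m, hms, hms₃, hm1, hm2⟩ : ∃ m : ℕ, m ≤ s ∧ m ≤ s₃ ∧ (t : ℝ) * 3 / 4 ≤ m ∧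
      l * ((t : ℝ) - m) ≤ t * 3 / 20 := by
    rcases le_total s s₃ with h | h
    · refine ⟨s, le_rfl, h, ?_, ?_⟩
      · linarith
      · linarith
    · refine ⟨s₃, h, le_rfl, ?_, ?_⟩
      · linarith
      · linarith
  set E : ℂ := (c * α ^ (s - m) + c' * α ^ (t - m)) - (c * α ^ (s₃ - m) + c' * α ^ (t₃ - m)) with hE
  have hmul : α ^ m * E = (c * α ^ s + c' * α ^ t) - (c * α ^ s₃ + c' * α ^ t₃) := by
    rw [show s = m + (s - m) by omega, show t = m + (t - m) by omega,
      show s₃ = m + (s₃ - m) by omega, show t₃ = m + (t₃ - m) by omega, hE]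
    simp only [pow_add]
    ring
  by_contra hne
  have hE0 : E ≠ 0 := by
    intro h
    rw [h, mul_zero] at hmul
    exact hne (sub_eq_zero.mp hmul.symm)
  have hmem : ∀ a b : ℕ, (c : ℂ) * α ^ a + c' * α ^ b ∈ O := fun a b =>
    O.add_mem (O.mul_mem (intCast_mem O c) (O.pow_mem S.root_mem _))
      (O.mul_mem (intCast_mem O c') (O.pow_mem S.root_mem _))
  have hEO : E ∈ O := O.sub_mem (hmem _ _) (hmem _ _)
  have h1 := S.norm_of_real m E hEO hE0 (by rw [hmul, Complex.sub_im, hVp, hV₃, sub_self])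
  have hbin : ∀ a b : ℕ, a ≤ t - m → b ≤ t - m →
      ‖(c : ℂ) * α ^ a + c' * α ^ b‖ ≤ 4 * ‖α‖ ^ (t - m) := by
    intro a b ha hb
    calc ‖(c : ℂ) * α ^ a + c' * α ^ b‖ ≤ ‖(c : ℂ)‖ * ‖α‖ ^ a + ‖(c' : ℂ)‖ * ‖α‖ ^ b := by
          rw [← _root_.norm_pow, ← _root_.norm_pow, ← norm_mul, ← norm_mul]
          exact norm_add_le _ _
      _ ≤ 2 * ‖α‖ ^ (t - m) + 2 * ‖α‖ ^ (t - m) :=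
          add_le_add (mul_le_mul (norm_intCast_le hc) (S.norm_root_pow_le ha) (by positivity)
            (by norm_num)) (mul_le_mul (norm_intCast_le hc') (S.norm_root_pow_le hb)
            (by positivity) (by norm_num))
      _ = _ := by ring
  have h2 : ‖E‖ ≤ Q ^ (3 + l * ((t : ℝ) - m)) := by
    calc ‖E‖ ≤ 4 * ‖α‖ ^ (t - m) + 4 * ‖α‖ ^ (t - m) :=
          (norm_sub_le _ _).trans (add_le_add (hbin _ _ (by omega) (by omega))
            (hbin _ _ (by omega) (by omega)))
      _ = 2 ^ 3 * Q ^ (l * ((t : ℝ) - m)) := by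
          rw [S.norm_root_pow, Nat.cast_sub (by omega)]; ring
      _ ≤ Q ^ (3 : ℝ) * Q ^ (l * ((t : ℝ) - m)) :=
          mul_le_mul_of_nonneg_right (S.le_rpow_of_nat 3 (by norm_num)) (Real.rpow_nonneg hQ0.le _)
      _ = _ := (Real.rpow_add hQ0 _ _).symm
  have h6 : Q ^ (m : ℝ) ≤ Q ^ ((3 + l * ((t : ℝ) - m)) * 2) := by
    rw [Real.rpow_natCast, Real.rpow_mul hQ0.le]
    refine h1.trans ?_
    rw [Real.rpow_ofNat]
    gcongr
  have h7 := S.le_of_rpow_le h6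
  linarith

set_option maxHeartbeats 400000 in
/-- Pairs of exponents for which a binomial has a given imaginary part. -/
theorem encard_binomial_im_eq_le {c c' : ℤ} (hc0 : c ≠ 0) (hc : |c| ≤ 2) (hc0' : c' ≠ 0)
    (hc' : |c'| ≤ 2) (V : ℝ) :
    {p : ℕ × ℕ | p.1 < p.2 ∧ (c * α ^ p.1 + c' * α ^ p.2).im = V}.encard ≤ (10 ^ 85 : ℕ) := by
  set T := {p : ℕ × ℕ | p.1 < p.2 ∧ (c * α ^ p.1 + c' * α ^ p.2).im = V} with hT
  rcases T.eq_empty_or_nonempty with hemp | hnon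
  · rw [hemp]; simp
  obtain ⟨⟨s₁, t₁⟩, ⟨hlt₁, hV₁⟩, hmin⟩ := exists_min_image_nat T hnon Prod.snd
  simp only at hlt₁ hV₁ hmin
  have hQ0 := S.pos
  have hα0 := S.norm_root_pos
  have hVle : |V| ≤ 4 * ‖α‖ ^ t₁ := by
    rw [← hV₁, Complex.add_im]
    have h1 := abs_im_intCast_mul_pow_le (α := α) hc s₁
    have h2 := abs_im_intCast_mul_pow_le (α := α) hc' t₁
    have h3 := S.norm_root_pow_le hlt₁.le
    exact (abs_add_le _ _).trans (by linarith)
  set Pf := {p | p ∈ T ∧ 10 ^ 44 ≤ p.2 ∧ l * ((p.2 : ℝ) - t₁) ≤ p.2 / 10 ^ 7 ∧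
    (p.2 : ℝ) / 10 ≤ l * ((p.2 : ℝ) - p.1)} with hPf
  set Pc := {p | p ∈ T ∧ 10 ^ 44 ≤ p.2 ∧ l * ((p.2 : ℝ) - t₁) ≤ p.2 / 10 ^ 7 ∧
    l * ((p.2 : ℝ) - p.1) ≤ p.2 / 10} with hPc
  set Pn := {p | p ∈ T ∧ NearReal α O Q 40000000 p.1 (c + c' * α ^ (p.2 - p.1))} with hPn
  set U := ({t : ℕ | t < 10 ^ 44} ∪ {t | NearReal α O Q 200000000000000000000 t 1}) ∪
    Prod.snd '' Pf with hU
  have hUc : U.encard ≤ (10 ^ 44 + (220 * 200000000000000000000 ^ 3 + 1) +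
      (1 + (220 * 40 ^ 3 + 1) * (2 * 10 ^ 46)) : ℕ) := by
    refine encard_union_le_add (encard_union_le_add (encard_lt_le _) ?_) ?_
    · have := S.encard_nearReal_exp 200000000000000000000 (by norm_num) 1
      exact_mod_cast this
    · exact S.encard_snd_le_of_far hc hc0' (fun p hp => hp.1.1) (fun p hp => hp.1.2)
        (fun p hp => hp.2.1) (fun p hp => hmin p hp.1) (fun p hp => hp.2.2.1)
        (fun p hp => hp.2.2.2)
  have hPcc : Pc.encard ≤ (10 ^ 46 : ℕ) :=
    S.encard_le_of_close hc0 hc hc0' hc' (fun p hp => hp.1.1) (fun p hp => hp.1.2)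
        (fun p hp => hp.2.1) (fun p hp => hmin p hp.1) (fun p hp => hp.2.2.1)
        (fun p hp => hp.2.2.2)
  have hPnc : Pn.encard ≤ ((220 * 40000000 ^ 3 + 1) * (2 * 10 ^ 46) : ℕ) :=
    S.encard_nearReal_binomial_le hc0 hc hc0' hc' (by norm_num) (fun p hp => hp.1.1)
      (fun p hp => hp.2)
  have hTU : {p | p ∈ T ∧ p.2 ∈ U}.encard ≤ ((10 ^ 44 + (220 * 200000000000000000000 ^ 3 + 1) +
      (1 + (220 * 40 ^ 3 + 1) * (2 * 10 ^ 46))) * 10 ^ 20 : ℕ) := by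
    refine encard_le_mul_of_fibers Prod.snd (fun p hp => hp.2) hUc ?_
    intro t _
    refine encard_le_of_injOn Prod.fst
      (S.encard_im_eq_le (ω := c) (by exact_mod_cast hc0) (V - (c' * α ^ t).im)) ?_ ?_
    · rintro ⟨s, t'⟩ ⟨⟨⟨_, him⟩, _⟩, rfl⟩
      simp only at him ⊢
      rw [Complex.add_im] at him
      rw [Set.mem_ofPred_eq]
      linarith
    · rintro ⟨s, t'⟩ ⟨_, h⟩ ⟨s', t''⟩ ⟨_, h'⟩ h2
      simp only at h h' h2
      rw [h, h', h2]
  have hsub : T ⊆ ({p | p ∈ T ∧ p.2 ∈ U} ∪ Pn) ∪ Pc := by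
    rintro ⟨s, t⟩ hp
    have hlt := hp.1
    have hV := hp.2
    have htt := hmin _ hp
    simp only at hlt hV htt
    by_cases hR : t < 10 ^ 44
    · left; left; exact ⟨hp, Or.inl (Or.inl hR)⟩
    push Not at hR
    have hr : (10 : ℝ) ^ 44 ≤ t := by exact_mod_cast hR
    rcases le_total (l * ((t : ℝ) - t₁)) (t / 10 ^ 7) with h1 | h1
    · rcases le_total ((t : ℝ) / 10) (l * ((t : ℝ) - s)) with h2 | h2
      · left; left; exact ⟨hp, Or.inr ⟨(s, t), ⟨hp, hR, h1, h2⟩, rfl⟩⟩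
      · right; exact ⟨hp, hR, h1, h2⟩
    left
    have hV' : |V| ≤ 4 * (‖α‖ ^ t * Q ^ (-(t / 10 ^ 7 : ℝ))) := by
      refine hVle.trans ?_
      rw [S.norm_root_pow_eq t t₁]
      refine mul_le_mul_of_nonneg_left (mul_le_mul_of_nonneg_left (S.rpow_le ?_) (by positivity))
        (by norm_num)
      linarith
    rcases le_total ((t : ℝ) / 10 ^ 20) (l * ((t : ℝ) - s)) with h2 | h2
    · left
      refine ⟨hp, Or.inl (Or.inr ⟨O.one_mem, one_ne_zero, by omega, ?_, ?_⟩)⟩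
      · rw [norm_one]; exact Real.one_le_rpow S.one_le (by positivity)
      · rw [mul_one, _root_.norm_pow]
        have e1 : |(α ^ t).im| ≤ |V| + 2 * ‖α‖ ^ s := by
          apply abs_im_le_of_abs_im_mul_le hc0'
          rw [Complex.add_im] at hV
          rw [show ((c' : ℂ) * α ^ t).im = V - (c * α ^ s).im by linarith]
          exact (abs_sub _ _).trans (add_le_add le_rfl (abs_im_intCast_mul_pow_le hc _))
        have e2 : ‖α‖ ^ s ≤ ‖α‖ ^ t * Q ^ (-(2 * t / (200000000000000000000 : ℕ) : ℝ)) := by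
          rw [S.norm_root_pow_eq t s]
          refine mul_le_mul_of_nonneg_left (S.rpow_le ?_) (by positivity)
          push_cast
          linarith
        have e3 : Q ^ (-(t / 10 ^ 7 : ℝ)) ≤ Q ^ (-(2 * t / (200000000000000000000 : ℕ) : ℝ)) := by
          apply S.rpow_le
          push_cast
          linarith
        have hA : 0 < ‖α‖ ^ t := pow_pos hα0 _
        have hq : 0 < Q ^ (-(2 * t / (200000000000000000000 : ℕ) : ℝ)) := Real.rpow_pos_of_pos hQ0 _
        have e4 := mul_le_mul_of_nonneg_left e3 hA.le
        have e5 := mul_pos hA hq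
        linarith
    · right
      refine ⟨hp, ?_⟩
      have hhalf := S.half_sub_le hlt.le
      have hst : (t : ℝ) * (9 / 10) ≤ s := by linarith
      have hst' : t ≤ 2 * s := by
        have : (t : ℝ) ≤ 2 * s := by linarith
        exact_mod_cast this
      have hstr : (s : ℝ) ≤ t := by exact_mod_cast hlt.le
      have hm := S.binomial_mem c c' (t - s)
      have h0 := S.binomial_ne_zero (c := c) hc0' (d := t - s) (by omega)
      simp only
      refine ⟨hm, h0, by omega, ?_, ?_⟩
      · apply S.norm_binomial_le_rpow hc hc'
        rw [Nat.cast_sub hlt.le]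
        push_cast
        linarith
      · have e1 := S.norm_pow_mul_ge (n := s) hm h0
        rw [← binomial_factor c c' α hlt.le] at e1 ⊢
        rw [hV]
        refine hV'.trans ?_
        rw [S.norm_root_pow_eq s t, mul_assoc, ← Real.rpow_add hQ0]
        have e3 : Q ^ (l * ((t : ℝ) - s) + -(t / 10 ^ 7 : ℝ)) ≤
            Q ^ (-(2 * s / (40000000 : ℕ) : ℝ)) := by
          apply S.rpow_le
          push_cast
          linarith
        have hq : 0 < Q ^ (-(2 * s / (40000000 : ℕ) : ℝ)) := Real.rpow_pos_of_pos hQ0 _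
        calc _ ≤ 4 * (‖(c : ℂ) * α ^ s + c' * α ^ t‖ * Q ^ (-(2 * s / (40000000 : ℕ) : ℝ))) := by
              gcongr
          _ ≤ 50 * (‖(c : ℂ) * α ^ s + c' * α ^ t‖ * Q ^ (-(2 * s / (40000000 : ℕ) : ℝ))) := by
              gcongr
              norm_num
          _ = _ := by ring
  refine (Set.encard_le_encard hsub).trans ((encard_union_le_add (encard_union_le_add hTU hPnc)
    hPcc).trans ?_)
  norm_num

end RootSetting

namespace RootSetting

variable {α η : ℂ} {O : Subring ℂ} {Q l : ℝ} (S : RootSetting α η O Q l)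

include S

/-- Triples of exponents for which a trinomial is real. -/
theorem encard_trinomial_real_le {a b c : ℤ} (ha0 : a ≠ 0) (ha : |a| ≤ 2) (hb0 : b ≠ 0)
    (hb : |b| ≤ 2) (hc0 : c ≠ 0) (hc : |c| ≤ 2)
    (hE : ∀ i j : ℕ, 0 < i → i < j → (a : ℂ) + b * α ^ i + c * α ^ j ≠ 0) :
    {p : ℕ × ℕ × ℕ | p.1 < p.2.1 ∧ p.2.1 < p.2.2 ∧
      (a * α ^ p.1 + b * α ^ p.2.1 + c * α ^ p.2.2).im = 0}.encard ≤ (10 ^ 110 : ℕ) := by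
  set T := {p : ℕ × ℕ × ℕ | p.1 < p.2.1 ∧ p.2.1 < p.2.2 ∧
      (a * α ^ p.1 + b * α ^ p.2.1 + c * α ^ p.2.2).im = 0} with hT
  have hQ0 := S.pos
  have hα0 := S.norm_root_pos
  set U : Set ℕ := {r | r < 10 ^ 17} ∪ {r | NearReal α O Q 2000000 r 1} with hU
  have hUc : U.encard ≤ (10 ^ 17 + (220 * 2000000 ^ 3 + 1) : ℕ) := by
    refine encard_union_le_add (encard_lt_le _) ?_
    have := S.encard_nearReal_exp 2000000 (by norm_num) 1
    exact_mod_cast this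
  set P : Set (ℕ × ℕ) := {q | q.1 < q.2 ∧ NearReal α O Q 16 q.1 (b + c * α ^ (q.2 - q.1))} with hP
  have hPc : P.encard ≤ ((220 * 16 ^ 3 + 1) * (2 * 10 ^ 46) : ℕ) :=
    S.encard_nearReal_binomial_le hb0 hb hc0 hc (by norm_num) (fun p hp => hp.1) (fun p hp => hp.2)
  have h1 : {p | p ∈ T ∧ p.2.2 ∈ U}.encard ≤
      ((10 ^ 17 + (220 * 2000000 ^ 3 + 1)) * 10 ^ 85 : ℕ) := by
    refine encard_le_mul_of_fibers (fun p => p.2.2) (fun p hp => hp.2) hUc ?_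
    intro r _
    refine encard_le_of_injOn (fun p => (p.1, p.2.1))
      (S.encard_binomial_im_eq_le ha0 ha hb0 hb (-(c * α ^ r).im)) ?_ ?_
    · rintro ⟨s, t, r'⟩ ⟨⟨⟨hst, htr, him⟩, _⟩, rfl⟩
      simp only at hst htr him ⊢
      rw [Complex.add_im] at him
      exact ⟨hst, by simp only; linarith⟩
    · rintro ⟨s, t, r'⟩ ⟨_, h⟩ ⟨s', t', r''⟩ ⟨_, h'⟩ h2
      simp only [Prod.mk.injEq] at h h' h2
      rw [h, h', h2.1, h2.2]
  have h2 : {p | p ∈ T ∧ p.2 ∈ P}.encard ≤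
      (((220 * 16 ^ 3 + 1) * (2 * 10 ^ 46)) * 10 ^ 20 : ℕ) := by
    refine encard_le_mul_of_fibers (fun p => p.2) (fun p hp => hp.2) hPc ?_
    intro q _
    refine encard_le_of_injOn (fun p => p.1)
      (S.encard_im_eq_le (ω := a) (by exact_mod_cast ha0) (-(b * α ^ q.1 + c * α ^ q.2).im)) ?_ ?_
    · rintro ⟨s, t, r⟩ ⟨⟨⟨_, _, him⟩, _⟩, rfl⟩
      simp only at him ⊢
      rw [add_assoc, Complex.add_im] at him
      rw [Set.mem_ofPred_eq]
      linarith
    · rintro ⟨s, q'⟩ ⟨_, h⟩ ⟨s', q''⟩ ⟨_, h'⟩ h2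
      simp only at h h' h2
      rw [h, h', h2]
  have hsub : T ⊆ {p | p ∈ T ∧ p.2.2 ∈ U} ∪ {p | p ∈ T ∧ p.2 ∈ P} := by
    rintro ⟨s, t, r⟩ hp
    have hst := hp.1
    have htr := hp.2.1
    have him := hp.2.2
    simp only at hst htr him
    by_cases hR : r < 10 ^ 17
    · left; exact ⟨hp, Or.inl hR⟩
    push Not at hR
    have hr : (10 : ℝ) ^ 17 ≤ r := by exact_mod_cast hR
    rcases le_total ((r : ℝ) / 10 ^ 6) (l * ((r : ℝ) - t)) with h | h
    · left
      refine ⟨hp, Or.inr ⟨O.one_mem, one_ne_zero, by simp only; omega, ?_, ?_⟩⟩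
      · rw [norm_one]; exact Real.one_le_rpow S.one_le (by positivity)
      · simp only
        rw [mul_one, _root_.norm_pow]
        have e1 : |(α ^ r).im| ≤ 2 * ‖α‖ ^ s + 2 * ‖α‖ ^ t := by
          apply abs_im_le_of_abs_im_mul_le hc0
          rw [Complex.add_im, Complex.add_im] at him
          rw [show ((c : ℂ) * α ^ r).im = -((a * α ^ s).im + (b * α ^ t).im) by linarith, abs_neg]
          exact (abs_add_le _ _).trans (add_le_add (abs_im_intCast_mul_pow_le ha _)
            (abs_im_intCast_mul_pow_le hb _))
        have e2 : ‖α‖ ^ t ≤ ‖α‖ ^ r * Q ^ (-(2 * r / (2000000 : ℕ) : ℝ)) := by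
          rw [S.norm_root_pow_eq r t]
          refine mul_le_mul_of_nonneg_left (S.rpow_le ?_) (by positivity)
          push_cast
          linarith
        have e3 := S.norm_root_pow_le hst.le
        have hA : 0 < ‖α‖ ^ r := pow_pos hα0 _
        have hq : 0 < Q ^ (-(2 * r / (2000000 : ℕ) : ℝ)) := Real.rpow_pos_of_pos hQ0 _
        have e5 := mul_pos hA hq
        linarith
    · right
      refine ⟨hp, htr, ?_⟩
      simp only
      have hm := S.binomial_mem b c (r - t)
      have h0 := S.binomial_ne_zero (c := b) hc0 (d := r - t) (by omega)
      have hhalf := S.half_sub_le htr.le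
      have hhalf' := S.half_sub_le (hst.trans htr).le
      have htrr : (t : ℝ) ≤ r := by exact_mod_cast htr.le
      have hstr : (s : ℝ) ≤ t := by exact_mod_cast hst.le
      have hrt : (r : ℝ) * (9 / 10) ≤ t := by linarith
      have hrt' : r ≤ 2 * t := by
        have : (r : ℝ) ≤ 2 * t := by linarith
        exact_mod_cast this
      refine ⟨hm, h0, by omega, ?_, ?_⟩
      · apply S.norm_binomial_le_rpow hb hc
        rw [Nat.cast_sub htr.le]
        push_cast
        linarith
      · set E : ℂ := a + b * α ^ (t - s) + c * α ^ (r - s) with hEdef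
        have hmul : a * α ^ s + b * α ^ t + c * α ^ r = α ^ s * E := by
          obtain ⟨i, rfl⟩ := Nat.exists_eq_add_of_le hst.le
          obtain ⟨j, rfl⟩ := Nat.exists_eq_add_of_le (hst.trans htr).le
          rw [hEdef]
          simp only [pow_add, Nat.add_sub_cancel_left]
          ring
        have hEO : E ∈ O := O.add_mem (S.binomial_mem a b _)
          (O.mul_mem (intCast_mem O c) (O.pow_mem S.root_mem _))
        have hE0 : E ≠ 0 := hE _ _ (by omega) (by omega)
        have f1 := S.norm_of_real s E hEO hE0 (by rw [← hmul, him])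
        have f2 : ‖E‖ ≤ Q ^ (3 + l * ((r : ℝ) - s)) := by
          calc ‖E‖ ≤ 4 * ‖α‖ ^ (t - s) + 2 * ‖α‖ ^ (r - s) := by
                refine (norm_add_le _ _).trans (add_le_add (S.norm_binomial_le ha hb _) ?_)
                rw [norm_mul, _root_.norm_pow]
                gcongr
                exact norm_intCast_le hc
            _ ≤ 8 * ‖α‖ ^ (r - s) := by
                have := S.norm_root_pow_le (show t - s ≤ r - s by omega)
                have : 0 < ‖α‖ ^ (r - s) := pow_pos hα0 _
                linarith
            _ = 2 ^ 3 * Q ^ (l * ((r : ℝ) - s)) := by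
                rw [S.norm_root_pow, Nat.cast_sub (by omega)]; norm_num
            _ ≤ Q ^ (3 : ℝ) * Q ^ (l * ((r : ℝ) - s)) :=
                mul_le_mul_of_nonneg_right (S.le_rpow_of_nat 3 (by norm_num))
                  (Real.rpow_nonneg hQ0.le _)
            _ = _ := (Real.rpow_add hQ0 _ _).symm
        have f6 : Q ^ (s : ℝ) ≤ Q ^ ((3 + l * ((r : ℝ) - s)) * 2) := by
          rw [Real.rpow_natCast, Real.rpow_mul hQ0.le]
          refine f1.trans ?_
          rw [Real.rpow_ofNat]
          gcongr
        have f7 := S.le_of_rpow_le f6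
        have e1 := S.norm_pow_mul_ge (n := t) hm h0
        rw [← binomial_factor b c α htr.le] at e1 ⊢
        have e2 : ‖α‖ ^ s ≤ ‖α‖ ^ t * Q ^ (-(2 * t / (16 : ℕ) : ℝ)) := by
          rw [S.norm_root_pow_eq t s]
          refine mul_le_mul_of_nonneg_left (S.rpow_le ?_) (by positivity)
          push_cast
          linarith
        have e3 : |((b : ℂ) * α ^ t + c * α ^ r).im| ≤ 2 * ‖α‖ ^ s := by
          rw [add_assoc, Complex.add_im] at him
          rw [show ((b : ℂ) * α ^ t + c * α ^ r).im = -(a * α ^ s).im by linarith, abs_neg]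
          exact abs_im_intCast_mul_pow_le ha _
        have hq : 0 < Q ^ (-(2 * t / (16 : ℕ) : ℝ)) := Real.rpow_pos_of_pos hQ0 _
        calc _ ≤ 2 * (‖α‖ ^ t * Q ^ (-(2 * t / (16 : ℕ) : ℝ))) := e3.trans (by linarith)
          _ ≤ 50 * (‖(b : ℂ) * α ^ t + c * α ^ r‖ * Q ^ (-(2 * t / (16 : ℕ) : ℝ))) := by
              gcongr
              norm_num
          _ = _ := by ring
  refine (Set.encard_le_encard hsub).trans ((encard_union_le_add h1 h2).trans ?_)
  norm_num

end RootSetting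

/-- The elements of `ℚ(α)` that are integral over `ℤ`, for `α` with rational integer trace `A`
and norm `q`. -/
def quadraticIntegers (A q : ℤ) (α : ℂ) (hα : α ^ 2 = A * α - q) : Subring ℂ where
  carrier := {z | IsIntegral ℤ z ∧ ∃ x y : ℚ, z = x + y * α}
  mul_mem' := by
    rintro a b ⟨ha, x, y, rfl⟩ ⟨hb, x', y', rfl⟩
    refine ⟨ha.mul hb, x * x' - q * y * y', x * y' + y * x' + A * y * y', ?_⟩
    push_cast
    linear_combination (y * y' : ℂ) * hα
  one_mem' := ⟨isIntegral_one, 1, 0, by simp⟩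
  add_mem' := by
    rintro a b ⟨ha, x, y, rfl⟩ ⟨hb, x', y', rfl⟩
    exact ⟨ha.add hb, x + x', y + y', by push_cast; ring⟩
  zero_mem' := ⟨isIntegral_zero, 0, 0, by simp⟩
  neg_mem' := by
    rintro a ⟨ha, x, y, rfl⟩
    exact ⟨ha.neg, -x, -y, by push_cast; ring⟩

theorem isIntegral_of_sq_eq {z : ℂ} (b c : ℤ) (h : z ^ 2 = b * z - c) : IsIntegral ℤ z := by
  refine ⟨Polynomial.X ^ 2 + (Polynomial.C (-b) * Polynomial.X + Polynomial.C c), ?_, ?_⟩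
  · apply Polynomial.monic_X_pow_add
    exact (Polynomial.degree_linear_le).trans_lt (by norm_num)
  · simp only [Polynomial.eval₂_add, Polynomial.eval₂_mul, Polynomial.eval₂_pow,
      Polynomial.eval₂_X, Polynomial.eval₂_C, h]
    simp only [algebraMap_int_eq, eq_intCast]
    push_cast
    ring

section

variable {A q : ℤ} {α : ℂ} (hs : α + starRingEnd ℂ α = A) (hp : α * starRingEnd ℂ α = q)

include hs hp

theorem sq_eq_of_trace_norm : α ^ 2 = A * α - q := by
  rw [← hs, ← hp]
  ring

theorem one_le_norm_of_mem_quadraticIntegers {z : ℂ} (hz : IsIntegral ℤ z) (hz0 : z ≠ 0)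
    (hxy : ∃ x y : ℚ, z = x + y * α) : 1 ≤ ‖z‖ := by
  obtain ⟨x, y, h⟩ := hxy
  have hc : IsIntegral ℤ (starRingEnd ℂ z) := hz.map (starRingEnd ℂ).toIntAlgHom
  have h1 : z * starRingEnd ℂ z = ((x ^ 2 + x * y * A + y ^ 2 * q : ℚ) : ℂ) := by
    rw [h]
    push_cast
    simp only [map_add, map_mul, map_ratCast]
    linear_combination (x * y : ℂ) * hs + (y ^ 2 : ℂ) * hp
  have h2 : IsIntegral ℤ ((x ^ 2 + x * y * A + y ^ 2 * q : ℚ) : ℂ) := h1 ▸ hz.mul hc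
  have h3 : IsIntegral ℤ (x ^ 2 + x * y * A + y ^ 2 * q : ℚ) :=
    (isIntegral_algebraMap_iff (algebraMap ℚ ℂ).injective).mp h2
  obtain ⟨m, hm⟩ := IsIntegrallyClosed.isIntegral_iff.mp h3
  have h4 : Complex.normSq z = m := by
    have : (Complex.normSq z : ℂ) = (m : ℂ) := by
      rw [← Complex.mul_conj, h1, ← hm]
      simp
    exact_mod_cast this
  have h5 : (0 : ℝ) < m := by rw [← h4]; exact Complex.normSq_pos.mpr hz0
  have h6 : (1 : ℝ) ≤ m := by
    have : 0 < m := by exact_mod_cast h5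
    exact_mod_cast this
  rw [← h4, Complex.normSq_eq_norm_sq] at h6
  exact (one_le_sq_iff₀ (norm_nonneg z)).mp h6

theorem trace_sq_lt (him : α.im ≠ 0) : A ^ 2 < 4 * q := by
  have h1 : ((A ^ 2 - 4 * q : ℤ) : ℂ) = ((-4 * α.im ^ 2 : ℝ) : ℂ) := by
    have h2 := Complex.sub_conj α
    push_cast
    rw [← hs, ← hp]
    calc _ = (α - starRingEnd ℂ α) ^ 2 := by ring
      _ = _ := by
        rw [h2]
        push_cast
        rw [mul_pow, Complex.I_sq]
        ring
  have h3 : ((A ^ 2 - 4 * q : ℤ) : ℝ) = -4 * α.im ^ 2 := by exact_mod_cast h1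
  have h4 : ((A ^ 2 - 4 * q : ℤ) : ℝ) < 0 := by
    rw [h3]
    have : 0 < α.im ^ 2 := by positivity
    linarith
  have h5 : A ^ 2 - 4 * q < 0 := by exact_mod_cast h4
  linarith

theorem not_dvd_trace_sq (hA : A ≠ 0) (hnr : ∀ n : ℕ, 0 < n → (α ^ n).im ≠ 0) : ¬ q ∣ A ^ 2 := by
  rintro ⟨k, hk⟩
  have him : α.im ≠ 0 := by simpa using hnr 1 one_pos
  have h1 := trace_sq_lt hs hp him
  have hA2 : 0 < A ^ 2 := by positivity
  have hq : 0 < q := by linarith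
  have hk1 : 0 < k := by
    by_contra h
    nlinarith
  have hk2 : k < 4 := by
    by_contra h
    nlinarith
  have hα := sq_eq_of_trace_norm hs hp
  have hkC : (A : ℂ) ^ 2 = q * k := by exact_mod_cast hk
  have key : ∀ n : ℕ, 0 < n → ∀ m : ℤ, α ^ n ≠ m := by
    intro n hn m h
    apply hnr n hn
    rw [h, Complex.intCast_im]
  interval_cases k
  · apply key 3 (by norm_num) (-A * q)
    push_cast at hkC ⊢
    linear_combination (α + A) * hα + α * hkC
  · apply key 4 (by norm_num) (-A ^ 2 * q + q ^ 2)
    push_cast at hkC ⊢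
    linear_combination (α ^ 2 + A * α - q + A ^ 2) * hα + (A * α) * hkC
  · apply key 6 (by norm_num) (q ^ 2 * (A ^ 2 - 4 * q))
    have h3 : α ^ 3 = q * (2 * α - A) := by
      push_cast at hkC
      linear_combination (α + A) * hα + α * hkC
    calc α ^ 6 = (α ^ 3) ^ 2 := by ring
      _ = _ := by
        rw [h3]
        push_cast
        linear_combination (4 * q ^ 2 : ℂ) * hα

theorem exists_rootSetting (hA : A ≠ 0) (hnr : ∀ n : ℕ, 0 < n → (α ^ n).im ≠ 0) :
    ∃ η O Q l, RootSetting α η O Q l := by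
  have him : α.im ≠ 0 := by simpa using hnr 1 one_pos
  have hα := sq_eq_of_trace_norm hs hp
  have hlt := trace_sq_lt hs hp him
  have hA2 : 0 < A ^ 2 := by positivity
  have hq0 : 0 < q := by linarith
  obtain ⟨g, a, Q, hcop, hga, hgQ⟩ : ∃ g a Q : ℤ, IsCoprime a Q ∧ A ^ 2 = g * a ∧ q = g * Q := by
    have hne : 0 < Int.gcd (A ^ 2) q := Int.gcd_pos_of_ne_zero_left _ hA2.ne'
    obtain ⟨a, Q, h1, h2, h3⟩ := Int.exists_gcd_one hne
    exact ⟨_, a, Q, Int.isCoprime_iff_gcd_eq_one.mpr h1, by rw [mul_comm]; exact h2,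
      by rw [mul_comm]; exact h3⟩
  have hg0 : g ≠ 0 := by rintro rfl; simp at hgQ; omega
  wlog hg : 0 < g generalizing g a Q
  · exact this (-g) (-a) (-Q) hcop.neg_neg (by rw [hga]; ring) (by rw [hgQ]; ring)
      (neg_ne_zero.mpr hg0) (by omega)
  have hQ0 : 0 < Q := by rw [hgQ] at hq0; exact pos_of_mul_pos_right hq0 hg.le
  have hQ2 : 2 ≤ Q := by
    by_contra h
    have hQ1 : Q = 1 := by omega
    apply not_dvd_trace_sq hs hp hA hnr
    rw [hgQ, hQ1, mul_one, hga]
    exact dvd_mul_right g a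
  have hgC : (g : ℂ) ≠ 0 := by exact_mod_cast hg0
  have hgR : (0 : ℝ) < g := by exact_mod_cast hg
  set η : ℂ := α ^ 2 / g with hη
  have hαη : α ^ 2 = g * η := by rw [hη]; field_simp
  have hηc : starRingEnd ℂ η = (starRingEnd ℂ α) ^ 2 / g := by simp [hη]
  have hgaC : (A : ℂ) ^ 2 = g * a := by exact_mod_cast hga
  have hgQC : (q : ℂ) = g * Q := by exact_mod_cast hgQ
  have hsum : η + starRingEnd ℂ η = ((a - 2 * Q : ℤ) : ℂ) := by
    rw [hηc, hη, ← add_div, div_eq_iff hgC]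
    push_cast
    linear_combination (α + starRingEnd ℂ α + A) * hs - 2 * hp + hgaC - 2 * hgQC
  have hprod : η * starRingEnd ℂ η = ((Q ^ 2 : ℤ) : ℂ) := by
    rw [hηc, hη, div_mul_div_comm, ← mul_pow, hp, hgQC]
    push_cast
    field_simp
  set O := quadraticIntegers A q α hα with hO
  have hconj : ∀ z ∈ O, starRingEnd ℂ z ∈ O := by
    rintro z ⟨hz, x, y, rfl⟩
    refine ⟨hz.map (starRingEnd ℂ).toIntAlgHom, x + y * A, -y, ?_⟩
    simp only [map_add, map_mul, map_ratCast]
    push_cast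
    linear_combination (y : ℂ) * hs
  have hone : ∀ z ∈ O, z ≠ 0 → 1 ≤ ‖z‖ := fun z hz hz0 =>
    one_le_norm_of_mem_quadraticIntegers hs hp hz.1 hz0 hz.2
  have hηO : η ∈ O := by
    refine ⟨isIntegral_of_sq_eq (a - 2 * Q) (Q ^ 2) ?_, -q / g, A / g, ?_⟩
    · rw [← hsum, ← hprod]; ring
    · rw [hη, hα]; push_cast; ring
  have hnα : ‖α‖ ^ 2 = q := by
    have : ((‖α‖ ^ 2 : ℝ) : ℂ) = (q : ℂ) := by
      rw [← hp, Complex.mul_conj, Complex.normSq_eq_norm_sq]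
    exact_mod_cast this
  have hgQR : (q : ℝ) = g * Q := by exact_mod_cast hgQ
  have hnη : ‖η‖ = Q := by
    rw [hη, norm_div, norm_pow, hnα, Complex.norm_intCast, abs_of_pos hgR, hgQR]
    field_simp
  have hQ2R : (2 : ℝ) ≤ Q := by exact_mod_cast hQ2
  have hQ1R : (1 : ℝ) < Q := by linarith
  have hα0 : 0 < ‖α‖ := norm_pos_iff.mpr fun h => by simp [h] at him
  refine ⟨η, O, Q, Real.logb Q ‖α‖, hconj, hone, ⟨isIntegral_of_sq_eq A q hα, 0, 1, by simp⟩, hηO,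
    hnη, hQ2R, ?_, ?_, ⟨g, hgR.ne', by rw [hαη]; simp⟩, hnr, ?_⟩
  · rw [Real.le_logb_iff_rpow_le hQ1R hα0, ← Real.sqrt_eq_rpow]
    apply Real.sqrt_le_iff.mpr
    refine ⟨hα0.le, ?_⟩
    rw [hnα, hgQR]
    have : (1 : ℝ) ≤ g := by exact_mod_cast hg
    nlinarith
  · intro n
    rw [Real.rpow_mul_natCast (by linarith), Real.rpow_logb (by linarith) hQ1R.ne' hα0]
  · intro k z hz hz0 hreal
    have hcop' : IsCoprime (a - 2 * Q) (Q ^ 2) := by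
      apply IsCoprime.pow_right
      have := hcop.add_mul_left_left (-2)
      rwa [show a + Q * -2 = a - 2 * Q by ring] at this
    obtain ⟨x, y, hxy⟩ := hcop'
    set e : O := ⟨η, hηO⟩ with he
    set e' : O := ⟨starRingEnd ℂ η, hconj η hηO⟩ with he'
    set z₁ : O := ⟨z, hz⟩ with hz₁
    set z₂ : O := ⟨starRingEnd ℂ z, hconj z hz⟩ with hz₂
    have hee : IsCoprime e e' := by
      refine ⟨x + y * e', x, ?_⟩
      apply Subtype.ext
      push_cast
      have : (x : ℂ) * ((a - 2 * Q : ℤ) : ℂ) + y * ((Q ^ 2 : ℤ) : ℂ) = 1 := by exact_mod_cast hxy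
      rw [← hsum, ← hprod] at this
      simp only [he, he']
      linear_combination this
    have heq : e ^ k * z₁ ^ 2 = e' ^ k * z₂ ^ 2 := by
      apply Subtype.ext
      push_cast
      simp only [he, he', hz₁, hz₂]
      have h1 := Complex.conj_eq_iff_im.mpr hreal
      rw [map_mul, map_pow] at h1
      have h2 : (starRingEnd ℂ α) ^ 2 = g * starRingEnd ℂ η := by rw [hηc]; field_simp
      have h3 : (g : ℂ) ^ k * (η ^ k * z ^ 2) = g ^ k * (starRingEnd ℂ η ^ k * starRingEnd ℂ z ^ 2) := by
        calc _ = (g * η) ^ k * z ^ 2 := by rw [mul_pow]; ring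
          _ = (α ^ k * z) ^ 2 := by rw [← hαη]; ring
          _ = ((starRingEnd ℂ α) ^ k * starRingEnd ℂ z) ^ 2 := by rw [h1]
          _ = (g * starRingEnd ℂ η) ^ k * starRingEnd ℂ z ^ 2 := by rw [← h2]; ring
          _ = _ := by rw [mul_pow]; ring
      exact mul_left_cancel₀ (pow_ne_zero k hgC) h3
    have hdvd : e' ^ k ∣ z₁ ^ 2 := by
      refine (hee.symm.pow (m := k) (n := k)).dvd_of_dvd_mul_left ?_
      rw [heq]
      exact dvd_mul_right _ _
    obtain ⟨u, hu⟩ := hdvd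
    have hu' : z ^ 2 = starRingEnd ℂ η ^ k * u := by
      have := congrArg (Subtype.val) hu
      push_cast at this
      exact this
    have hu0 : (u : ℂ) ≠ 0 := by
      intro h
      rw [h, mul_zero] at hu'
      exact hz0 (pow_eq_zero_iff (by norm_num) |>.mp hu')
    have h5 := hone u u.2 hu0
    rw [← norm_pow, hu', norm_mul, norm_pow, Complex.norm_conj, hnη]
    exact le_mul_of_one_le_right (by positivity) h5

end

theorem lucasU_mul_im {A q : ℤ} {α : ℂ} (hα : α ^ 2 = A * α - q) (n : ℕ) :
    (lucasU A (-q) n : ℝ) * α.im = (α ^ n).im := by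
  induction n using Nat.twoStepInduction with
  | zero => simp [lucasU]
  | one => simp [lucasU]
  | more n ih1 ih2 =>
    have h : α ^ (n + 2) = (A : ℝ) * α ^ (n + 1) - (q : ℝ) * α ^ n := by
      rw [pow_add, hα, pow_succ]
      push_cast
      ring
    rw [h, Complex.sub_im, Complex.im_ofReal_mul, Complex.im_ofReal_mul, ← ih1, ← ih2, lucasU]
    push_cast
    ring

section

theorem normSq_of_norm {q : ℤ} {α : ℂ} (hp : α * starRingEnd ℂ α = q) : Complex.normSq α = q := by
  have : (Complex.normSq α : ℂ) = (q : ℂ) := by rw [← Complex.mul_conj, hp]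
  exact_mod_cast this

variable {A q : ℤ} {α : ℂ} (hs : α + starRingEnd ℂ α = A) (hp : α * starRingEnd ℂ α = q)

include hs hp

theorem pow_mul_one_add_pow_ne_two (hA : A ≠ 0) (hnr : ∀ n : ℕ, 0 < n → (α ^ n).im ≠ 0)
    (hq : 2 ≤ q) (hAq : ¬ (A = -1 ∧ q = 2)) {η : ℂ} {O : Subring ℂ} {Q l : ℝ}
    (S : RootSetting α η O Q l) {i d : ℕ} (hi : 0 < i) (hd : 0 < d) :
    α ^ i * (1 + α ^ d) ≠ 2 := by
  intro h
  have him : α.im ≠ 0 := by simpa using hnr 1 one_pos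
  have hn := normSq_of_norm hp
  have hw0 : (1 : ℂ) + α ^ d ≠ 0 := by
    intro h0
    rw [h0, mul_zero] at h
    norm_num at h
  have hw := S.one_le_norm _ (O.add_mem O.one_mem (O.pow_mem S.root_mem d)) hw0
  have hw2 : 1 ≤ Complex.normSq (1 + α ^ d) := by
    rw [Complex.normSq_eq_norm_sq]; exact one_le_pow₀ hw
  have h1 : (q : ℝ) ^ i * Complex.normSq (1 + α ^ d) = 4 := by
    rw [← hn, ← map_pow, ← map_mul, h]
    norm_num [Complex.normSq_apply]
  have hq2 : (2 : ℝ) ≤ q := by exact_mod_cast hq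
  have hqC : (q : ℂ) ≠ 0 := by exact_mod_cast (by omega : q ≠ 0)
  have h2 : (q : ℝ) ^ i ≤ 4 := by
    have : 0 ≤ (q : ℝ) ^ i := by positivity
    nlinarith
  have hi2 : i ≤ 2 := by
    by_contra h3
    have h4 : (2 : ℝ) ^ 3 ≤ q ^ i := by
      calc (2 : ℝ) ^ 3 ≤ (q : ℝ) ^ 3 := by gcongr
        _ ≤ _ := pow_le_pow_right₀ (by linarith) (by omega)
    linarith
  have h5 : (starRingEnd ℂ α) ^ i * 2 = q ^ i * (1 + α ^ d) := by
    rw [← h, ← mul_assoc, ← mul_pow, mul_comm _ α, hp]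
  have hcA : starRingEnd ℂ α = A - α := by rw [← hs]; ring
  have hα := sq_eq_of_trace_norm hs hp
  have hlt := trace_sq_lt hs hp him
  have hnd : Complex.normSq (α ^ d) = (q : ℝ) ^ d := by rw [map_pow, hn]
  rcases (by omega : i = 1 ∨ i = 2) with rfl | rfl
  · have h6 : (q : ℂ) * α ^ d = 2 * starRingEnd ℂ α - q := by linear_combination -h5
    rcases hq.eq_or_lt with hq' | hq'
    · subst hq'
      have h7 : α ^ d = starRingEnd ℂ α - 1 := by
        have h8 : (2 : ℂ) * α ^ d = 2 * (starRingEnd ℂ α - 1) := by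
          push_cast at h6
          linear_combination h6
        exact mul_left_cancel₀ two_ne_zero h8
      have h8 : ((2 : ℤ) : ℝ) ^ d = 3 - A := by
        have h9 : (Complex.normSq (starRingEnd ℂ α - 1) : ℂ) = ((3 - A : ℝ) : ℂ) := by
          rw [← Complex.mul_conj, map_sub, Complex.conj_conj, map_one]
          push_cast
          push_cast at hp
          linear_combination hp - hs
        rw [← hnd, h7]
        exact_mod_cast h9
      have h9 : (2 : ℤ) ^ d = 3 - A := by exact_mod_cast h8
      have hA1 : -2 ≤ A := by nlinarith
      have hA2 : A ≤ 2 := by nlinarith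
      obtain ⟨e, rfl⟩ : ∃ e, d = e + 1 := ⟨d - 1, by omega⟩
      rw [pow_succ] at h9
      have hA3 : A = 1 ∨ A = -1 := by omega
      rcases hA3 with rfl | rfl
      · have : e = 0 := by
          by_contra h10
          have : (2 : ℤ) ^ 1 ≤ 2 ^ e := pow_le_pow_right₀ (by norm_num) (by omega)
          omega
        subst this
        have := congrArg Complex.im h7
        simp at this
        apply him
        linarith
      · exact hAq ⟨rfl, rfl⟩
    · have hq3 : (3 : ℝ) ≤ q := by exact_mod_cast hq'
      have hd1 : d = 1 := by
        by_contra hd1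
        have h7 : (q : ℝ) * q ≤ ‖(q : ℂ) * α ^ d‖ := by
          rw [norm_mul, Complex.norm_intCast, abs_of_pos (by linarith)]
          gcongr
          have h8 : (q : ℝ) ^ 2 ≤ ‖α ^ d‖ ^ 2 := by
            rw [← Complex.normSq_eq_norm_sq, hnd]
            exact pow_le_pow_right₀ (by linarith) (by omega)
          exact (pow_le_pow_iff_left₀ (by linarith) (norm_nonneg _) two_ne_zero).mp h8
        have h8 : ‖α‖ ≤ q := by
          have : ‖α‖ ^ 2 ≤ q ^ 2 := by
            rw [← Complex.normSq_eq_norm_sq, hn]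
            nlinarith
          exact (pow_le_pow_iff_left₀ (norm_nonneg _) (by linarith) two_ne_zero).mp this
        have h9 : ‖(q : ℂ) * α ^ d‖ ≤ 2 * ‖α‖ + q := by
          rw [h6]
          refine (norm_sub_le _ _).trans ?_
          rw [norm_mul, Complex.norm_conj, Complex.norm_intCast, abs_of_pos (by linarith)]
          norm_num
        have h10 : ‖α‖ ^ 2 = q := by rw [← Complex.normSq_eq_norm_sq, hn]
        nlinarith [norm_nonneg α]
      subst hd1
      have h7 := congrArg Complex.im h6
      simp at h7
      have : ((q : ℝ) + 2) * α.im = 0 := by linarith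
      rcases mul_eq_zero.mp this with h8 | h8
      · linarith
      · exact him h8
  · have hq' : q = 2 := by
      have : (q : ℝ) < 3 := by nlinarith
      have : q < 3 := by exact_mod_cast this
      omega
    subst hq'
    have h6 : (2 : ℂ) * α ^ d = (starRingEnd ℂ α) ^ 2 - 2 := by
      push_cast at h5
      linear_combination (-1 / 2 : ℂ) * h5
    have h7 : ‖α‖ ^ 2 = 2 := by rw [← Complex.normSq_eq_norm_sq, hn]; norm_num
    have hd2 : d ≤ 2 := by
      by_contra hd2
      have h8 : ‖(2 : ℂ) * α ^ d‖ ≤ 4 := by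
        rw [h6]
        refine (norm_sub_le _ _).trans ?_
        rw [norm_pow, Complex.norm_conj, h7]
        norm_num
      rw [norm_mul] at h8
      have h9 : ‖α ^ d‖ ≤ 2 := by
        norm_num at h8 ⊢
        linarith
      have h10 : ‖α ^ d‖ ^ 2 = 2 ^ d := by rw [← Complex.normSq_eq_norm_sq, hnd]; norm_num
      have h11 : (2 : ℝ) ^ 3 ≤ 2 ^ d := pow_le_pow_right₀ (by norm_num) (by omega)
      nlinarith [norm_nonneg (α ^ d)]
    rcases (by omega : d = 1 ∨ d = 2) with rfl | rfl
    · have h8 : (2 : ℂ) * α = A * starRingEnd ℂ α - 4 := by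
        have h9 : (starRingEnd ℂ α) ^ 2 = A * starRingEnd ℂ α - 2 := by
          have := congrArg (starRingEnd ℂ) hα
          rw [map_pow, map_sub, map_mul, map_intCast, map_intCast] at this
          push_cast at this
          exact this
        rw [h9] at h6
        linear_combination h6
      have h9 := congrArg Complex.im h8
      simp at h9
      have h10 : ((A : ℝ) + 2) * α.im = 0 := by linarith
      rcases mul_eq_zero.mp h10 with h11 | h11
      · have hA2 : A = -2 := by
          have : A + 2 = 0 := by exact_mod_cast h11
          omega
        subst hA2
        apply hnr 4 (by norm_num)
        have : α ^ 4 = ((-4 : ℝ) : ℂ) := by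
          push_cast at hα ⊢
          linear_combination (α ^ 2 - 2 * α + 2) * hα
        rw [this, Complex.ofReal_im]
      · exact him h11
    · have h9 := congrArg Complex.im h6
      rw [← map_pow, Complex.sub_im, Complex.conj_im, show (2 : ℂ) = ((2 : ℝ) : ℂ) by norm_num,
        Complex.im_ofReal_mul, Complex.ofReal_im] at h9
      exact hnr 2 (by norm_num) (by linarith)

theorem encard_progressions_of_im_ne_zero (hA : A ≠ 0)
    (hnr : ∀ n : ℕ, 0 < n → (α ^ n).im ≠ 0) (hAq : ¬ (A = -1 ∧ q = 2)) :
    {p : ℕ × ℕ × ℕ | lucasU A (-q) p.1 < lucasU A (-q) p.2.1 ∧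
        lucasU A (-q) p.2.1 < lucasU A (-q) p.2.2 ∧
        lucasU A (-q) p.1 + lucasU A (-q) p.2.2 = 2 * lucasU A (-q) p.2.1}.encard
      ≤ (10 ^ 111 : ℕ) := by
  obtain ⟨η, O, Q, l, S⟩ := exists_rootSetting hs hp hA hnr
  have him : α.im ≠ 0 := by simpa using hnr 1 one_pos
  have hα := sq_eq_of_trace_norm hs hp
  have hlt := trace_sq_lt hs hp him
  have hA2 : 0 < A ^ 2 := by positivity
  have hq2 : 2 ≤ q := by
    by_contra h
    have hq1 : q = 1 := by omega
    exact not_dvd_trace_sq hs hp hA hnr (hq1 ▸ one_dvd _)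
  have hα1 := S.one_lt_norm_root
  have hunit : ∀ w ∈ O, ∀ m : ℤ, |m| = 1 → α * w ≠ m := by
    intro w hw m hm h
    have h1 : ‖α‖ * ‖w‖ = 1 := by
      rw [← norm_mul, h, Complex.norm_intCast]
      exact_mod_cast hm
    have hw0 : w ≠ 0 := by
      rintro rfl
      simp at h1
    nlinarith [S.one_le_norm w hw hw0]
  have hE1 : ∀ b c : ℤ, ∀ i j : ℕ, 0 < i → i < j → ((1 : ℤ) : ℂ) + b * α ^ i + c * α ^ j ≠ 0 := by
    intro b c i j hi hij h
    refine hunit (b * α ^ (i - 1) + c * α ^ (j - 1)) ?_ (-1) (by norm_num) ?_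
    · exact O.add_mem (O.mul_mem (intCast_mem O b) (O.pow_mem S.root_mem _))
        (O.mul_mem (intCast_mem O c) (O.pow_mem S.root_mem _))
    · obtain ⟨i, rfl⟩ : ∃ k, i = k + 1 := ⟨i - 1, by omega⟩
      obtain ⟨j, rfl⟩ : ∃ k, j = k + 1 := ⟨j - 1, by omega⟩
      simp only [Nat.add_sub_cancel]
      push_cast at h ⊢
      linear_combination h
  have hE2 : ∀ i j : ℕ, 0 < i → i < j →
      ((-2 : ℤ) : ℂ) + (1 : ℤ) * α ^ i + (1 : ℤ) * α ^ j ≠ 0 := by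
    intro i j hi hij h
    apply pow_mul_one_add_pow_ne_two hs hp hA hnr hq2 hAq S hi (d := j - i) (by omega)
    obtain ⟨d, rfl⟩ := Nat.exists_eq_add_of_le hij.le
    rw [Nat.add_sub_cancel_left]
    rw [pow_add] at h
    push_cast at h
    linear_combination h
  have hT1 := S.encard_trinomial_real_le (a := 1) (b := 1) (c := -2) (by norm_num) (by norm_num)
    (by norm_num) (by norm_num) (by norm_num) (by norm_num) (hE1 _ _)
  have hT2 := S.encard_trinomial_real_le (a := 1) (b := -2) (c := 1) (by norm_num) (by norm_num)
    (by norm_num) (by norm_num) (by norm_num) (by norm_num) (hE1 _ _)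
  have hT3 := S.encard_trinomial_real_le (a := -2) (b := 1) (c := 1) (by norm_num) (by norm_num)
    (by norm_num) (by norm_num) (by norm_num) (by norm_num) hE2
  have hpull : ∀ (T : Set (ℕ × ℕ × ℕ)), T.encard ≤ (10 ^ 110 : ℕ) →
      ∀ f : ℕ × ℕ × ℕ → ℕ × ℕ × ℕ, Function.Injective f → (f ⁻¹' T).encard ≤ (10 ^ 110 : ℕ) :=
    fun T hT f hf => encard_le_of_injOn f hT (fun x hx => hx) hf.injOn
  have hunion := encard_union_le_add (encard_union_le_add
    (encard_union_le_add (hpull _ hT2 (fun p => (p.1, p.2.1, p.2.2)) (fun p q h => h))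
      (hpull _ hT2 (fun p => (p.2.2, p.2.1, p.1)) (by
        rintro ⟨a, b, c⟩ ⟨a', b', c'⟩ h; simp_all)))
    (encard_union_le_add (hpull _ hT1 (fun p => (p.1, p.2.2, p.2.1)) (by
        rintro ⟨a, b, c⟩ ⟨a', b', c'⟩ h; simp_all))
      (hpull _ hT1 (fun p => (p.2.2, p.1, p.2.1)) (by
        rintro ⟨a, b, c⟩ ⟨a', b', c'⟩ h; simp_all))))
    (encard_union_le_add (hpull _ hT3 (fun p => (p.2.1, p.1, p.2.2)) (by
        rintro ⟨a, b, c⟩ ⟨a', b', c'⟩ h; simp_all))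
      (hpull _ hT3 (fun p => (p.2.1, p.2.2, p.1)) (by
        rintro ⟨a, b, c⟩ ⟨a', b', c'⟩ h; simp_all)))
  refine (Set.encard_le_encard ?_).trans (hunion.trans (by norm_num))
  rintro ⟨k, l', m⟩ ⟨h1, h2, h3⟩
  simp only at h1 h2 h3
  have hkl : k ≠ l' := by rintro rfl; exact lt_irrefl _ h1
  have hlm : l' ≠ m := by rintro rfl; exact lt_irrefl _ h2
  have hkm : k ≠ m := by rintro rfl; exact lt_irrefl _ (h1.trans h2)
  have hsum : (α ^ k).im + (α ^ m).im = 2 * (α ^ l').im := by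
    rw [← lucasU_mul_im hα, ← lucasU_mul_im hα, ← lucasU_mul_im hα, ← add_mul, ← mul_assoc]
    congr 1
    exact_mod_cast h3
  have e2 : ((2 : ℂ) * α ^ l').im = 2 * (α ^ l').im := by
    rw [show (2 : ℂ) = ((2 : ℝ) : ℂ) by norm_num, Complex.im_ofReal_mul]
  have hgoal : ∀ z : ℂ, z = α ^ k + α ^ m - 2 * α ^ l' → z.im = 0 := by
    rintro z rfl
    rw [Complex.sub_im, Complex.add_im, e2]
    linarith
  rcases lt_or_gt_of_ne hkl with a1 | a1 <;> rcases lt_or_gt_of_ne hlm with a2 | a2 <;>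
    rcases lt_or_gt_of_ne hkm with a3 | a3
  · left; left; left
    exact ⟨a1, a2, hgoal _ (by push_cast; ring)⟩
  · omega
  · left; right; left
    exact ⟨a3, a2, hgoal _ (by push_cast; ring)⟩
  · left; right; right
    exact ⟨a3, a1, hgoal _ (by push_cast; ring)⟩
  · right; left
    exact ⟨a1, a3, hgoal _ (by push_cast; ring)⟩
  · right; right
    exact ⟨a2, a3, hgoal _ (by push_cast; ring)⟩
  · omega
  · left; left; right
    exact ⟨a2, a1, hgoal _ (by push_cast; ring)⟩

end

theorem lucasU_neg_left (A B : ℤ) (n : ℕ) :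
    lucasU (-A) B n = (-1) ^ (n + 1) * lucasU A B n := by
  induction n using Nat.twoStepInduction with
  | zero => simp [lucasU]
  | one => simp [lucasU]
  | more n ih1 ih2 =>
    rw [lucasU, lucasU, ih1, ih2]
    ring

/-- The growth of `|u_n|` which rules out all progressions with an index at least `10`. -/
structure RapidGrowth (U : ℕ → ℤ) : Prop where
  nonneg : ∀ n, 0 ≤ U n
  lt : ∀ t r, t < r → 3 ≤ r → U t < U r
  le : ∀ s t, s < t → U s ≤ U t
  add_ne : ∀ s t r, s < t → t < r → 10 ≤ r → U r + U s ≠ 2 * U t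
  lt_of_add_two_le : ∀ s t r, s < t → t + 2 ≤ r → 2 * U t + U s < U r
  ne_add : ∀ s t r, s < t → t < r → 10 ≤ r → U r ≠ U t + 2 * U s

theorem RapidGrowth.sign_ne {U V : ℕ → ℤ} (h : RapidGrowth U)
    (hV : (∀ n, V n = U n) ∨ ∀ n, V n = (-1) ^ (n + 1) * U n)
    {s t r : ℕ} (hst : s < t) (htr : t < r) (hr : 10 ≤ r) :
    V r + V s ≠ 2 * V t ∧ V r + V t ≠ 2 * V s ∧ V s + V t ≠ 2 * V r := by
  have h1 := h.nonneg s
  have h2 := h.lt t r htr (by omega)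
  have h3 := h.lt s r (by omega) (by omega)
  have h4 := h.le s t hst
  have h5 := h.add_ne s t r hst htr hr
  have h6 := h.lt_of_add_two_le s t r hst
  have h7 := h.ne_add s t r hst htr hr
  rcases hV with hV | hV
  · rw [hV, hV, hV]
    refine ⟨h5, ?_, ?_⟩ <;> omega
  · rw [hV, hV, hV]
    rcases Nat.even_or_odd s with e1 | e1 <;> rcases Nat.even_or_odd t with e2 | e2 <;>
      rcases Nat.even_or_odd r with e3 | e3 <;>
      simp only [pow_succ, e1.neg_one_pow, e2.neg_one_pow, e3.neg_one_pow] <;>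
      (simp only [Nat.even_iff, Nat.odd_iff] at e1 e2 e3; refine ⟨?_, ?_, ?_⟩ <;> omega)

theorem RapidGrowth.encard_progressions_le {U V : ℕ → ℤ} (h : RapidGrowth U)
    (hV : (∀ n, V n = U n) ∨ ∀ n, V n = (-1) ^ (n + 1) * U n) :
    {p : ℕ × ℕ × ℕ | V p.1 < V p.2.1 ∧ V p.2.1 < V p.2.2 ∧
      V p.1 + V p.2.2 = 2 * V p.2.1}.encard ≤ (10 ^ 3 : ℕ) := by
  have hc : ((Finset.range 10 ×ˢ Finset.range 10 ×ˢ Finset.range 10 :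
      Finset (ℕ × ℕ × ℕ)) : Set (ℕ × ℕ × ℕ)).encard = (10 ^ 3 : ℕ) := by
    rw [Set.encard_coe_eq_coe_finsetCard]
    simp
  rw [← hc]
  refine Set.encard_le_encard ?_
  rintro ⟨k, l, m⟩ ⟨h1, h2, h3⟩
  simp only at h1 h2 h3
  have hkl : k ≠ l := by rintro rfl; exact lt_irrefl _ h1
  have hlm : l ≠ m := by rintro rfl; exact lt_irrefl _ h2
  have hkm : k ≠ m := by rintro rfl; exact lt_irrefl _ (h1.trans h2)
  simp only [Finset.coe_product, Finset.coe_range, Set.mem_prod, Set.mem_Iio]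
  by_contra hbig
  have key : ∀ s t r, s < t → t < r → 10 ≤ r → _ := fun s t r a b c => h.sign_ne hV (s := s) a b c
  rcases lt_or_gt_of_ne hkl with a1 | a1 <;> rcases lt_or_gt_of_ne hlm with a2 | a2 <;>
    rcases lt_or_gt_of_ne hkm with a3 | a3
  · exact (key k l m a1 a2 (by omega)).1 (by linarith)
  · omega
  · exact (key k m l a3 a2 (by omega)).2.2 (by linarith)
  · exact (key m k l a3 a1 (by omega)).2.2 (by linarith)
  · exact (key l k m a1 a3 (by omega)).2.1 (by linarith)
  · exact (key l m k a2 a3 (by omega)).2.1 (by linarith)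
  · omega
  · exact (key m l k a2 a1 (by omega)).1 (by linarith)

theorem rapidGrowth_of_two_mul_le {U : ℕ → ℤ} (h0 : U 0 = 0) (h1 : U 1 = 1)
    (hle : ∀ n, 2 * U n ≤ U (n + 1)) (hlt : ∀ n, 2 ≤ n → 2 * U n < U (n + 1)) :
    RapidGrowth U := by
  have hnonneg : ∀ n, 0 ≤ U n := by
    intro n
    induction n with
    | zero => rw [h0]
    | succ n ih => linarith [hle n]
  have hmono : Monotone U := monotone_nat_of_le_succ fun n => by linarith [hle n, hnonneg n]
  have hpos : ∀ n, 0 < n → 0 < U n := fun n hn => by linarith [hmono (show 1 ≤ n from hn)]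
  have hstep : ∀ t r, t < r → 2 * U t ≤ U r := fun t r h => (hle t).trans (hmono h)
  have hstep' : ∀ t r, t < r → 3 ≤ r → 2 * U t < U r := by
    intro t r h hr
    rcases Nat.lt_or_ge t 2 with ht | ht
    · have := hlt 2 le_rfl
      have h3 := hmono hr
      have h4 := hmono (show t ≤ 1 by omega)
      have h5 := hle 1
      norm_num at h5 this
      linarith
    · exact (hlt t ht).trans_le (hmono h)
  refine ⟨hnonneg, fun t r h hr => ?_, fun s t h => hmono h.le, fun s t r a b c => ?_,
    fun s t r a b => ?_, fun s t r a b c => ?_⟩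
  · linarith [hstep' t r h hr, hnonneg t]
  · linarith [hstep' t r b (by omega), hnonneg s]
  · linarith [hle t, hstep (t + 1) r (by omega), hpos t (by omega), hstep s t a, hnonneg s]
  · linarith [hstep' t r b (by omega), hstep s t a]

theorem rapidGrowth_of_one {B : ℤ} (hB : 3 ≤ B) : RapidGrowth (lucasU 1 B) := by
  have hrec : ∀ n, lucasU 1 B (n + 2) = lucasU 1 B (n + 1) + B * lucasU 1 B n := by
    intro n
    rw [lucasU, one_mul]
  have h0 : lucasU 1 B 0 = 0 := by rw [lucasU]
  have h1 : lucasU 1 B 1 = 1 := by rw [lucasU]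
  have h2 : lucasU 1 B 2 = 1 := by rw [hrec 0, h0, h1]; ring
  have h3 : lucasU 1 B 3 = 1 + B := by rw [hrec 1, h1, h2]; ring
  generalize lucasU 1 B = U at *
  have hnonneg : ∀ n, 0 ≤ U n := by
    intro n
    induction n using Nat.twoStepInduction with
    | zero => rw [h0]
    | one => rw [h1]; norm_num
    | more n ih1 ih2 => rw [hrec]; positivity
  have hmono : Monotone U := monotone_nat_of_le_succ fun n => by
    cases n with
    | zero => rw [h0]; exact hnonneg _
    | succ n => rw [hrec]; nlinarith [hnonneg n]
  have hpos : ∀ n, 0 < n → 0 < U n := fun n hn => by linarith [hmono (show 1 ≤ n from hn)]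
  have hstep : ∀ t r, t + 2 ≤ r → 4 * U t ≤ U r := by
    intro t r h
    have := hmono h
    have h5 := hmono (show t ≤ t + 1 by omega)
    rw [hrec] at this
    nlinarith [hnonneg t]
  refine ⟨hnonneg, fun t r h hr => ?_, fun s t h => hmono h.le, fun s t r a b c hs => ?_,
    fun s t r a b => ?_, fun s t r a b c hs => ?_⟩
  · rcases Nat.lt_or_ge t 2 with ht | ht
    · have := hmono hr
      have h4 := hmono (show t ≤ 1 by omega)
      linarith
    · refine lt_of_lt_of_le ?_ (hmono h)
      obtain ⟨t, rfl⟩ := Nat.exists_eq_add_of_le' ht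
      rw [show (t + 2).succ = (t + 1) + 2 by rfl, hrec (t + 1)]
      nlinarith [hpos (t + 1) (by omega)]
  · rcases (by omega : t + 2 ≤ r ∨ r = t + 1) with h | rfl
    · linarith [hstep t r h, hpos t (by omega), hnonneg s]
    · obtain ⟨t, rfl⟩ : ∃ k, t = k + 4 := ⟨t - 4, by omega⟩
      rw [hrec (t + 3), hrec (t + 2), hrec (t + 1), hrec t] at hs
      have e1 := hpos (t + 1) (by omega)
      have e2 := hnonneg s
      have e3 := hmono (show t ≤ t + 1 by omega)
      have e4 : (B ^ 2 - B - 1) * U (t + 1) + U s = B * U t := by linear_combination hs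
      have e5 : B * U t ≤ B * U (t + 1) := by gcongr
      have e6 : (B ^ 2 - 2 * B - 1) * U (t + 1) ≤ 0 := by linarith
      have e7 : 0 < B ^ 2 - 2 * B - 1 := by nlinarith
      nlinarith
  · linarith [hstep t r b, hmono a.le, hpos t (by omega)]
  · have e1 := hmono a.le
    rcases (by omega : t + 2 ≤ r ∨ r = t + 1) with h | rfl
    · linarith [hstep t r h, hpos t (by omega)]
    · obtain ⟨t, rfl⟩ : ∃ k, t = k + 2 := ⟨t - 2, by omega⟩
      rw [hrec (t + 1)] at hs
      have e2 := hmono (show s ≤ t + 1 by omega)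
      nlinarith [hpos (t + 1) (by omega)]

theorem rapidGrowth_lucasU {a B : ℤ} (ha : 0 < a) (hB : B ≠ 0) (hD : 0 < a ^ 2 + 4 * B)
    (hB1 : ¬ (a = 1 ∧ B = 1)) (hB2 : ¬ (a = 1 ∧ B = 2)) : RapidGrowth (lucasU a B) := by
  by_cases ha1 : a = 1
  · subst ha1
    exact rapidGrowth_of_one (by omega)
  have hrec : ∀ n, lucasU a B (n + 2) = a * lucasU a B (n + 1) + B * lucasU a B n := by
    intro n
    rw [lucasU]
  have h0 : lucasU a B 0 = 0 := by rw [lucasU]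
  have h1 : lucasU a B 1 = 1 := by rw [lucasU]
  have h2 : lucasU a B 2 = a := by rw [hrec 0, h0, h1]; ring
  generalize lucasU a B = U at *
  rcases lt_or_gt_of_ne hB with hB | hB
  · have ha3 : 3 ≤ a := by
      by_contra h
      have : a = 2 := by omega
      subst this
      omega
    have hstep : ∀ n, 0 ≤ U n ∧ a * U n < 2 * U (n + 1) := by
      intro n
      induction n with
      | zero => rw [h0, h1]; norm_num
      | succ n ih =>
        have hp : 0 < U (n + 1) := by nlinarith
        refine ⟨hp.le, ?_⟩
        rw [hrec]
        nlinarith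
    have hlt : ∀ n, 1 ≤ n → 2 * U n < U (n + 1) := by
      by_cases ha4 : 4 ≤ a
      · intro n _
        have := hstep n
        nlinarith
      · have ha : a = 3 := by omega
        subst ha
        intro n hn
        induction n, hn using Nat.le_induction with
        | base => rw [h1, h2]; norm_num
        | succ n _ ih =>
          rw [hrec]
          have : -2 ≤ B := by omega
          nlinarith [hstep n]
    refine rapidGrowth_of_two_mul_le h0 h1 (fun n => ?_) fun n hn => hlt n (by omega)
    cases n with
    | zero => rw [h0, h1]; norm_num
    | succ n => exact (hlt _ (by omega)).le
  · have hnonneg : ∀ n, 0 ≤ U n := by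
      intro n
      induction n using Nat.twoStepInduction with
      | zero => rw [h0]
      | one => rw [h1]; norm_num
      | more n ih1 ih2 => rw [hrec]; positivity
    have hle : ∀ n, 2 * U n + B * U (n - 1) ≤ U (n + 1) := by
      intro n
      cases n with
      | zero => rw [h0, h1]; norm_num
      | succ n =>
        rw [hrec, Nat.add_sub_cancel]
        nlinarith [hnonneg (n + 1), (by omega : 2 ≤ a)]
    have hpos : ∀ n, 0 < U (n + 1) := by
      intro n
      induction n with
      | zero => rw [h1]; norm_num
      | succ n ih =>
        have e := hle (n + 1)
        rw [Nat.add_sub_cancel] at e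
        nlinarith [hnonneg n]
    refine rapidGrowth_of_two_mul_le h0 h1 (fun n => ?_) fun n hn => ?_
    · nlinarith [hle n, hnonneg (n - 1)]
    · obtain ⟨n, rfl⟩ := Nat.exists_eq_add_of_le' hn
      have e := hle (n + 2)
      rw [show n + 2 - 1 = n + 1 by rfl] at e
      nlinarith [hpos n]

theorem encard_progressions_le (A B : ℤ) (hA : A ≠ 0) (hB : B ≠ 0)
    (hnd : ∀ α β : ℂ, α + β = (A : ℂ) → α * β = -(B : ℂ) →
      ∀ n : ℕ, 0 < n → (α / β) ^ n ≠ 1)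
    (h1 : (A, B) ≠ (1, 1)) (h2 : (A, B) ≠ (-1, 1)) (h3 : (A, B) ≠ (1, 2))
    (h4 : (A, B) ≠ (-1, 2)) (h5 : (A, B) ≠ (-1, -2)) :
    {p : ℕ × ℕ × ℕ | lucasU A B p.1 < lucasU A B p.2.1 ∧
        lucasU A B p.2.1 < lucasU A B p.2.2 ∧
        lucasU A B p.1 + lucasU A B p.2.2 = 2 * lucasU A B p.2.1}.encard ≤ (10 ^ 111 : ℕ) := by
  simp only [ne_eq, Prod.mk.injEq] at h1 h2 h3 h4 h5
  rcases lt_trichotomy (A ^ 2 + 4 * B) 0 with hD | hD | hD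
  · have hDr : (0 : ℝ) < -(A ^ 2 + 4 * B) := by
      have : ((A ^ 2 + 4 * B : ℤ) : ℝ) < 0 := by exact_mod_cast hD
      push_cast at this
      linarith
    have hsq := Real.sq_sqrt hDr.le
    obtain ⟨q, rfl⟩ : ∃ q, B = -q := ⟨-B, by ring⟩
    set y : ℝ := Real.sqrt (-(A ^ 2 + 4 * (-q : ℤ))) with hy
    have hs : (⟨A / 2, y / 2⟩ : ℂ) + starRingEnd ℂ (⟨A / 2, y / 2⟩ : ℂ) = A := by
      apply Complex.ext <;> simp
    have hp : (⟨A / 2, y / 2⟩ : ℂ) * starRingEnd ℂ (⟨A / 2, y / 2⟩ : ℂ) = q := by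
      apply Complex.ext
      · simp
        push_cast at hsq
        linarith
      · simp
        ring
    refine encard_progressions_of_im_ne_zero hs hp hA ?_ (by omega)
    intro n hn him
    refine hnd _ _ hs (by rw [hp]; simp) n hn ?_
    rw [div_pow, ← map_pow, Complex.conj_eq_iff_im.mpr him]
    refine div_self (pow_ne_zero _ ?_)
    intro h
    rw [h, zero_mul] at hp
    apply hB
    rw [neg_eq_zero]
    exact_mod_cast hp.symm
  · exfalso
    have hDc : (A : ℂ) ^ 2 + 4 * B = 0 := by exact_mod_cast hD
    refine hnd (A / 2) (A / 2) (by ring) (by linear_combination hDc / 4) 1 one_pos ?_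
    rw [pow_one, div_self]
    simpa using hA
  · have hle : ((10 ^ 3 : ℕ) : ℕ∞) ≤ (10 ^ 111 : ℕ) := by
      exact_mod_cast (by norm_num : 10 ^ 3 ≤ 10 ^ 111)
    rcases lt_or_gt_of_ne hA with hA | hA
    · obtain ⟨a, rfl⟩ : ∃ a, A = -a := ⟨-A, by ring⟩
      exact ((rapidGrowth_lucasU (a := a) (by omega) hB (by rwa [neg_sq] at hD) (by omega)
        (by omega)).encard_progressions_le (Or.inr (lucasU_neg_left a B))).trans hle
    · exact ((rapidGrowth_lucasU hA hB hD h1 h3).encard_progressions_le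
        (Or.inl fun _ => rfl)).trans hle

theorem pow_le_mul_pow (b : ℕ) {k m n : ℕ} (hb : 0 < b) (hk : 0 < k) (h : m ≤ n) :
    b ^ m ≤ k * b ^ n :=
  (Nat.pow_le_pow_right hb h).trans (Nat.le_mul_of_pos_left _ hk)

theorem stmt_0 (A B : ℤ) (hA : A ≠ 0) (hB : B ≠ 0)
    (hnd : ∀ α β : ℂ, α + β = (A : ℂ) → α * β = -(B : ℂ) →
      ∀ n : ℕ, 0 < n → (α / β) ^ n ≠ 1)
    (h1 : (A, B) ≠ (1, 1)) (h2 : (A, B) ≠ (-1, 1)) (h3 : (A, B) ≠ (1, 2))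
    (h4 : (A, B) ≠ (-1, 2)) (h5 : (A, B) ≠ (-1, -2)) :
    {p : ℕ × ℕ × ℕ | lucasU A B p.1 < lucasU A B p.2.1 ∧
        lucasU A B p.2.1 < lucasU A B p.2.2 ∧
        lucasU A B p.1 + lucasU A B p.2.2 = 2 * lucasU A B p.2.1}.Finite ∧
    {p : ℕ × ℕ × ℕ | lucasU A B p.1 < lucasU A B p.2.1 ∧
        lucasU A B p.2.1 < lucasU A B p.2.2 ∧
        lucasU A B p.1 + lucasU A B p.2.2 = 2 * lucasU A B p.2.1}.ncard
      ≤ 645 * 10 ^ 2338 := by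
  have h := encard_progressions_le A B hA hB hnd h1 h2 h3 h4 h5
  have hfin := Set.finite_of_encard_le_coe h
  refine ⟨hfin, ?_⟩
  rw [← hfin.cast_ncard_eq, Nat.cast_le] at h
  exact h.trans (pow_le_mul_pow 10 (by norm_num) (by norm_num) (by norm_num))
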